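/- Let N ≥ 1, Ω ⊂ ℝ^N a nonempty bounded open set, and λ₁ > 0. Let f : ℝ → ℝ be locally Lipschitz with f(0) = 0 and f(u) > 0 for u > 0, and suppose there are constants α > 2, β > 0, γ > 0 with β ≤ (α−2)λ₁/2 such that α F(u) ≤ u f(u) + β u² + γ for all u > 0 (condition (C)). Let u₀ be a nonnegative, not identically zero, continuously differentiable function on the closure of Ω with u₀ = 0 on ∂Ω satisfying J(0) := −(1/2)∫_Ω ‖∇u₀(x)‖² dx + ∫_Ω (F(u₀(x)) − γ) dx > 0. Set σ := √(α/2) − 1 and M := (α/(α−2))·(1+√(α/2))·(∫_Ω u₀² dx)² / (2α J(0)). Then for every T > 0: if u is continuous on cl(Ω)×[0,T), twice continuously differentiable in x and once continuously differentiable in t on Ω×(0,T), nonnegative, satisfies ∂_t u(x,t) = Δ_x u(x,t) + f(u(x,t)) for (x,t) ∈ Ω×(0,T), u(x,t) = 0 for x ∈ ∂Ω and t ∈ [0,T), u(x,0) = u₀(x), and λ₁ ∫_Ω u(x,t)² dx ≤ ∫_Ω ‖∇_x u(x,t)‖² dx for every t ∈ [0,T) (as holds when λ₁ is the first Dirichlet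 eigenvalue of −Δ on Ω), then T ≤ M/(σ ∫_Ω u₀² dx). In particular, no such nonnegative classical solution exists for all time, i.e. the solution blows up at some finite time T* ≤ M/(σ ∫_Ω u₀² dx) in the sense that ∫₀^t ∫_Ω u(x,s)² dx ds → +∞ as t → T*. -/

import Mathlib

open MeasureTheory Real Set

/-- The Laplacian of `w` at `x`, computed as the divergence of the gradient. -/
noncomputable def laplacian {N : ℕ} (w : EuclideanSpace ℝ (Fin N) → ℝ)
    (x : EuclideanSpace ℝ (Fin N)) : ℝ :=
  ∑ i, EuclideanSpace.proj i (fderiv ℝ (gradient w) x (EuclideanSpace.single i 1))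

/-- The heat operator `∂ₜ - Δ` on polynomials, the variable `none` being the time variable. -/
noncomputable def heatPoly (N : ℕ) :
    MvPolynomial (Option (Fin N)) ℝ →ₗ[ℝ] MvPolynomial (Option (Fin N)) ℝ :=
  (MvPolynomial.pderiv none).toLinearMap -
    ∑ i : Fin N, (MvPolynomial.pderiv (some i)).toLinearMap ∘ₗ
      (MvPolynomial.pderiv (some i)).toLinearMap

/-- The polynomial `|x|² - t`, whose zero set is a paraboloid. -/
noncomputable def paraboloidPoly (N : ℕ) : MvPolynomial (Option (Fin N)) ℝ :=
  ∑ i : Fin N, MvPolynomial.X (some i) ^ 2 - MvPolynomial.X none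

/-- Evaluation of a polynomial at a point of space-time. -/
noncomputable def evalPoly {N : ℕ} (p : MvPolynomial (Option (Fin N)) ℝ)
    (x : EuclideanSpace ℝ (Fin N)) (t : ℝ) : ℝ :=
  MvPolynomial.eval (fun o => o.elim t (fun i => x i)) p

open MvPolynomial in
lemma heatPoly_apply {N : ℕ} (p : MvPolynomial (Option (Fin N)) ℝ) :
    heatPoly N p = pderiv none p - ∑ i : Fin N, pderiv (some i) (pderiv (some i) p) := by
  simp [heatPoly]

/-- The parabolic weight: time counts twice. -/
def parabolicWeight (N : ℕ) : Option (Fin N) → ℕ := fun o => o.elim 2 (fun _ => 1)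

open MvPolynomial in
lemma isWeightedHomogeneous_heatPoly_mul {N n : ℕ} {p : MvPolynomial (Option (Fin N)) ℝ}
    (hp : p.IsWeightedHomogeneous (parabolicWeight N) n) :
    (heatPoly N (paraboloidPoly N * p)).IsWeightedHomogeneous (parabolicWeight N) n := by
  have hq : (paraboloidPoly N).IsWeightedHomogeneous (parabolicWeight N) 2 := by
    refine IsWeightedHomogeneous.sub (IsWeightedHomogeneous.sum _ _ _ fun i _ => ?_) ?_
    · exact (isWeightedHomogeneous_X ℝ (parabolicWeight N) (some i)).pow 2
    · exact isWeightedHomogeneous_X ℝ (parabolicWeight N) none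
  have h := hq.mul hp
  rw [heatPoly_apply]
  refine IsWeightedHomogeneous.sub (h.pderiv ?_)
    (IsWeightedHomogeneous.sum _ _ _ fun i _ => (h.pderiv (n' := n + 1) ?_).pderiv ?_)
  · simp [parabolicWeight]; omega
  · simp [parabolicWeight]; omega
  · simp [parabolicWeight]

open MvPolynomial in
lemma exists_heatPoly_mul_eq {N : ℕ}
    (hinj : ∀ p : MvPolynomial (Option (Fin N)) ℝ, heatPoly N (paraboloidPoly N * p) = 0 → p = 0)
    (r : MvPolynomial (Option (Fin N)) ℝ) :
    ∃ p, heatPoly N (paraboloidPoly N * p) = r := by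
  classical
  have hw : ∀ o, parabolicWeight N o ≠ 0 := by
    intro o; cases o <;> simp [parabolicWeight]
  let Lm : MvPolynomial (Option (Fin N)) ℝ →ₗ[ℝ] MvPolynomial (Option (Fin N)) ℝ :=
    heatPoly N ∘ₗ LinearMap.mulLeft ℝ (paraboloidPoly N)
  have key : ∀ n, ∀ r ∈ weightedHomogeneousSubmodule ℝ (parabolicWeight N) n,
      ∃ p, heatPoly N (paraboloidPoly N * p) = r := by
    intro n r hr
    have hfin : Module.Finite ℝ (weightedHomogeneousSubmodule ℝ (parabolicWeight N) n) :=
      Module.Finite.iff_fg.mpr (weightedHomogeneousSubmodule_fg ℝ (parabolicWeight N) hw n)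
    let Ln := Lm.restrict (p := weightedHomogeneousSubmodule ℝ (parabolicWeight N) n)
      (q := weightedHomogeneousSubmodule ℝ (parabolicWeight N) n)
      (fun p hp => isWeightedHomogeneous_heatPoly_mul hp)
    have hLn : Function.Injective Ln := by
      rw [← LinearMap.ker_eq_bot, LinearMap.ker_eq_bot']
      intro p hp
      exact Subtype.ext (hinj p (congrArg Subtype.val hp))
    obtain ⟨p, hp⟩ := LinearMap.injective_iff_surjective.mp hLn ⟨r, hr⟩
    exact ⟨p, congrArg Subtype.val hp⟩
  have hr := sum_weightedHomogeneousComponent (parabolicWeight N) r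
  rw [finsum_eq_sum _ (weightedHomogeneousComponent_finsupp r)] at hr
  choose P hP using fun n => key n _ (weightedHomogeneousComponent_mem (parabolicWeight N) r n)
  refine ⟨∑ n ∈ (weightedHomogeneousComponent_finsupp (w := parabolicWeight N) r).toFinset, P n, ?_⟩
  rw [Finset.mul_sum, map_sum]
  simp_rw [hP]
  exact hr

open MvPolynomial in
lemma contDiff_evalPoly {N : ℕ} (p : MvPolynomial (Option (Fin N)) ℝ) {n : WithTop ℕ∞} :
    ContDiff ℝ n (fun z : EuclideanSpace ℝ (Fin N) × ℝ => evalPoly p z.1 z.2) := by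
  unfold evalPoly
  induction p using MvPolynomial.induction_on with
  | C a => simpa using contDiff_const
  | add p q hp hq => simpa using hp.add hq
  | mul_X p o hp =>
    simp only [map_mul, eval_X]
    refine hp.mul ?_
    cases o with
    | none => simpa using contDiff_snd
    | some i =>
      simp only [Option.elim_some]
      exact (EuclideanSpace.proj (𝕜 := ℝ) i).contDiff.comp contDiff_fst

lemma contDiff_evalPoly_left {N : ℕ} (p : MvPolynomial (Option (Fin N)) ℝ) (t : ℝ)
    {n : WithTop ℕ∞} : ContDiff ℝ n (fun x => evalPoly p x t) :=
  (contDiff_evalPoly p).comp (f := fun x : EuclideanSpace ℝ (Fin N) => (x, t))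
    (contDiff_id.prodMk contDiff_const)

open MvPolynomial in
lemma hasDerivAt_evalPoly {N : ℕ} (p : MvPolynomial (Option (Fin N)) ℝ)
    (x : EuclideanSpace ℝ (Fin N)) (t : ℝ) :
    HasDerivAt (evalPoly p x) (evalPoly (pderiv none p) x t) t := by
  unfold evalPoly
  induction p using MvPolynomial.induction_on with
  | C a => simpa using hasDerivAt_const t a
  | add p q hp hq => simpa using hp.fun_add hq
  | mul_X p o hp =>
    simp only [map_mul, eval_X, Derivation.leibniz, map_add, smul_eq_mul]
    cases o with
    | none =>
      simp only [Option.elim_none, pderiv_X_self, map_one, mul_one]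
      exact (hp.fun_mul (hasDerivAt_id t)).congr_deriv (by simp [add_comm, mul_comm])
    | some i =>
      have : (pderiv (none : Option (Fin N))) (X (some i) : MvPolynomial _ ℝ) = 0 :=
        pderiv_X_of_ne (by simp)
      simp only [this, Option.elim_some, map_zero, mul_zero, zero_add]
      exact (hp.mul_const (x i)).congr_deriv (mul_comm _ _)

open MvPolynomial in
lemma fderiv_evalPoly {N : ℕ} (p : MvPolynomial (Option (Fin N)) ℝ)
    (x : EuclideanSpace ℝ (Fin N)) (t : ℝ) (i : Fin N) :
    fderiv ℝ (fun y => evalPoly p y t) x (EuclideanSpace.single i 1)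
      = evalPoly (pderiv (some i) p) x t := by
  induction p using MvPolynomial.induction_on with
  | C a => simp [evalPoly]
  | add p q hp hq =>
    have h := fderiv_fun_add (𝕜 := ℝ)
      ((contDiff_evalPoly_left p t (n := 1)).differentiable one_ne_zero x)
      ((contDiff_evalPoly_left q t (n := 1)).differentiable one_ne_zero x)
    have e : (fun y => evalPoly (p + q) y t) = fun y => evalPoly p y t + evalPoly q y t := by
      ext; simp [evalPoly]
    rw [e, h, add_apply, hp, hq]
    simp [evalPoly]
  | mul_X p o hp =>
    have h := fderiv_fun_mul (𝕜 := ℝ)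
      ((contDiff_evalPoly_left p t (n := 1)).differentiable one_ne_zero x)
      ((contDiff_evalPoly_left (X o) t (n := 1)).differentiable one_ne_zero x)
    have e : (fun y => evalPoly (p * X o) y t) = fun y => evalPoly p y t * evalPoly (X o) y t := by
      ext; simp [evalPoly]
    rw [e, h, add_apply, smul_apply,
      smul_apply, hp]
    have hX : fderiv ℝ (fun y => evalPoly (X o) y t) x (EuclideanSpace.single i 1)
        = evalPoly (pderiv (some i) (X o)) x t := by
      cases o with
      | none =>
        rw [pderiv_X_of_ne (by simp)]
        simp [evalPoly]
      | some j =>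
        have : (fun y : EuclideanSpace ℝ (Fin N) => evalPoly (X (some j)) y t)
            = EuclideanSpace.proj (𝕜 := ℝ) j := by ext; simp [evalPoly]
        rw [this, ContinuousLinearMap.fderiv]
        rw [pderiv_X]
        by_cases hij : j = i
        · subst hij; simp [evalPoly]
        · simp [evalPoly, hij]
    rw [hX]
    simp only [Derivation.leibniz, smul_eq_mul]
    simp [evalPoly]

lemma gradient_apply {N : ℕ} (w : EuclideanSpace ℝ (Fin N) → ℝ) (x : EuclideanSpace ℝ (Fin N))
    (i : Fin N) : gradient w x i = fderiv ℝ w x (EuclideanSpace.single i 1) := by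
  have h := InnerProductSpace.toDual_symm_apply (𝕜 := ℝ) (x := EuclideanSpace.single i (1:ℝ))
    (y := fderiv ℝ w x)
  rw [← h, gradient, real_inner_comm, EuclideanSpace.inner_single_left]
  simp

lemma norm_gradient_sq {N : ℕ} (w : EuclideanSpace ℝ (Fin N) → ℝ)
    (x : EuclideanSpace ℝ (Fin N)) :
    ‖gradient w x‖ ^ 2 = ∑ i, (fderiv ℝ w x (EuclideanSpace.single i 1)) ^ 2 := by
  rw [EuclideanSpace.norm_sq_eq]
  simp [gradient_apply]

lemma laplacian_eq_sum {N : ℕ} {w : EuclideanSpace ℝ (Fin N) → ℝ} {x : EuclideanSpace ℝ (Fin N)}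
    (hw : ContDiffAt ℝ 2 w x) :
    laplacian w x = ∑ i, fderiv ℝ (fun y => fderiv ℝ w y (EuclideanSpace.single i 1)) x
      (EuclideanSpace.single i 1) := by
  have hf : DifferentiableAt ℝ (fderiv ℝ w) x :=
    (hw.fderiv_right (m := 1) le_rfl).differentiableAt one_ne_zero
  have hg : DifferentiableAt ℝ (gradient w) x :=
    ((InnerProductSpace.toDual ℝ (EuclideanSpace ℝ (Fin N))).symm.differentiable _).comp x hf
  unfold laplacian
  refine Finset.sum_congr rfl fun i _ => ?_
  have h := ((EuclideanSpace.proj (𝕜 := ℝ) i).hasFDerivAt.comp x hg.hasFDerivAt).fderiv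
  have e : (fun y => fderiv ℝ w y (EuclideanSpace.single i 1))
      = (EuclideanSpace.proj (𝕜 := ℝ) i : EuclideanSpace ℝ (Fin N) →L[ℝ] ℝ) ∘ gradient w := by
    ext y; simp [gradient_apply]
  rw [e, h]
  rfl

lemma laplacian_evalPoly {N : ℕ} (p : MvPolynomial (Option (Fin N)) ℝ)
    (x : EuclideanSpace ℝ (Fin N)) (t : ℝ) :
    laplacian (fun y => evalPoly p y t) x =
      evalPoly (∑ i : Fin N, MvPolynomial.pderiv (some i) (MvPolynomial.pderiv (some i) p))
        x t := by
  rw [laplacian_eq_sum (contDiff_evalPoly_left p t).contDiffAt]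
  simp_rw [fderiv_evalPoly]
  simp [evalPoly]

open Filter Topology in
lemma laplacian_nonpos_of_isLocalMax {N : ℕ} {w : EuclideanSpace ℝ (Fin N) → ℝ}
    {x : EuclideanSpace ℝ (Fin N)} (hw : ContDiffAt ℝ 2 w x) (hx : IsLocalMax w x) :
    laplacian w x ≤ 0 := by
  rw [laplacian_eq_sum hw]
  refine Finset.sum_nonpos fun i _ => ?_
  set e : EuclideanSpace ℝ (Fin N) := EuclideanSpace.single i 1
  have hline : ∀ s : ℝ, HasDerivAt (fun s : ℝ => x + s • e) e s := fun s => by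
    simpa using ((hasDerivAt_id s).smul_const e).const_add x
  have hcont : Tendsto (fun s : ℝ => x + s • e) (𝓝 0) (𝓝 x) :=
    Continuous.tendsto' (by fun_prop) _ _ (by simp)
  have hd1 : ∀ᶠ s in 𝓝 (0:ℝ), HasDerivAt (fun s : ℝ => w (x + s • e))
      (fderiv ℝ w (x + s • e) e) s := by
    have : ∀ᶠ y in 𝓝 x, ContDiffAt ℝ 2 w y := hw.eventually (by simp)
    filter_upwards [hcont.eventually this] with s hs
    exact (hs.differentiableAt two_ne_zero).hasFDerivAt.comp_hasDerivAt s (hline s)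
  have hd1' : deriv (fun s : ℝ => w (x + s • e)) =ᶠ[𝓝 0] fun s => fderiv ℝ w (x + s • e) e :=
    hd1.mono fun s hs => hs.deriv
  have hf : DifferentiableAt ℝ (fun y => fderiv ℝ w y e) x :=
    ((hw.fderiv_right (m := 1) le_rfl).differentiableAt one_ne_zero).clm_apply
      (differentiableAt_const _)
  have hd2 : deriv (deriv (fun s : ℝ => w (x + s • e))) 0
      = fderiv ℝ (fun y => fderiv ℝ w y e) x e := by
    rw [hd1'.deriv_eq]
    have hf' : HasFDerivAt (fun y => fderiv ℝ w y e) (fderiv ℝ (fun y => fderiv ℝ w y e) x)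
        (x + (0:ℝ) • e) := by simpa using hf.hasFDerivAt
    exact (hf'.comp_hasDerivAt (0:ℝ) (hline 0)).deriv
  have hmax : IsLocalMax (fun s : ℝ => w (x + s • e)) 0 := by
    have := hcont.eventually hx
    filter_upwards [this] with s hs
    simpa using hs
  by_contra! hpos
  rw [← hd2] at hpos
  have hmin := isLocalMin_of_deriv_deriv_pos hpos hmax.deriv_eq_zero
    hd1.self_of_nhds.continuousAt
  have hconst : (fun s : ℝ => w (x + s • e)) =ᶠ[𝓝 0] fun _ => w (x + (0:ℝ) • e) := by
    filter_upwards [hmax, hmin] with s h1 h2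
    exact le_antisymm h1 h2
  have h0 : deriv (deriv (fun s : ℝ => w (x + s • e))) 0 = 0 := by
    rw [hconst.deriv.deriv_eq]
    simp
  exact hpos.ne' h0

lemma isCompact_paraboloid (N : ℕ) (τ : ℝ) :
    IsCompact {q : EuclideanSpace ℝ (Fin N) × ℝ | ‖q.1‖ ^ 2 ≤ q.2 ∧ q.2 ≤ τ} := by
  refine ((isCompact_closedBall (0 : EuclideanSpace ℝ (Fin N)) (√τ)).prod
    (isCompact_Icc (a := (0:ℝ)) (b := τ))).of_isClosed_subset ?_ ?_
  · have h1 : IsClosed {q : EuclideanSpace ℝ (Fin N) × ℝ | ‖q.1‖ ^ 2 ≤ q.2} :=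
      isClosed_le (by fun_prop) (by fun_prop)
    have h2 : IsClosed {q : EuclideanSpace ℝ (Fin N) × ℝ | q.2 ≤ τ} :=
      isClosed_le (by fun_prop) (by fun_prop)
    exact h1.inter h2
  · rintro ⟨x, t⟩ ⟨h1, h2⟩
    simp only at h1 h2
    refine ⟨?_, ?_, h2⟩
    · simpa using Real.le_sqrt_of_sq_le (h1.trans h2)
    · exact (sq_nonneg _).trans h1

open Filter Topology in
/-- The maximum principle for strict subsolutions of the heat equation on a paraboloid. -/
lemma nonpos_of_deriv_lt_laplacian {N : ℕ} {τ : ℝ} {z : EuclideanSpace ℝ (Fin N) → ℝ → ℝ}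
    (hc : ContinuousOn (fun q : EuclideanSpace ℝ (Fin N) × ℝ => z q.1 q.2)
      {q | ‖q.1‖ ^ 2 ≤ q.2 ∧ q.2 ≤ τ})
    (hz : ∀ x t, ‖x‖ ^ 2 < t → t ≤ τ → ContDiffAt ℝ 2 (fun y => z y t) x ∧
      ∃ z', HasDerivAt (z x) z' t ∧ z' < laplacian (fun y => z y t) x)
    (hb : ∀ x t, ‖x‖ ^ 2 = t → t ≤ τ → z x t ≤ 0) :
    ∀ x t, ‖x‖ ^ 2 ≤ t → t ≤ τ → z x t ≤ 0 := by
  intro x t hx ht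
  obtain ⟨⟨y, s⟩, ⟨hy, hs⟩, hmax⟩ := (isCompact_paraboloid N τ).exists_isMaxOn ⟨(x, t), hx, ht⟩ hc
  refine (hmax (show (x, t) ∈ _ from ⟨hx, ht⟩) : z x t ≤ z y s).trans ?_
  by_contra! hpos
  simp only at hy hs
  rcases hy.eq_or_lt with h | h
  · exact absurd (hb y s h hs) (not_le.mpr hpos)
  obtain ⟨h2, z', hz', hlt⟩ := hz y s h hs
  have hlap : laplacian (fun y => z y s) y ≤ 0 := by
    refine laplacian_nonpos_of_isLocalMax h2 ?_
    have : ∀ᶠ y' in 𝓝 y, ‖y'‖ ^ 2 < s :=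
      (Continuous.continuousAt (by fun_prop)).eventually_lt continuousAt_const h
    filter_upwards [this] with y' hy'
    exact hmax (show (y', s) ∈ _ from ⟨hy'.le, hs⟩)
  have hder : 0 ≤ z' := by
    have h1 := (hasDerivWithinAt_iff_tendsto_slope' (s := Iio s) (by simp)).mp
      hz'.hasDerivWithinAt
    refine ge_of_tendsto h1 ?_
    have : ∀ᶠ s' in 𝓝[<] s, s' ∈ Ioo (‖y‖ ^ 2) s := Ioo_mem_nhdsLT h
    filter_upwards [this] with s' hs'
    rw [slope_def_field]
    have h3 : z y s' ≤ z y s := hmax (show (y, s') ∈ _ from ⟨hs'.1.le, hs'.2.le.trans hs⟩)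
    exact div_nonneg_of_nonpos (by linarith) (by linarith [hs'.2])
  linarith

lemma laplacian_evalPoly_eq {N : ℕ} (p : MvPolynomial (Option (Fin N)) ℝ)
    (x : EuclideanSpace ℝ (Fin N)) (t : ℝ) :
    laplacian (fun y => evalPoly p y t) x =
      evalPoly (MvPolynomial.pderiv none p) x t - evalPoly (heatPoly N p) x t := by
  rw [laplacian_evalPoly, heatPoly_apply]
  simp [evalPoly]

lemma evalPoly_paraboloidPoly {N : ℕ} (x : EuclideanSpace ℝ (Fin N)) (t : ℝ) :
    evalPoly (paraboloidPoly N) x t = ‖x‖ ^ 2 - t := by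
  simp [evalPoly, paraboloidPoly, EuclideanSpace.norm_sq_eq]

lemma laplacian_add_const {N : ℕ} (w : EuclideanSpace ℝ (Fin N) → ℝ) (c : ℝ)
    (x : EuclideanSpace ℝ (Fin N)) : laplacian (fun y => w y + c) x = laplacian w x := by
  have : gradient (fun y => w y + c) = gradient w := by
    ext y i
    simp [gradient_apply]
  simp [laplacian, this]

lemma laplacian_sub {N : ℕ} {w v : EuclideanSpace ℝ (Fin N) → ℝ}
    {x : EuclideanSpace ℝ (Fin N)} (hw : ContDiffAt ℝ 2 w x) (hv : ContDiffAt ℝ 2 v x) :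
    laplacian (fun y => w y - v y) x = laplacian w x - laplacian v x := by
  rw [laplacian_eq_sum hw, laplacian_eq_sum hv, laplacian_eq_sum (hw.sub hv),
    ← Finset.sum_sub_distrib]
  refine Finset.sum_congr rfl fun i _ => ?_
  have hdiff : ∀ {u : EuclideanSpace ℝ (Fin N) → ℝ}, ContDiffAt ℝ 2 u x →
      DifferentiableAt ℝ (fun y => fderiv ℝ u y (EuclideanSpace.single i 1)) x := fun hu =>
    ((hu.fderiv_right (m := 1) le_rfl).differentiableAt one_ne_zero).clm_apply
      (differentiableAt_const _)
  have e : (fun y => fderiv ℝ (fun y => w y - v y) y (EuclideanSpace.single i 1))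
      =ᶠ[nhds x] fun y => fderiv ℝ w y (EuclideanSpace.single i 1)
        - fderiv ℝ v y (EuclideanSpace.single i 1) := by
    filter_upwards [hw.eventually (by simp), hv.eventually (by simp)] with y h1 h2
    rw [fderiv_fun_sub (h1.differentiableAt two_ne_zero) (h2.differentiableAt two_ne_zero)]
    rfl
  rw [e.fderiv_eq, fderiv_fun_sub (hdiff hw) (hdiff hv)]
  rfl

/-- Comparison estimate on a paraboloid for the heat equation with small data. -/
lemma le_of_heat_le {N : ℕ} {τ ε : ℝ} (hε : 0 < ε) {z : EuclideanSpace ℝ (Fin N) → ℝ → ℝ}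
    (hc : ContinuousOn (fun q : EuclideanSpace ℝ (Fin N) × ℝ => z q.1 q.2)
      {q | ‖q.1‖ ^ 2 ≤ q.2 ∧ q.2 ≤ τ})
    (hz : ∀ x t, ‖x‖ ^ 2 < t → t ≤ τ → ContDiffAt ℝ 2 (fun y => z y t) x ∧
      ∃ z', HasDerivAt (z x) z' t ∧ z' ≤ laplacian (fun y => z y t) x + ε)
    (hb : ∀ x t, ‖x‖ ^ 2 = t → t ≤ τ → z x t ≤ ε) :
    ∀ x t, ‖x‖ ^ 2 ≤ t → t ≤ τ → z x t ≤ ε + 2 * ε * t := by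
  have key := nonpos_of_deriv_lt_laplacian (τ := τ)
    (z := fun x t => z x t + (-(ε + 2 * ε * t))) ?_ ?_ ?_
  · intro x t h1 h2
    have := key x t h1 h2
    linarith
  · exact hc.add (by fun_prop)
  · intro x t h1 h2
    obtain ⟨h3, z', h4, h5⟩ := hz x t h1 h2
    refine ⟨h3.add contDiffAt_const, z' - 2 * ε, ?_, ?_⟩
    · have : HasDerivAt (fun t : ℝ => -(ε + 2 * ε * t)) (-(2 * ε)) t := by
        simpa using (((hasDerivAt_id t).const_mul (2 * ε)).const_add ε).fun_neg
      simpa [sub_eq_add_neg] using h4.fun_add this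
    · rw [laplacian_add_const]
      linarith
  · intro x t h1 h2
    have : 0 ≤ t := h1 ▸ sq_nonneg _
    have := hb x t h1 h2
    nlinarith

open MvPolynomial in
lemma eq_zero_of_heatPoly_mul_eq_zero {N : ℕ} (p : MvPolynomial (Option (Fin N)) ℝ)
    (hp : heatPoly N (paraboloidPoly N * p) = 0) : p = 0 := by
  have hle : ∀ (p : MvPolynomial (Option (Fin N)) ℝ), heatPoly N (paraboloidPoly N * p) = 0 →
      ∀ (x : EuclideanSpace ℝ (Fin N)) t, ‖x‖ ^ 2 ≤ t → t ≤ 1 →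
        evalPoly (paraboloidPoly N * p) x t ≤ 0 := by
    intro p hp x t hx ht
    refine le_of_forall_pos_le_add fun ε hε => ?_
    have := le_of_heat_le (τ := 1) (ε := ε / 3) (by positivity)
      (z := fun x t => evalPoly (paraboloidPoly N * p) x t)
      (contDiff_evalPoly _ (n := 0)).continuous.continuousOn ?_ ?_ x t hx ht
    · nlinarith
    · intro x t _ _
      refine ⟨(contDiff_evalPoly_left _ t).contDiffAt, _, hasDerivAt_evalPoly _ _ _, ?_⟩
      rw [laplacian_evalPoly_eq, hp]
      simp [evalPoly]
      positivity
    · intro x t h1 _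
      have : evalPoly (paraboloidPoly N * p) x t = 0 := by
        have := evalPoly_paraboloidPoly x t
        unfold evalPoly at this ⊢
        rw [map_mul, this, h1]
        simp
      rw [this]
      positivity
  have hzero : ∀ (x : EuclideanSpace ℝ (Fin N)) t, ‖x‖ ^ 2 < t → t ≤ 1 → evalPoly p x t = 0 := by
    intro x t hx ht
    have h1 := hle p hp x t hx.le ht
    have h2 := hle (-p) (by simp [hp]) x t hx.le ht
    have h3 := evalPoly_paraboloidPoly x t
    unfold evalPoly at h1 h2 h3 ⊢
    rw [map_mul, h3] at h1 h2
    rw [map_neg] at h2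
    have h4 : ‖x‖ ^ 2 - t ≠ 0 := by linarith
    have : (‖x‖ ^ 2 - t) * eval (fun o : Option (Fin N) => o.elim t fun i => x i) p = 0 := by
      linarith
    exact (mul_eq_zero.mp this).resolve_left h4
  refine funext_set (fun o : Option (Fin N) =>
    o.elim (Ioo (1/2 : ℝ) 1) (fun _ => Ioo (0 : ℝ) (1 / (2 * (N + 1))))) ?_ ?_
  · intro o
    cases o with
    | none => exact Ioo_infinite (by norm_num)
    | some i => exact Ioo_infinite (by positivity)
  · intro y hy
    rw [map_zero]
    have h1 : y none ∈ Ioo (1/2 : ℝ) 1 := hy none trivial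
    have h2 : ∀ i, y (some i) ∈ Ioo (0 : ℝ) (1 / (2 * (N + 1))) := fun i => hy (some i) trivial
    have h3 := hzero (WithLp.toLp 2 fun i => y (some i)) (y none) ?_ h1.2.le
    · rw [← h3, evalPoly]
      congr 1
      congr 1
      ext o
      cases o <;> simp
    · rw [EuclideanSpace.norm_sq_eq]
      have : ∀ i : Fin N, ‖y (some i)‖ ^ 2 ≤ 1 / (2 * (N + 1)) := by
        intro i
        have h4 := h2 i
        have h5 : (1:ℝ) / (2 * (N + 1)) ≤ 1 := by
          rw [div_le_one (by positivity)]
          linarith [(Nat.cast_nonneg N : (0:ℝ) ≤ N)]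
        rw [Real.norm_eq_abs, sq_abs]
        nlinarith [h4.1, h4.2]
      calc ∑ i : Fin N, ‖y (some i)‖ ^ 2 ≤ ∑ i : Fin N, 1 / (2 * ((N:ℝ) + 1)) :=
            Finset.sum_le_sum fun i _ => this i
        _ = N / (N + 1) * (1 / 2) := by
            simp; field_simp
        _ ≤ 1 * (1 / 2) := by
            gcongr
            rw [div_le_one (by positivity)]
            linarith
        _ < y none := by linarith [h1.1]

open MvPolynomial in
lemma exists_evalPoly_near {N : ℕ} {K : Set (EuclideanSpace ℝ (Fin N) × ℝ)} (hK : IsCompact K)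
    {g : EuclideanSpace ℝ (Fin N) × ℝ → ℝ} (hg : ContinuousOn g K) {ε : ℝ} (hε : 0 < ε) :
    ∃ p : MvPolynomial (Option (Fin N)) ℝ, ∀ q ∈ K, |evalPoly p q.1 q.2 - g q| < ε := by
  have : CompactSpace K := isCompact_iff_compactSpace.mp hK
  let coord : Option (Fin N) → C(K, ℝ) := fun o =>
    o.elim ⟨fun q => q.1.2, by fun_prop⟩ (fun i => ⟨fun q => q.1.1 i, by fun_prop⟩)
  let A : Subalgebra ℝ C(K, ℝ) := (aeval (R := ℝ) coord).range
  have heval : ∀ (p : MvPolynomial (Option (Fin N)) ℝ) (q : K),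
      (aeval (R := ℝ) coord p) q = evalPoly p q.1.1 q.1.2 := by
    intro p q
    induction p using MvPolynomial.induction_on with
    | C a => simp [evalPoly]
    | add p q hp hq => simp [evalPoly, hp, hq] at hp hq ⊢
    | mul_X p o hp =>
      rw [map_mul, ContinuousMap.mul_apply, hp]
      cases o <;> simp [evalPoly, coord]
  have hA : A.SeparatesPoints := by
    rintro ⟨⟨x, t⟩, h⟩ ⟨⟨y, s⟩, h'⟩ hne
    by_cases hts : t = s
    · have : ∃ i, x i ≠ y i := by
        by_contra! hxy
        exact hne (Subtype.ext (Prod.ext (PiLp.ext hxy) hts))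
      obtain ⟨i, hi⟩ := this
      exact ⟨coord (some i), ⟨coord (some i), ⟨X (some i), by simp⟩, rfl⟩, hi⟩
    · exact ⟨coord none, ⟨coord none, ⟨X none, by simp⟩, rfl⟩, hts⟩
  obtain ⟨⟨_, p, rfl⟩, hp⟩ :=
    ContinuousMap.exists_mem_subalgebra_near_continuous_of_separatesPoints A hA
      (K.domRestrict g) hg.domRestrict ε hε
  refine ⟨p, fun q hq => ?_⟩
  have := hp ⟨q, hq⟩
  rw [Real.norm_eq_abs] at this
  rw [← heval p ⟨q, hq⟩]
  exact this

/-- A classical solution of the inhomogeneous heat equation on a paraboloid is a uniform limit of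
polynomials solving nearby equations. -/
lemma exists_evalPoly_near_solution {N : ℕ} {τ : ℝ} {u g : EuclideanSpace ℝ (Fin N) → ℝ → ℝ}
    (hu : ContinuousOn (fun q : EuclideanSpace ℝ (Fin N) × ℝ => u q.1 q.2)
      {q | ‖q.1‖ ^ 2 ≤ q.2 ∧ q.2 ≤ τ})
    (hg : ContinuousOn (fun q : EuclideanSpace ℝ (Fin N) × ℝ => g q.1 q.2)
      {q | ‖q.1‖ ^ 2 ≤ q.2 ∧ q.2 ≤ τ})
    (hsol : ∀ x t, ‖x‖ ^ 2 < t → t ≤ τ → ContDiffAt ℝ 2 (fun y => u y t) x ∧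
      HasDerivAt (u x) (laplacian (fun y => u y t) x + g x t) t) {ε : ℝ} (hε : 0 < ε) :
    ∃ p : MvPolynomial (Option (Fin N)) ℝ, ∀ x t, ‖x‖ ^ 2 ≤ t → t ≤ τ →
      |evalPoly p x t - u x t| ≤ ε ∧ |evalPoly (heatPoly N p) x t - g x t| ≤ ε := by
  set δ : ℝ := ε / (1 + 2 * |τ|) with hδ
  have hδ0 : 0 < δ := by positivity
  have hδε : δ ≤ ε := div_le_self hε.le (by linarith [abs_nonneg τ])
  obtain ⟨b, hb⟩ := exists_evalPoly_near (isCompact_paraboloid N τ) hu hδ0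
  obtain ⟨r, hr⟩ := exists_evalPoly_near (isCompact_paraboloid N τ) hg hδ0
  obtain ⟨P, hP⟩ := exists_heatPoly_mul_eq eq_zero_of_heatPoly_mul_eq_zero (heatPoly N b - r)
  have hheat : heatPoly N (b - paraboloidPoly N * P) = r := by rw [map_sub, hP]; ring
  set p := b - paraboloidPoly N * P with hp
  have hpb : ∀ x t, ‖x‖ ^ 2 = t → evalPoly p x t = evalPoly b x t := by
    intro x t h
    have h1 := evalPoly_paraboloidPoly x t
    rw [h, sub_self] at h1
    unfold evalPoly at h1 ⊢
    rw [hp, map_sub, map_mul, h1]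
    ring
  have hpc : ContinuousOn (fun q : EuclideanSpace ℝ (Fin N) × ℝ => evalPoly p q.1 q.2)
      {q | ‖q.1‖ ^ 2 ≤ q.2 ∧ q.2 ≤ τ} := (contDiff_evalPoly p (n := 0)).continuous.continuousOn
  have h1 := le_of_heat_le (τ := τ) hδ0 (z := fun x t => evalPoly p x t - u x t)
    (hpc.sub hu) ?_ ?_
  · have h2 := le_of_heat_le (τ := τ) hδ0 (z := fun x t => u x t - evalPoly p x t)
      (hu.sub hpc) ?_ ?_
    · refine ⟨p, fun x t hx ht => ⟨?_, ?_⟩⟩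
      · have h3 := h1 x t hx ht
        have h4 := h2 x t hx ht
        have h5 : δ + 2 * δ * t ≤ ε := by
          have : δ * (1 + 2 * |τ|) = ε := by rw [hδ]; field_simp
          nlinarith [le_abs_self τ]
        rw [abs_le]
        constructor <;> linarith
      · rw [hheat]
        exact (hr (x, t) ⟨hx, ht⟩).le.trans hδε
    · intro x t hx ht
      obtain ⟨h3, h4⟩ := hsol x t hx ht
      refine ⟨h3.sub (contDiff_evalPoly_left p t).contDiffAt, _,
        h4.fun_sub (hasDerivAt_evalPoly p x t), ?_⟩
      rw [laplacian_sub h3 (contDiff_evalPoly_left p t).contDiffAt, laplacian_evalPoly_eq, hheat]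
      have := abs_lt.mp (hr (x, t) ⟨hx.le, ht⟩)
      simp only at this
      linarith [this.1]
    · intro x t hx ht
      have := abs_lt.mp (hb (x, t) ⟨hx.le, ht⟩)
      simp only at this
      rw [hpb x t hx]
      linarith [this.1]
  · intro x t hx ht
    obtain ⟨h3, h4⟩ := hsol x t hx ht
    refine ⟨(contDiff_evalPoly_left p t).contDiffAt.sub h3, _,
      (hasDerivAt_evalPoly p x t).fun_sub h4, ?_⟩
    rw [laplacian_sub (contDiff_evalPoly_left p t).contDiffAt h3, laplacian_evalPoly_eq, hheat]
    have := abs_lt.mp (hr (x, t) ⟨hx.le, ht⟩)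
    simp only at this
    linarith [this.2]
  · intro x t hx ht
    have := abs_lt.mp (hb (x, t) ⟨hx.le, ht⟩)
    simp only at this
    rw [hpb x t hx]
    linarith [this.2]

lemma continuous_mul_of_tsupport_subset {X : Type*} [TopologicalSpace X] {Ω : Set X}
    (hΩ : IsOpen Ω) {a b : X → ℝ} (ha : ContinuousOn a Ω) (hb : Continuous b)
    (hs : tsupport b ⊆ Ω) : Continuous (fun x => a x * b x) :=
  continuous_of_tsupport fun _ hx =>
    (ha.continuousAt (hΩ.mem_nhds (hs (tsupport_mul_subset_right hx)))).mul hb.continuousAt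

lemma integrable_mul_of_tsupport_subset {N : ℕ} {Ω : Set (EuclideanSpace ℝ (Fin N))}
    (hΩ : IsOpen Ω) {a b : EuclideanSpace ℝ (Fin N) → ℝ} (ha : ContinuousOn a Ω)
    (hb : Continuous b) (hc : HasCompactSupport b) (hs : tsupport b ⊆ Ω) :
    Integrable (fun x => a x * b x) :=
  (continuous_mul_of_tsupport_subset hΩ ha hb hs).integrable_of_hasCompactSupport hc.mul_left

lemma ContDiffOn.continuousOn_fderiv_apply {N : ℕ} {Ω : Set (EuclideanSpace ℝ (Fin N))}
    (hΩ : IsOpen Ω) {w : EuclideanSpace ℝ (Fin N) → ℝ} (hw : ContDiffOn ℝ 1 w Ω)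
    (v : EuclideanSpace ℝ (Fin N)) : ContinuousOn (fun x => fderiv ℝ w x v) Ω :=
  (hw.continuousOn_fderiv_of_isOpen hΩ le_rfl).clm_apply continuousOn_const

/-- Integration by parts against a compactly supported function. -/
lemma integral_mul_fderiv_of_tsupport_subset {N : ℕ} {Ω : Set (EuclideanSpace ℝ (Fin N))}
    (hΩ : IsOpen Ω) {w φ : EuclideanSpace ℝ (Fin N) → ℝ} (hw : ContDiffOn ℝ 1 w Ω)
    (hφ : ContDiff ℝ 1 φ) (hc : HasCompactSupport φ) (hs : tsupport φ ⊆ Ω)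
    (v : EuclideanSpace ℝ (Fin N)) :
    ∫ x, w x * fderiv ℝ φ x v = -∫ x, fderiv ℝ w x v * φ x := by
  refine integral_mul_fderiv_eq_neg_fderiv_mul_of_integrable ?_ ?_ ?_ ?_ ?_
  · exact integrable_mul_of_tsupport_subset hΩ (hw.continuousOn_fderiv_apply hΩ v)
      hφ.continuous hc hs
  · exact integrable_mul_of_tsupport_subset hΩ hw.continuousOn
      ((hφ.continuous_fderiv one_ne_zero).clm_apply continuous_const) (hc.fderiv_apply ℝ v)
      ((tsupport_fderiv_apply_subset ℝ v).trans hs)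
  · exact integrable_mul_of_tsupport_subset hΩ hw.continuousOn hφ.continuous hc hs
  · exact fun x hx => (hw.contDiffAt (hΩ.mem_nhds (hs hx))).differentiableAt one_ne_zero
  · exact fun x _ => (hφ.differentiable one_ne_zero) x

lemma ContDiff.fderiv_apply_const {N : ℕ} {φ : EuclideanSpace ℝ (Fin N) → ℝ}
    (hφ : ContDiff ℝ 2 φ) (v : EuclideanSpace ℝ (Fin N)) :
    ContDiff ℝ 1 (fun x => fderiv ℝ φ x v) :=
  (hφ.fderiv_right (m := 1) (by norm_num)).clm_apply contDiff_const

lemma ContDiff.continuous_laplacian {N : ℕ} {φ : EuclideanSpace ℝ (Fin N) → ℝ}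
    (hφ : ContDiff ℝ 2 φ) : Continuous (laplacian φ) := by
  have : laplacian φ = fun x => ∑ i : Fin N,
      fderiv ℝ (fun y => fderiv ℝ φ y (EuclideanSpace.single i 1)) x (EuclideanSpace.single i 1) :=
    funext fun x => laplacian_eq_sum hφ.contDiffAt
  rw [this]
  exact continuous_finsetSum _ fun i _ =>
    ((hφ.fderiv_apply_const _).continuous_fderiv one_ne_zero).clm_apply continuous_const

lemma tsupport_laplacian_subset {N : ℕ} (φ : EuclideanSpace ℝ (Fin N) → ℝ) :
    tsupport (laplacian φ) ⊆ tsupport φ := by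
  refine closure_minimal (fun x hx => ?_) (isClosed_tsupport φ)
  by_contra h
  refine hx ?_
  have h1 : φ =ᶠ[nhds x] 0 := notMem_tsupport_iff_eventuallyEq.mp h
  have h2 : gradient φ =ᶠ[nhds x] 0 := by
    filter_upwards [h1.eventuallyEq_nhds] with y hy
    simp [gradient, hy.fderiv_eq]
  simp [laplacian, h2.fderiv_eq]

lemma HasCompactSupport.laplacian {N : ℕ} {φ : EuclideanSpace ℝ (Fin N) → ℝ}
    (hc : HasCompactSupport φ) : HasCompactSupport (laplacian φ) :=
  hc.of_isClosed_subset (isClosed_tsupport _) (tsupport_laplacian_subset φ)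

/-- Green's first identity against a compactly supported function. -/
lemma integral_mul_laplacian_of_tsupport_subset {N : ℕ} {Ω : Set (EuclideanSpace ℝ (Fin N))}
    (hΩ : IsOpen Ω) {w φ : EuclideanSpace ℝ (Fin N) → ℝ} (hw : ContDiffOn ℝ 1 w Ω)
    (hφ : ContDiff ℝ 2 φ) (hc : HasCompactSupport φ) (hs : tsupport φ ⊆ Ω) :
    ∫ x, w x * laplacian φ x = -∫ x, ∑ i : Fin N,
      fderiv ℝ w x (EuclideanSpace.single i 1) * fderiv ℝ φ x (EuclideanSpace.single i 1) := by
  have h1 : ∀ x, w x * laplacian φ x = ∑ i : Fin N, w x *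
      fderiv ℝ (fun y => fderiv ℝ φ y (EuclideanSpace.single i 1)) x
        (EuclideanSpace.single i 1) := fun x => by
    rw [laplacian_eq_sum hφ.contDiffAt, Finset.mul_sum]
  simp_rw [h1]
  have hc' := fun v => hc.fderiv_apply ℝ v
  have hs' := fun v => (tsupport_fderiv_apply_subset ℝ (f := φ) v).trans hs
  rw [integral_finsetSum, integral_finsetSum, ← Finset.sum_neg_distrib]
  · refine Finset.sum_congr rfl fun i _ => ?_
    exact integral_mul_fderiv_of_tsupport_subset hΩ hw (hφ.fderiv_apply_const _) (hc' _) (hs' _) _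
  · intro i _
    exact integrable_mul_of_tsupport_subset hΩ (hw.continuousOn_fderiv_apply hΩ _)
      (hφ.fderiv_apply_const _).continuous (hc' _) (hs' _)
  · intro i _
    exact integrable_mul_of_tsupport_subset hΩ hw.continuousOn
      (((hφ.fderiv_apply_const _).continuous_fderiv one_ne_zero).clm_apply continuous_const)
      ((hc' _).fderiv_apply ℝ _) ((tsupport_fderiv_apply_subset ℝ _).trans (hs' _))

/-- Green's second identity against a compactly supported function. -/
lemma integral_mul_laplacian_comm {N : ℕ} {w φ : EuclideanSpace ℝ (Fin N) → ℝ}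
    (hw : ContDiff ℝ 2 w) (hφ : ContDiff ℝ 2 φ) (hc : HasCompactSupport φ) :
    ∫ x, w x * laplacian φ x = ∫ x, laplacian w x * φ x := by
  rw [integral_mul_laplacian_of_tsupport_subset isOpen_univ
    (hw.of_le (by norm_num)).contDiffOn hφ hc (subset_univ _)]
  have h1 : ∀ x, laplacian w x * φ x = ∑ i : Fin N,
      fderiv ℝ (fun y => fderiv ℝ w y (EuclideanSpace.single i 1)) x
        (EuclideanSpace.single i 1) * φ x := fun x => by
    rw [laplacian_eq_sum hw.contDiffAt, Finset.sum_mul]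
  simp_rw [h1]
  have hw' : ∀ v, ContDiffOn ℝ 1 (fun x => fderiv ℝ w x v) univ :=
    fun v => (hw.fderiv_apply_const v).contDiffOn
  have hφ1 : ContDiff ℝ 1 φ := hφ.of_le (by norm_num)
  rw [integral_finsetSum, integral_finsetSum, ← Finset.sum_neg_distrib]
  · refine Finset.sum_congr rfl fun i _ => ?_
    rw [integral_mul_fderiv_of_tsupport_subset isOpen_univ (hw' _) hφ1 hc (subset_univ _), neg_neg]
  · intro i _
    exact integrable_mul_of_tsupport_subset isOpen_univ
      ((hw' _).continuousOn_fderiv_apply isOpen_univ _) hφ.continuous hc (subset_univ _)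
  · intro i _
    exact integrable_mul_of_tsupport_subset isOpen_univ (hw' _).continuousOn
      (hφ.fderiv_apply_const _).continuous (hc.fderiv_apply ℝ _) (subset_univ _)

lemma integrable_restrict_prod_of_continuous {N : ℕ} {h : ℝ × EuclideanSpace ℝ (Fin N) → ℝ}
    (hh : Continuous h) {K : Set (EuclideanSpace ℝ (Fin N))} (hK : IsCompact K)
    (h0 : ∀ r, ∀ x ∉ K, h (r, x) = 0) (a b : ℝ) :
    Integrable h ((volume.restrict (uIoc a b)).prod volume) := by
  have h1 : IntegrableOn h (uIcc a b ×ˢ K) ((volume : Measure ℝ).prod volume) :=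
    hh.continuousOn.integrableOn_compact (isCompact_uIcc.prod hK)
  have h2 : IntegrableOn h (uIoc a b ×ˢ univ) ((volume : Measure ℝ).prod volume) := by
    refine h1.of_forall_sdiff_eq_zero (measurableSet_uIoc.prod MeasurableSet.univ) ?_
    rintro ⟨r, x⟩ ⟨⟨hr, -⟩, hx⟩
    exact h0 r x fun hxK => hx ⟨uIoc_subset_uIcc hr, hxK⟩
  rwa [IntegrableOn, ← Measure.prod_restrict, Measure.restrict_univ] at h2

lemma continuous_integral_of_compact {N : ℕ} {h : ℝ → EuclideanSpace ℝ (Fin N) → ℝ}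
    (hh : Continuous (Function.uncurry h)) {K : Set (EuclideanSpace ℝ (Fin N))} (hK : IsCompact K)
    (h0 : ∀ r, ∀ x ∉ K, h r x = 0) : Continuous (fun r => ∫ x, h r x) := by
  have : (fun r => ∫ x, h r x) = fun r => ∫ x in K, h r x :=
    funext fun r => (setIntegral_eq_integral_of_forall_compl_eq_zero (h0 r)).symm
  rw [this]
  exact continuous_parametric_integral_of_continuous hh hK

lemma evalPoly_weak_form {N : ℕ} (p : MvPolynomial (Option (Fin N)) ℝ)
    {φ : EuclideanSpace ℝ (Fin N) → ℝ} (hφ : ContDiff ℝ 2 φ) (hc : HasCompactSupport φ) (s t : ℝ) :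
    (∫ x, evalPoly p x t * φ x) - ∫ x, evalPoly p x s * φ x =
      ∫ r in s..t, ((∫ x, evalPoly p x r * laplacian φ x) +
        ∫ x, evalPoly (heatPoly N p) x r * φ x) := by
  have hpc : ∀ (q : MvPolynomial (Option (Fin N)) ℝ),
      Continuous fun z : EuclideanSpace ℝ (Fin N) × ℝ => evalPoly q z.1 z.2 :=
    fun q => (contDiff_evalPoly q (n := 0)).continuous
  have hInt : ∀ (q : MvPolynomial (Option (Fin N)) ℝ) (r : ℝ),
      Integrable fun x => evalPoly q x r * φ x := fun q r =>
    (((hpc q).comp (Continuous.prodMk_left r)).mul hφ.continuous).integrable_of_hasCompactSupport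
      hc.mul_left
  have h1 : ∀ r, (∫ x, evalPoly p x r * laplacian φ x) + ∫ x, evalPoly (heatPoly N p) x r * φ x =
      ∫ x, evalPoly (MvPolynomial.pderiv none p) x r * φ x := by
    intro r
    rw [integral_mul_laplacian_comm (contDiff_evalPoly_left p r) hφ hc, ← integral_add]
    · simp_rw [laplacian_evalPoly_eq]
      congr 1 with x
      ring
    · simp_rw [laplacian_evalPoly_eq, sub_mul]
      exact (hInt _ r).sub (hInt _ r)
    · exact hInt _ r
  simp_rw [h1]
  rw [intervalIntegral_integral_swap, ← integral_sub (hInt p t) (hInt p s)]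
  · congr 1 with x
    rw [intervalIntegral.integral_mul_const, intervalIntegral.integral_eq_sub_of_hasDerivAt
      (fun r _ => hasDerivAt_evalPoly p x r)
      (((hpc _).comp (Continuous.prodMk_right x)).intervalIntegrable _ _), sub_mul]
  · refine integrable_restrict_prod_of_continuous (K := tsupport φ) ?_ hc ?_ s t
    · exact ((hpc _).comp (continuous_snd.prodMk continuous_fst)).mul
        (hφ.continuous.comp continuous_snd)
    · intro r x hx
      simp [image_eq_zero_of_notMem_tsupport hx]

lemma abs_integral_mul_sub_le {N : ℕ} {a b ψ : EuclideanSpace ℝ (Fin N) → ℝ} {ε : ℝ}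
    (ha : Integrable fun x => a x * ψ x) (hb : Integrable fun x => b x * ψ x)
    (hψ : Integrable ψ) (h : ∀ x ∈ tsupport ψ, |a x - b x| ≤ ε) :
    |(∫ x, a x * ψ x) - ∫ x, b x * ψ x| ≤ ε * ∫ x, |ψ x| := by
  rw [← integral_sub ha hb, ← integral_const_mul]
  refine (abs_integral_le_integral_abs).trans (integral_mono (ha.sub hb).abs
    (hψ.abs.const_mul ε) fun x => ?_)
  simp only
  by_cases hx : x ∈ tsupport ψ
  · rw [← sub_mul, abs_mul]
    exact mul_le_mul_of_nonneg_right (h x hx) (abs_nonneg _)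
  · simp [image_eq_zero_of_notMem_tsupport hx]

/-- The weak form of the heat equation on a paraboloid. -/
lemma weak_form_paraboloid {N : ℕ} {τ : ℝ} {u g : EuclideanSpace ℝ (Fin N) → ℝ → ℝ}
    (hu : Continuous (Function.uncurry u)) (hg : Continuous (Function.uncurry g))
    (hsol : ∀ x t, ‖x‖ ^ 2 < t → t ≤ τ → ContDiffAt ℝ 2 (fun y => u y t) x ∧
      HasDerivAt (u x) (laplacian (fun y => u y t) x + g x t) t)
    {φ : EuclideanSpace ℝ (Fin N) → ℝ} (hφ : ContDiff ℝ 2 φ) (hc : HasCompactSupport φ)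
    {s t : ℝ} (hφs : ∀ x ∈ tsupport φ, ‖x‖ ^ 2 ≤ s) (hst : s ≤ t) (htτ : t ≤ τ) :
    (∫ x, u x t * φ x) - ∫ x, u x s * φ x =
      ∫ r in s..t, ((∫ x, u x r * laplacian φ x) + ∫ x, g x r * φ x) := by
  have hpc : ∀ (q : MvPolynomial (Option (Fin N)) ℝ),
      Continuous (Function.uncurry (evalPoly (N := N) q)) :=
    fun q => (contDiff_evalPoly q (n := 0)).continuous
  have hInt : ∀ {v : EuclideanSpace ℝ (Fin N) → ℝ → ℝ} {ψ : EuclideanSpace ℝ (Fin N) → ℝ}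
      (r : ℝ), Continuous (Function.uncurry v) → Continuous ψ → HasCompactSupport ψ →
      Integrable fun x => v x r * ψ x := fun r hv hψ hψc =>
    ((hv.comp (Continuous.prodMk_left r)).mul hψ).integrable_of_hasCompactSupport hψc.mul_left
  have hcont : ∀ {v : EuclideanSpace ℝ (Fin N) → ℝ → ℝ} {ψ : EuclideanSpace ℝ (Fin N) → ℝ},
      Continuous (Function.uncurry v) → Continuous ψ → HasCompactSupport ψ →
      Continuous fun r => ∫ x, v x r * ψ x := fun {v ψ} hv hψ hψc => by
    refine continuous_integral_of_compact (K := tsupport ψ) ?_ hψc ?_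
    · exact (hv.comp (continuous_snd.prodMk continuous_fst)).mul (hψ.comp continuous_snd)
    · intro r x hx
      simp [image_eq_zero_of_notMem_tsupport hx]
  have hL := hφ.continuous_laplacian
  have hLc := hc.laplacian
  set A := ∫ x, |φ x|
  set B := ∫ x, |laplacian φ x|
  have hA : 0 ≤ A := integral_nonneg fun _ => abs_nonneg _
  have hB : 0 ≤ B := integral_nonneg fun _ => abs_nonneg _
  have hφi : Integrable φ := hφ.continuous.integrable_of_hasCompactSupport hc
  have hLi : Integrable (laplacian φ) := hL.integrable_of_hasCompactSupport hLc
  rw [← sub_eq_zero, ← abs_nonpos_iff]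
  refine le_of_forall_pos_le_add fun ε hε => ?_
  rw [zero_add]
  set C := 2 * A + (B + A) * (t - s) with hC
  have hC0 : 0 ≤ C := by have := sub_nonneg.mpr hst; positivity
  obtain ⟨p, hp⟩ := exists_evalPoly_near_solution (ε := ε / (C + 1))
    hu.continuousOn hg.continuousOn hsol (by positivity)
  have hnear : ∀ r ∈ Icc s t,
      |(∫ x, evalPoly p x r * φ x) - ∫ x, u x r * φ x| ≤ ε / (C + 1) * A ∧
      |((∫ x, evalPoly p x r * laplacian φ x) + ∫ x, evalPoly (heatPoly N p) x r * φ x) -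
        ((∫ x, u x r * laplacian φ x) + ∫ x, g x r * φ x)| ≤ ε / (C + 1) * (B + A) := by
    intro r hr
    have h1 : |(∫ x, evalPoly p x r * φ x) - ∫ x, u x r * φ x| ≤ ε / (C + 1) * A :=
      abs_integral_mul_sub_le (hInt r (hpc p) hφ.continuous hc) (hInt r hu hφ.continuous hc) hφi
        fun x hx => (hp x r ((hφs x hx).trans hr.1) (hr.2.trans htτ)).1
    have h2 : |(∫ x, evalPoly p x r * laplacian φ x) - ∫ x, u x r * laplacian φ x| ≤
        ε / (C + 1) * B :=
      abs_integral_mul_sub_le (hInt r (hpc p) hL hLc) (hInt r hu hL hLc) hLi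
        fun x hx => (hp x r ((hφs x (tsupport_laplacian_subset φ hx)).trans hr.1)
          (hr.2.trans htτ)).1
    have h3 : |(∫ x, evalPoly (heatPoly N p) x r * φ x) - ∫ x, g x r * φ x| ≤ ε / (C + 1) * A :=
      abs_integral_mul_sub_le (hInt r (hpc _) hφ.continuous hc) (hInt r hg hφ.continuous hc) hφi
        fun x hx => (hp x r ((hφs x hx).trans hr.1) (hr.2.trans htτ)).2
    refine ⟨h1, ?_⟩
    rw [add_sub_add_comm, mul_add]
    exact (abs_add_le _ _).trans (add_le_add h2 h3)
  have hw := evalPoly_weak_form p hφ hc s t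
  have hI : |(∫ r in s..t, ((∫ x, evalPoly p x r * laplacian φ x) +
        ∫ x, evalPoly (heatPoly N p) x r * φ x)) -
      ∫ r in s..t, ((∫ x, u x r * laplacian φ x) + ∫ x, g x r * φ x)| ≤
      ε / (C + 1) * (B + A) * (t - s) := by
    rw [← intervalIntegral.integral_sub]
    · rw [← Real.norm_eq_abs, ← abs_of_nonneg (sub_nonneg.mpr hst)]
      refine intervalIntegral.norm_integral_le_of_norm_le_const fun r hr => ?_
      rw [uIoc_of_le hst] at hr
      exact (hnear r ⟨hr.1.le, hr.2⟩).2
    · exact ((hcont (hpc p) hL hLc).add (hcont (hpc _) hφ.continuous hc)).intervalIntegrable _ _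
    · exact ((hcont hu hL hLc).add (hcont hg hφ.continuous hc)).intervalIntegrable _ _
  have ht := abs_le.mp (hnear t ⟨hst, le_rfl⟩).1
  have hs := abs_le.mp (hnear s ⟨le_rfl, hst⟩).1
  have hI := abs_le.mp hI
  have hε' : ε / (C + 1) * A + ε / (C + 1) * A + ε / (C + 1) * (B + A) * (t - s) ≤ ε := by
    have : ε / (C + 1) * A + ε / (C + 1) * A + ε / (C + 1) * (B + A) * (t - s) =
      ε * (C / (C + 1)) := by rw [hC]; ring
    rw [this]
    exact mul_le_of_le_one_right hε.le (div_le_one_of_le₀ (by linarith) (by linarith))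
  rw [abs_le]
  constructor <;> linarith [ht.1, ht.2, hs.1, hs.2, hI.1, hI.2]

lemma laplacian_comp_add_left {N : ℕ} (w : EuclideanSpace ℝ (Fin N) → ℝ)
    (a x : EuclideanSpace ℝ (Fin N)) : laplacian (fun y => w (a + y)) x = laplacian w (a + x) := by
  have h : gradient (fun y => w (a + y)) = fun y => gradient w (a + y) := by
    ext1 y
    simp [gradient, fderiv_comp_add_left]
  simp [laplacian, h, fderiv_comp_add_left]

lemma laplacian_add {N : ℕ} {v w : EuclideanSpace ℝ (Fin N) → ℝ} {x : EuclideanSpace ℝ (Fin N)}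
    (hv : ContDiffAt ℝ 2 v x) (hw : ContDiffAt ℝ 2 w x) :
    laplacian (fun y => v y + w y) x = laplacian v x + laplacian w x := by
  have h := laplacian_sub (hv.add hw) hw
  simp only [add_sub_cancel_right] at h
  have h' : laplacian v x = laplacian (fun y => v y + w y) x - laplacian w x := h
  linarith

/-- A nonnegative classical solution of `∂ₜU = ΔU + f(U)` on `Ω × (0, b)` with finite Dirichlet
energy and zero boundary values, extended by zero outside of `Ω`. -/
structure IsHeatSolution {N : ℕ} (Ω : Set (EuclideanSpace ℝ (Fin N))) (b : ℝ) (f : ℝ → ℝ)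
    (U : EuclideanSpace ℝ (Fin N) → ℝ → ℝ) : Prop where
  isOpen : IsOpen Ω
  isBounded : Bornology.IsBounded Ω
  locallyLipschitz : LocallyLipschitz f
  map_zero : f 0 = 0
  continuous : Continuous (Function.uncurry U)
  eq_zero : ∀ x ∉ Ω, ∀ t, U x t = 0
  nonneg : ∀ x t, 0 ≤ U x t
  contDiffOn_zero : ContDiffOn ℝ 1 (fun x => U x 0) Ω
  contDiffAt : ∀ x ∈ Ω, ∀ t ∈ Ioo 0 b, ContDiffAt ℝ 2 (fun y => U y t) x
  hasDerivAt : ∀ x ∈ Ω, ∀ t ∈ Ioo 0 b,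
    HasDerivAt (U x) (laplacian (fun y => U y t) x + f (U x t)) t
  integrableOn_gradient : ∀ t ∈ Ico 0 b,
    IntegrableOn (fun x => ‖gradient (fun y => U y t) x‖ ^ 2) Ω

namespace IsHeatSolution

variable {N : ℕ} {Ω : Set (EuclideanSpace ℝ (Fin N))} {b : ℝ} {f : ℝ → ℝ}
  {U : EuclideanSpace ℝ (Fin N) → ℝ → ℝ}

lemma isCompact_closure (hU : IsHeatSolution Ω b f U) : IsCompact (closure Ω) :=
  hU.isBounded.isCompact_closure

lemma continuous_slice (hU : IsHeatSolution Ω b f U) (t : ℝ) : Continuous fun x => U x t :=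
  hU.continuous.comp (Continuous.prodMk_left t)

lemma continuous_comp (hU : IsHeatSolution Ω b f U) :
    Continuous (Function.uncurry fun x t => f (U x t)) :=
  hU.locallyLipschitz.continuous.comp hU.continuous

lemma continuous_integral_mul (hU : IsHeatSolution Ω b f U)
    {φ : EuclideanSpace ℝ (Fin N) → ℝ} (hφ : Continuous φ) :
    Continuous fun t => ∫ x, U x t * φ x := by
  refine continuous_integral_of_compact (K := closure Ω) ?_ hU.isCompact_closure ?_
  · exact (hU.continuous.comp (continuous_snd.prodMk continuous_fst)).mul (hφ.comp continuous_snd)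
  · intro r x hx
    simp [hU.eq_zero x (fun h => hx (subset_closure h))]

lemma continuous_integral_comp_mul (hU : IsHeatSolution Ω b f U)
    {φ : EuclideanSpace ℝ (Fin N) → ℝ} (hφ : Continuous φ) :
    Continuous fun t => ∫ x, f (U x t) * φ x := by
  refine continuous_integral_of_compact (K := closure Ω) ?_ hU.isCompact_closure ?_
  · exact (hU.continuous_comp.comp (continuous_snd.prodMk continuous_fst)).mul
      (hφ.comp continuous_snd)
  · intro r x hx
    simp [hU.eq_zero x (fun h => hx (subset_closure h)), hU.map_zero]

lemma exists_isOpen_weak_form (hU : IsHeatSolution Ω b f U) {t : ℝ} (ht : t ∈ Ioo 0 b)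
    {x₀ : EuclideanSpace ℝ (Fin N)} (hx₀ : x₀ ∈ Ω) :
    ∃ V : Set (EuclideanSpace ℝ (Fin N)), IsOpen V ∧ x₀ ∈ V ∧
      ∀ φ : EuclideanSpace ℝ (Fin N) → ℝ, ContDiff ℝ 2 φ → HasCompactSupport φ → tsupport φ ⊆ V →
        HasDerivAt (fun t => ∫ x, U x t * φ x)
          ((∫ x, U x t * laplacian φ x) + ∫ x, f (U x t) * φ x) t := by
  obtain ⟨R, hR, hball⟩ := Metric.isOpen_iff.mp hU.isOpen x₀ hx₀
  obtain ⟨ρ, hρ, hρ'⟩ : ∃ ρ > 0, ρ < min (min t (b - t)) (R ^ 2 / 2) :=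
    exists_between (by have := ht.1; have := sub_pos.mpr ht.2; positivity)
  obtain ⟨⟨hρt, hρb⟩, hρR⟩ : (ρ < t ∧ ρ < b - t) ∧ ρ < R ^ 2 / 2 := by
    simpa only [lt_min_iff] using hρ'
  refine ⟨{x | ‖-x₀ + x‖ ^ 2 < ρ / 2}, isOpen_lt (by fun_prop) (by fun_prop), by simp [hρ], ?_⟩
  intro φ hφ hc hs
  set c : ℝ → ℝ := fun r => (∫ x, U x r * laplacian φ x) + ∫ x, f (U x r) * φ x with hcdef
  have hcc : Continuous c := (hU.continuous_integral_mul hφ.continuous_laplacian).add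
    (hU.continuous_integral_comp_mul hφ.continuous)
  set v : EuclideanSpace ℝ (Fin N) → ℝ → ℝ := fun x s => U (x₀ + x) ((t - ρ) + s) with hv
  have hshift : Continuous fun z : EuclideanSpace ℝ (Fin N) × ℝ => (x₀ + z.1, (t - ρ) + z.2) := by
    fun_prop
  have key : ∀ r ∈ Icc (t - ρ / 2) (t + ρ), ∫ x, U x r * φ x =
      (∫ x, U x (t - ρ / 2) * φ x) + ∫ q in (t - ρ / 2)..r, c q := by
    intro r hr
    have h1 := weak_form_paraboloid (τ := 2 * ρ) (u := v) (g := fun x s => f (v x s))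
      (φ := fun x => φ (x₀ + x)) (s := ρ / 2) (t := r - (t - ρ))
      (hU.continuous.comp hshift) (hU.continuous_comp.comp hshift) ?_
      (hφ.comp (contDiff_const.add contDiff_id))
      (hc.comp_homeomorph (Homeomorph.addLeft x₀)) ?_ (by linarith [hr.1]) (by linarith [hr.2])
    · simp_rw [laplacian_comp_add_left] at h1
      simp only [hv] at h1
      rw [integral_add_left_eq_self (fun x => U x (t - ρ + (r - (t - ρ))) * φ x),
        integral_add_left_eq_self (fun x => U x (t - ρ + ρ / 2) * φ x)] at h1
      have h2 : ∀ q, (∫ x, U (x₀ + x) (t - ρ + q) * laplacian φ (x₀ + x)) +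
          ∫ x, f (U (x₀ + x) (t - ρ + q)) * φ (x₀ + x) = c (t - ρ + q) := fun q => by
        rw [integral_add_left_eq_self (fun x => U x (t - ρ + q) * laplacian φ x),
          integral_add_left_eq_self (fun x => f (U x (t - ρ + q)) * φ x)]
      simp_rw [h2] at h1
      rw [intervalIntegral.integral_comp_add_left (fun q => c q)] at h1
      rw [show t - ρ + ρ / 2 = t - ρ / 2 by ring, add_sub_cancel] at h1
      linarith
    · intro x s hxs hsτ
      have hxΩ : x₀ + x ∈ Ω := hball (by
        rw [mem_ball_iff_norm, add_sub_cancel_left]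
        exact lt_of_pow_lt_pow_left₀ 2 hR.le (by linarith))
      have hst : t - ρ + s ∈ Ioo 0 b :=
        ⟨by linarith [(sq_nonneg ‖x‖).trans_lt hxs], by linarith⟩
      refine ⟨?_, ?_⟩
      · exact (hU.contDiffAt _ hxΩ _ hst).comp x (contDiffAt_const.add contDiffAt_id)
      · rw [hv, laplacian_comp_add_left (fun y => U y (t - ρ + s))]
        exact (hU.hasDerivAt _ hxΩ _ hst).comp_const_add _ _
    · intro x hx
      have : x₀ + x ∈ tsupport φ := by
        have := tsupport_comp_subset_preimage φ (f := fun x => x₀ + x) (by fun_prop) hx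
        exact this
      have h3 := hs this
      simp only [mem_ofPred_eq, neg_add_cancel_left] at h3
      exact h3.le
  have h4 : HasDerivAt (fun r => (∫ x, U x (t - ρ / 2) * φ x) + ∫ q in (t - ρ / 2)..r, c q)
      (c t) t := (hcc.integral_hasStrictDerivAt _ t).hasDerivAt.const_add _
  refine h4.congr_of_eventuallyEq ?_
  filter_upwards [Icc_mem_nhds (a := t - ρ / 2) (b := t + ρ) (by linarith) (by linarith)] with r hr
  exact key r hr

open Manifold in
/-- The weak form of the equation, tested against a `C²` compactly supported function. -/
lemma hasDerivAt_integral_mul (hU : IsHeatSolution Ω b f U) {t : ℝ} (ht : t ∈ Ioo 0 b)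
    {φ : EuclideanSpace ℝ (Fin N) → ℝ} (hφ : ContDiff ℝ 2 φ) (hc : HasCompactSupport φ)
    (hs : tsupport φ ⊆ Ω) :
    HasDerivAt (fun t => ∫ x, U x t * φ x)
      ((∫ x, U x t * laplacian φ x) + ∫ x, f (U x t) * φ x) t := by
  choose V hVo hV hw using fun x₀ : tsupport φ => hU.exists_isOpen_weak_form ht (hs x₀.2)
  obtain ⟨I, hI⟩ := hc.elim_finite_subcover V hVo
    fun x hx => mem_iUnion.mpr ⟨⟨x, hx⟩, hV ⟨x, hx⟩⟩
  obtain ⟨χ, hχ⟩ := SmoothPartitionOfUnity.exists_isSubordinate 𝓘(ℝ, EuclideanSpace ℝ (Fin N))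
    (isClosed_tsupport φ) (fun i : I => V i) (fun i => hVo i) (by
      intro x hx
      obtain ⟨i, hi, hxi⟩ := mem_iUnion₂.mp (hI hx)
      exact mem_iUnion.mpr ⟨⟨i, hi⟩, hxi⟩)
  let P : (EuclideanSpace ℝ (Fin N) → ℝ) → Prop := fun ψ =>
    ContDiff ℝ 2 ψ ∧ HasCompactSupport ψ ∧ HasDerivAt (fun t => ∫ x, U x t * ψ x)
      ((∫ x, U x t * laplacian ψ x) + ∫ x, f (U x t) * ψ x) t
  have hPadd : ∀ ψ₁ ψ₂, P ψ₁ → P ψ₂ → P (ψ₁ + ψ₂) := by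
    rintro ψ₁ ψ₂ ⟨h1, hc1, hd1⟩ ⟨h2, hc2, hd2⟩
    refine ⟨h1.add h2, hc1.add hc2, ?_⟩
    have hInt : ∀ {v ψ : EuclideanSpace ℝ (Fin N) → ℝ}, Continuous v → Continuous ψ →
        HasCompactSupport ψ → Integrable fun x => v x * ψ x := fun hv hψ hψc =>
      (hv.mul hψ).integrable_of_hasCompactSupport hψc.mul_left
    have hUc := hU.continuous_slice
    have hfc : ∀ s, Continuous fun x => f (U x s) := fun s =>
      hU.locallyLipschitz.continuous.comp (hUc s)
    have e1 : (fun t => ∫ x, U x t * (ψ₁ + ψ₂) x) =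
        fun t => (∫ x, U x t * ψ₁ x) + ∫ x, U x t * ψ₂ x := by
      funext s
      simp only [Pi.add_apply, mul_add]
      exact integral_add (hInt (hUc s) h1.continuous hc1) (hInt (hUc s) h2.continuous hc2)
    have e2 : ∫ x, f (U x t) * (ψ₁ + ψ₂) x =
        (∫ x, f (U x t) * ψ₁ x) + ∫ x, f (U x t) * ψ₂ x := by
      simp only [Pi.add_apply, mul_add]
      exact integral_add (hInt (hfc t) h1.continuous hc1) (hInt (hfc t) h2.continuous hc2)
    have e3 : ∫ x, U x t * laplacian (ψ₁ + ψ₂) x =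
        (∫ x, U x t * laplacian ψ₁ x) + ∫ x, U x t * laplacian ψ₂ x := by
      have : ∀ x, laplacian (ψ₁ + ψ₂) x = laplacian ψ₁ x + laplacian ψ₂ x :=
        fun x => laplacian_add h1.contDiffAt h2.contDiffAt
      simp only [this, mul_add]
      exact integral_add (hInt (hUc t) h1.continuous_laplacian hc1.laplacian)
        (hInt (hUc t) h2.continuous_laplacian hc2.laplacian)
    rw [e1, e2, e3]
    exact (hd1.fun_add hd2).congr_deriv (by ring)
  have hP0 : P 0 := by
    refine ⟨contDiff_const, HasCompactSupport.zero, ?_⟩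
    have : laplacian (0 : EuclideanSpace ℝ (Fin N) → ℝ) = 0 := by
      have h : gradient (0 : EuclideanSpace ℝ (Fin N) → ℝ) = 0 := by
        ext1 y
        simp [gradient]
      ext x
      simp [laplacian, h]
    simp [this, hasDerivAt_const]
  have hPi : ∀ i ∈ Finset.univ, P (fun x => χ i x * φ x) := by
    intro i _
    have hsm : ContDiff ℝ 2 fun x => χ i x * φ x :=
      (contDiff_infty.mp (χ i).contMDiff.contDiff 2).mul hφ
    have hcs : HasCompactSupport fun x => χ i x * φ x := hc.mul_left
    exact ⟨hsm, hcs, hw i _ hsm hcs ((tsupport_mul_subset_left).trans (hχ i))⟩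
  have hsum : (∑ i, fun x => χ i x * φ x) = φ := by
    funext x
    rw [Finset.sum_apply, ← Finset.sum_mul]
    by_cases hx : x ∈ tsupport φ
    · rw [χ.sum_finsupport' x hx (Finset.subset_univ _), one_mul]
    · rw [image_eq_zero_of_notMem_tsupport hx, mul_zero]
  have := Finset.sum_induction _ P hPadd hP0 hPi
  rw [hsum] at this
  exact this.2.2

end IsHeatSolution

/-- A smooth truncation: it vanishes for `s ≤ δ` and equals `s` for `s ≥ 2δ`. -/
noncomputable def truncation (δ s : ℝ) : ℝ := s * smoothTransition (s / δ - 1)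

lemma contDiff_truncation (δ : ℝ) {n : ℕ∞} : ContDiff ℝ n (truncation δ) :=
  contDiff_id.mul (smoothTransition.contDiff.comp ((contDiff_id.div_const δ).sub contDiff_const))

lemma truncation_of_le {δ s : ℝ} (hδ : 0 < δ) (hs : s ≤ δ) : truncation δ s = 0 := by
  rw [truncation, smoothTransition.zero_of_nonpos, mul_zero]
  rwa [sub_nonpos, div_le_one hδ]

lemma truncation_of_two_mul_le {δ s : ℝ} (hδ : 0 < δ) (hs : 2 * δ ≤ s) : truncation δ s = s := by
  rw [truncation, smoothTransition.one_of_one_le, mul_one]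
  rw [le_sub_iff_add_le, le_div_iff₀ hδ]
  linarith

lemma truncation_nonneg {δ s : ℝ} (hs : 0 ≤ s) : 0 ≤ truncation δ s :=
  mul_nonneg hs (smoothTransition.nonneg _)

lemma truncation_le {δ s : ℝ} (hs : 0 ≤ s) : truncation δ s ≤ s :=
  mul_le_of_le_one_right hs (smoothTransition.le_one _)

lemma abs_truncation_sub_le {δ s : ℝ} (hδ : 0 < δ) (hs : 0 ≤ s) :
    |truncation δ s - s| ≤ 2 * δ := by
  rcases le_total (2 * δ) s with h | h
  · rw [truncation_of_two_mul_le hδ h, sub_self, abs_zero]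
    positivity
  · rw [abs_le]
    constructor <;> linarith [truncation_nonneg (δ := δ) hs, truncation_le (δ := δ) hs]

lemma truncation_eq_mul {δ : ℝ} (hδ : 0 < δ) (s : ℝ) :
    truncation δ s = δ * truncation 1 (s / δ) := by
  rw [truncation, truncation, div_one]
  field_simp

lemma deriv_truncation {δ : ℝ} (hδ : 0 < δ) (s : ℝ) :
    deriv (truncation δ) s = deriv (truncation 1) (s / δ) := by
  have h1 : HasDerivAt (truncation 1) (deriv (truncation 1) (s / δ)) (s / δ) :=
    ((contDiff_truncation 1 (n := 1)).differentiable (by norm_num) _).hasDerivAt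
  have h2 := (h1.comp s ((hasDerivAt_id s).div_const δ)).const_mul δ
  have h3 : truncation δ = fun s => δ * (truncation 1 ∘ fun s => id s / δ) s :=
    funext fun s => truncation_eq_mul hδ s
  rw [h3]
  refine h2.deriv.trans ?_
  field_simp

open Filter Topology in
lemma deriv_truncation_of_two_mul_lt {δ s : ℝ} (hδ : 0 < δ) (hs : 2 * δ < s) :
    deriv (truncation δ) s = 1 := by
  have : truncation δ =ᶠ[𝓝 s] id := by
    filter_upwards [eventually_gt_nhds hs] with r hr
    exact truncation_of_two_mul_le hδ hr.le
  rw [this.deriv_eq, deriv_id]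

lemma monotone_truncation {δ : ℝ} (hδ : 0 < δ) : Monotone (truncation δ) := by
  intro r s hrs
  rcases le_total r δ with h | h
  · rw [truncation_of_le hδ h]
    rcases le_total 0 s with h' | h'
    · exact truncation_nonneg h'
    · rw [truncation_of_le hδ (h'.trans hδ.le)]
  · have h0 : 0 ≤ r := hδ.le.trans h
    exact mul_le_mul hrs (smoothTransition.monotone (by gcongr)) (smoothTransition.nonneg _)
      (h0.trans hrs)

lemma deriv_truncation_nonneg {δ : ℝ} (hδ : 0 < δ) (s : ℝ) : 0 ≤ deriv (truncation δ) s :=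
  (monotone_truncation hδ).deriv_nonneg

open Filter Topology in
lemma exists_deriv_truncation_le : ∃ C, 0 ≤ C ∧ ∀ δ, 0 < δ → ∀ s, deriv (truncation δ) s ≤ C := by
  obtain ⟨C, hC⟩ := (isCompact_Icc (a := (1:ℝ)) (b := 2)).exists_bound_of_continuousOn
    ((contDiff_truncation 1 (n := 1)).continuous_deriv (by norm_num)).continuousOn
  refine ⟨max C 1, by positivity, fun δ hδ s => ?_⟩
  rw [deriv_truncation hδ]
  set y := s / δ
  rcases lt_or_ge y 1 with h1 | h1
  · have : truncation 1 =ᶠ[𝓝 y] fun _ => 0 := by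
      filter_upwards [eventually_lt_nhds h1] with r hr
      exact truncation_of_le one_pos hr.le
    rw [this.deriv_eq, deriv_const]
    positivity
  rcases le_or_gt y 2 with h2 | h2
  · exact ((le_abs_self _).trans (hC y ⟨h1, h2⟩)).trans (le_max_left _ _)
  · rw [deriv_truncation_of_two_mul_lt one_pos (by linarith)]
    exact le_max_right _ _

/-- A primitive of the truncation. -/
noncomputable def truncationPrimitive (δ s : ℝ) : ℝ := ∫ r in (0:ℝ)..s, truncation δ r

lemma hasDerivAt_truncationPrimitive (δ s : ℝ) :
    HasDerivAt (truncationPrimitive δ) (truncation δ s) s :=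
  ((contDiff_truncation δ (n := 0)).continuous.integral_hasStrictDerivAt 0 s).hasDerivAt

lemma truncationPrimitive_sub_le {δ : ℝ} (hδ : 0 < δ) (p q : ℝ) :
    truncationPrimitive δ p - truncationPrimitive δ q ≤ truncation δ p * (p - q) := by
  have hInt := fun a b => (contDiff_truncation δ (n := 0)).continuous.intervalIntegrable
    (μ := volume) a b
  rw [truncationPrimitive, truncationPrimitive,
    intervalIntegral.integral_interval_sub_left (hInt _ _) (hInt _ _)]
  rcases le_total q p with h | h
  · refine (intervalIntegral.integral_mono_on h (hInt _ _) intervalIntegrable_const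
      (fun r hr => monotone_truncation hδ hr.2)).trans_eq ?_
    rw [intervalIntegral.integral_const, smul_eq_mul, mul_comm]
  · rw [intervalIntegral.integral_symm]
    have := intervalIntegral.integral_mono_on h intervalIntegrable_const (hInt _ _)
      (fun r hr => monotone_truncation hδ hr.1)
    rw [intervalIntegral.integral_const, smul_eq_mul] at this
    linarith

lemma abs_truncationPrimitive_sub_le {δ s : ℝ} (hδ : 0 < δ) (hs : 0 ≤ s) :
    |truncationPrimitive δ s - s ^ 2 / 2| ≤ 2 * δ * s := by
  have h1 : s ^ 2 / 2 = ∫ r in (0:ℝ)..s, r := by rw [integral_id]; ring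
  rw [truncationPrimitive, h1, ← intervalIntegral.integral_sub
    ((contDiff_truncation δ (n := 0)).continuous.intervalIntegrable _ _)
    (continuous_id'.intervalIntegrable _ _)]
  have h2 := intervalIntegral.norm_integral_le_of_norm_le_const (a := 0) (b := s) (C := 2 * δ)
    (f := fun r => truncation δ r - r) (fun r hr => by
      rw [uIoc_of_le hs] at hr
      exact abs_truncation_sub_le hδ hr.1.le)
  rwa [sub_zero, abs_of_nonneg hs] at h2

open Filter Topology in
/-- If a continuous function is touched from above in the past, up to an additive constant, by
functions with nonpositive derivative, then it is antitone. -/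
lemma antitoneOn_of_sub_le_sub {g κ : ℝ → ℝ} {a b : ℝ} (hg : ContinuousOn g (Icc a b))
    (hκ : ∀ τ ∈ Ioc a b, 0 ≤ κ τ)
    (h : ∀ τ ∈ Ioc a b, ∃ p : ℝ → ℝ, HasDerivAt p (-κ τ) τ ∧
      ∀ s ∈ Ico a τ, g τ - g s ≤ p τ - p s) : AntitoneOn g (Icc a b) := by
  intro c hc d hd hcd
  have hsub : Icc c d ⊆ Icc a b := Icc_subset_Icc hc.1 hd.2
  have key := image_le_of_liminf_slope_right_le_deriv_boundary (f := fun z => -g (-z))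
    (a := -d) (b := -c) (B := fun _ => -g d) (B' := fun _ => 0) ?_ (by simp) continuousOn_const
    (fun x _ => hasDerivWithinAt_const _ _ _) ?_
  · have := key (x := -c) ⟨by linarith, le_rfl⟩
    simp only [neg_neg] at this
    linarith
  · refine ((hg.mono hsub).comp continuousOn_neg fun z hz => ?_).neg
    exact ⟨by linarith [hz.2], by linarith [hz.1]⟩
  · intro x hx r hr
    have hτ : -x ∈ Ioc a b := ⟨by linarith [hx.2, hc.1], by linarith [hx.1, hd.2]⟩
    obtain ⟨p, hp, hps⟩ := h (-x) hτ
    have hq : HasDerivAt (fun z => -p (-z)) (-κ (-x)) x := by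
      have h1 := (HasDerivAt.scomp x hp (hasDerivAt_neg x)).fun_neg
      simpa using h1
    have hslope := (hasDerivWithinAt_iff_tendsto_slope' (s := Ioi x) (by simp)).1
      (hq.hasDerivWithinAt (s := Ioi x))
    have h2 : ∀ᶠ z in 𝓝[>] x, slope (fun z => -p (-z)) x z < r :=
      hslope.eventually_lt_const ((neg_nonpos.mpr (hκ _ hτ)).trans_lt hr)
    refine Eventually.frequently ?_
    filter_upwards [h2, Ioc_mem_nhdsGT (show x < -a by linarith [hx.2, hc.1])] with z hz hzx
    refine lt_of_le_of_lt ?_ hz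
    rw [slope_def_field, slope_def_field, div_le_div_iff_of_pos_right (sub_pos.2 hzx.1)]
    have := hps (-z) ⟨by linarith [hzx.2], by linarith [hzx.1]⟩
    linarith

open Filter Topology in
lemma lintegral_le_of_sub_le_sub {g κ : ℝ → ℝ} {a b : ℝ} (hab : a ≤ b)
    (hg : ContinuousOn g (Icc a b)) (hκ : ∀ τ ∈ Ioc a b, 0 ≤ κ τ)
    (h : ∀ τ ∈ Ioc a b, ∃ p : ℝ → ℝ, HasDerivAt p (-κ τ) τ ∧
      ∀ s ∈ Ico a τ, g τ - g s ≤ p τ - p s) :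
    0 ≤ g a - g b ∧ ∫⁻ τ in Ioc a b, ENNReal.ofReal (κ τ) ≤ ENNReal.ofReal (g a - g b) := by
  have hanti := antitoneOn_of_sub_le_sub hg hκ h
  refine ⟨sub_nonneg.2 (hanti ⟨le_rfl, hab⟩ ⟨hab, le_rfl⟩ hab), ?_⟩
  set F : ℝ → ℝ := fun s => -g s with hF
  have hmono : MonotoneOn F (Icc a b) := hanti.neg
  have hmono' : MonotoneOn F (uIcc a b) := by rwa [uIcc_of_le hab]
  have hInt : IntegrableOn (deriv F) (Ioc a b) :=
    (intervalIntegrable_iff_integrableOn_Ioc_of_le hab).mp hmono'.intervalIntegrable_deriv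
  have hle : ∀ᵐ τ ∂(volume.restrict (Ioc a b)), κ τ ≤ deriv F τ := by
    rw [← restrict_Ioo_eq_restrict_Ioc, ae_restrict_iff' measurableSet_Ioo]
    filter_upwards [hmono.ae_differentiableWithinAt_of_mem] with τ hdiff hτ
    have hd : DifferentiableAt ℝ F τ :=
      (hdiff (Ioo_subset_Icc_self hτ)).differentiableAt (Icc_mem_nhds hτ.1 hτ.2)
    obtain ⟨p, hp, hps⟩ := h τ (Ioo_subset_Ioc_self hτ)
    have h1 := (hasDerivWithinAt_iff_tendsto_slope' (s := Iio τ) (by simp)).1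
      (hd.hasDerivAt.hasDerivWithinAt (s := Iio τ))
    have h2 := (hasDerivWithinAt_iff_tendsto_slope' (s := Iio τ) (by simp)).1
      (hp.fun_neg.hasDerivWithinAt (s := Iio τ))
    rw [neg_neg] at h2
    refine le_of_tendsto_of_tendsto h2 h1 ?_
    filter_upwards [Ico_mem_nhdsLT hτ.1] with s hs
    have := hps s hs
    rw [slope_def_field, slope_def_field, div_le_div_right_of_neg (sub_neg.2 hs.2), hF]
    linarith
  have hpos : ∀ᵐ τ ∂(volume.restrict (Ioc a b)), 0 ≤ deriv F τ := by
    filter_upwards [hle, ae_restrict_mem measurableSet_Ioc] with τ h1 hτ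
    exact (hκ τ hτ).trans h1
  calc ∫⁻ τ in Ioc a b, ENNReal.ofReal (κ τ)
      ≤ ∫⁻ τ in Ioc a b, ENNReal.ofReal (deriv F τ) :=
        lintegral_mono_ae (hle.mono fun τ hτ => ENNReal.ofReal_le_ofReal hτ)
    _ = ENNReal.ofReal (∫ τ in Ioc a b, deriv F τ) :=
        (ofReal_integral_eq_lintegral_ofReal hInt hpos).symm
    _ ≤ ENNReal.ofReal (g a - g b) := by
        refine ENNReal.ofReal_le_ofReal ?_
        rw [← intervalIntegral.integral_of_le hab]
        have h1 := hmono'.intervalIntegral_deriv_mem_uIcc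
        have h2 : F a ≤ F b := hmono ⟨le_rfl, hab⟩ ⟨hab, le_rfl⟩ hab
        rw [uIcc_of_le (by linarith)] at h1
        refine h1.2.trans_eq ?_
        simp only [hF]
        ring

section TruncationComp

variable {N : ℕ} {Ω : Set (EuclideanSpace ℝ (Fin N))} {v : EuclideanSpace ℝ (Fin N) → ℝ} {δ : ℝ}

lemma tsupport_truncation_comp_subset (hv : Continuous v) (hδ : 0 < δ) :
    tsupport (fun x => truncation δ (v x)) ⊆ {x | δ ≤ v x} := by
  refine closure_minimal (fun x hx => ?_) (isClosed_le continuous_const hv)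
  by_contra h
  exact hx (truncation_of_le hδ (not_le.mp h).le)

lemma tsupport_truncation_comp_subset_of_eq_zero (hv : Continuous v) (h0 : ∀ x ∉ Ω, v x = 0)
    (hδ : 0 < δ) : tsupport (fun x => truncation δ (v x)) ⊆ Ω := by
  intro x hx
  by_contra h
  have := tsupport_truncation_comp_subset hv hδ hx
  rw [mem_ofPred_eq, h0 x h] at this
  exact absurd this (not_le.mpr hδ)

lemma hasCompactSupport_truncation_comp (hv : Continuous v) (hΩ : Bornology.IsBounded Ω)
    (h0 : ∀ x ∉ Ω, v x = 0) (hδ : 0 < δ) : HasCompactSupport (fun x => truncation δ (v x)) :=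
  hΩ.isCompact_closure.of_isClosed_subset (isClosed_tsupport _)
    ((tsupport_truncation_comp_subset_of_eq_zero hv h0 hδ).trans subset_closure)

lemma contDiff_truncation_comp {n : ℕ∞} (hΩ : IsOpen Ω) (hv : Continuous v)
    (hv' : ContDiffOn ℝ n v Ω) (h0 : ∀ x ∉ Ω, v x = 0) (hδ : 0 < δ) :
    ContDiff ℝ n (fun x => truncation δ (v x)) := by
  refine contDiff_iff_contDiffAt.mpr fun x => ?_
  by_cases hx : x ∈ Ω
  · exact (contDiff_truncation δ).contDiffAt.comp x (hv'.contDiffAt (hΩ.mem_nhds hx))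
  · have : x ∉ tsupport fun x => truncation δ (v x) :=
      fun h => hx (tsupport_truncation_comp_subset_of_eq_zero hv h0 hδ h)
    exact contDiffAt_const.congr_of_eventuallyEq (notMem_tsupport_iff_eventuallyEq.mp this)

lemma fderiv_truncation_comp {x : EuclideanSpace ℝ (Fin N)} (hv : DifferentiableAt ℝ v x) :
    fderiv ℝ (fun x => truncation δ (v x)) x = deriv (truncation δ) (v x) • fderiv ℝ v x :=
  ((((contDiff_truncation δ (n := 1)).differentiable (by norm_num) _).hasDerivAt).comp_hasFDerivAt
    x hv.hasFDerivAt).fderiv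

end TruncationComp

lemma norm_gradient {N : ℕ} (w : EuclideanSpace ℝ (Fin N) → ℝ) (x : EuclideanSpace ℝ (Fin N)) :
    ‖gradient w x‖ = ‖fderiv ℝ w x‖ := by
  rw [gradient, LinearIsometryEquiv.norm_map]

namespace IsHeatSolution

variable {N : ℕ} {Ω : Set (EuclideanSpace ℝ (Fin N))} {b : ℝ} {f : ℝ → ℝ}
  {U : EuclideanSpace ℝ (Fin N) → ℝ → ℝ}

lemma contDiffOn_two (hU : IsHeatSolution Ω b f U) {t : ℝ} (ht : t ∈ Ioo 0 b) :
    ContDiffOn ℝ 2 (fun x => U x t) Ω :=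
  fun x hx => (hU.contDiffAt x hx t ht).contDiffWithinAt

lemma contDiffOn_one (hU : IsHeatSolution Ω b f U) {t : ℝ} (ht : t ∈ Ico 0 b) :
    ContDiffOn ℝ 1 (fun x => U x t) Ω := by
  rcases ht.1.eq_or_lt with h | h
  · exact h ▸ hU.contDiffOn_zero
  · exact (hU.contDiffOn_two ⟨h, ht.2⟩).of_le (by norm_num)

lemma measurable_norm_gradient_sq (hU : IsHeatSolution Ω b f U) :
    Measurable fun p : ℝ × EuclideanSpace ℝ (Fin N) => ‖gradient (fun y => U y p.1) p.2‖ ^ 2 := by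
  simp_rw [norm_gradient]
  have : Measurable fun p : ℝ × EuclideanSpace ℝ (Fin N) => fderiv ℝ (fun y => U y p.1) p.2 :=
    measurable_fderiv_with_param (f := fun t x => U x t) ℝ
      (hU.continuous.comp (continuous_snd.prodMk continuous_fst))
  exact this.norm.pow_const 2

lemma measurable_truncated_dirichlet (hU : IsHeatSolution Ω b f U) (δ : ℝ) :
    Measurable fun t => ∫ x in Ω, deriv (truncation δ) (U x t) *
      ‖gradient (fun y => U y t) x‖ ^ 2 := by
  have h1 : Measurable fun p : ℝ × EuclideanSpace ℝ (Fin N) =>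
      deriv (truncation δ) (U p.2 p.1) :=
    (measurable_deriv _).comp
      (hU.continuous.comp (continuous_snd.prodMk continuous_fst)).measurable
  exact ((h1.mul hU.measurable_norm_gradient_sq).stronglyMeasurable.integral_prod_right'
    (ν := volume.restrict Ω)).measurable

lemma measurable_dirichlet (hU : IsHeatSolution Ω b f U) :
    Measurable fun t => ∫ x in Ω, ‖gradient (fun y => U y t) x‖ ^ 2 :=
  (hU.measurable_norm_gradient_sq.stronglyMeasurable.integral_prod_right'
    (ν := volume.restrict Ω)).measurable

lemma continuous_truncated_source (hU : IsHeatSolution Ω b f U) (δ : ℝ) :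
    Continuous fun t => ∫ x, f (U x t) * truncation δ (U x t) := by
  have hswap := hU.continuous.comp (continuous_snd.prodMk continuous_fst)
  refine continuous_integral_of_compact (K := closure Ω) ?_ hU.isCompact_closure ?_
  · exact (hU.locallyLipschitz.continuous.comp hswap).mul
      ((contDiff_truncation δ (n := 0)).continuous.comp hswap)
  · intro r x hx
    simp [hU.eq_zero x (fun h => hx (subset_closure h)), hU.map_zero]

lemma continuous_truncationPrimitive (hU : IsHeatSolution Ω b f U) (δ : ℝ) :
    Continuous fun t => ∫ x, truncationPrimitive δ (U x t) := by
  have hswap := hU.continuous.comp (continuous_snd.prodMk continuous_fst)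
  refine continuous_integral_of_compact (K := closure Ω) ?_ hU.isCompact_closure ?_
  · exact (continuous_iff_continuousAt.mpr fun s =>
      (hasDerivAt_truncationPrimitive δ s).continuousAt).comp hswap
  · intro r x hx
    simp [hU.eq_zero x (fun h => hx (subset_closure h)), truncationPrimitive]

lemma hasDerivAt_integral_mul_truncation (hU : IsHeatSolution Ω b f U) {t : ℝ}
    (ht : t ∈ Ioo 0 b) {δ : ℝ} (hδ : 0 < δ) :
    HasDerivAt (fun s => ∫ x, U x s * truncation δ (U x t))
      (-(∫ x in Ω, deriv (truncation δ) (U x t) * ‖gradient (fun y => U y t) x‖ ^ 2) +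
        ∫ x, f (U x t) * truncation δ (U x t)) t := by
  have h0 : ∀ x ∉ Ω, U x t = 0 := fun x hx => hU.eq_zero x hx t
  have hv := hU.continuous_slice t
  have hsub := tsupport_truncation_comp_subset_of_eq_zero hv h0 hδ
  have hcd : ContDiff ℝ 2 fun x => truncation δ (U x t) :=
    contDiff_truncation_comp hU.isOpen hv (hU.contDiffOn_two ht) h0 hδ
  have hcs := hasCompactSupport_truncation_comp hv hU.isBounded h0 hδ
  have h1 := hU.hasDerivAt_integral_mul ht hcd hcs hsub
  rw [integral_mul_laplacian_of_tsupport_subset hU.isOpen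
    (hU.contDiffOn_one ⟨ht.1.le, ht.2⟩) hcd hcs hsub] at h1
  refine h1.congr_deriv ?_
  congr 2
  rw [← setIntegral_eq_integral_of_forall_compl_eq_zero (s := Ω)]
  · refine setIntegral_congr_fun hU.isOpen.measurableSet fun x hx => ?_
    have hd : DifferentiableAt ℝ (fun y => U y t) x :=
      (hU.contDiffAt x hx t ht).differentiableAt two_ne_zero
    simp only [fderiv_truncation_comp hd, norm_gradient_sq, smul_apply, smul_eq_mul,
      Finset.mul_sum]
    exact Finset.sum_congr rfl fun i _ => by ring
  · intro x hx
    have h2 : fderiv ℝ (fun x => truncation δ (U x t)) x = 0 :=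
      image_eq_zero_of_notMem_tsupport
        fun h => hx (hsub (tsupport_fderiv_subset ℝ h))
    simp [h2]

lemma lintegral_truncated_dirichlet_le (hU : IsHeatSolution Ω b f U) {s t : ℝ} (hs : 0 ≤ s)
    (hst : s ≤ t) (ht : t < b) {δ : ℝ} (hδ : 0 < δ) :
    0 ≤ (∫ x, truncationPrimitive δ (U x s)) - (∫ x, truncationPrimitive δ (U x t)) +
      (∫ τ in s..t, ∫ x, f (U x τ) * truncation δ (U x τ)) ∧
    ∫⁻ τ in Ioc s t, ENNReal.ofReal
      (∫ x in Ω, deriv (truncation δ) (U x τ) * ‖gradient (fun y => U y τ) x‖ ^ 2) ≤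
    ENNReal.ofReal ((∫ x, truncationPrimitive δ (U x s)) - (∫ x, truncationPrimitive δ (U x t)) +
      ∫ τ in s..t, ∫ x, f (U x τ) * truncation δ (U x τ)) := by
  set c : ℝ → ℝ := fun τ => ∫ x, f (U x τ) * truncation δ (U x τ) with hc
  have hcc : Continuous c := hU.continuous_truncated_source δ
  set e : ℝ → ℝ := fun τ => ∫ x, truncationPrimitive δ (U x τ) with he
  have hec : Continuous e := hU.continuous_truncationPrimitive δ
  have hI : ∀ τ, HasDerivAt (fun r => ∫ q in s..r, c q) (c τ) τ :=
    fun τ => (hcc.integral_hasStrictDerivAt s τ).hasDerivAt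
  have hIc : Continuous fun r => ∫ q in s..r, c q :=
    continuous_iff_continuousAt.mpr fun τ => (hI τ).continuousAt
  have hge : e s - (∫ q in s..s, c q) - (e t - ∫ q in s..t, c q) =
      e s - e t + ∫ q in s..t, c q := by
    rw [intervalIntegral.integral_same]
    ring
  refine hge ▸ lintegral_le_of_sub_le_sub (g := fun τ => e τ - ∫ q in s..τ, c q) hst
    (hec.sub hIc).continuousOn ?_ ?_
  · exact fun τ _ => integral_nonneg fun x =>
      mul_nonneg (deriv_truncation_nonneg hδ _) (sq_nonneg _)
  · intro τ hτ
    refine ⟨fun r => (∫ x, U x r * truncation δ (U x τ)) - ∫ q in s..r, c q, ?_, ?_⟩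
    · refine ((hU.hasDerivAt_integral_mul_truncation ⟨hs.trans_lt hτ.1, hτ.2.trans_lt ht⟩
        hδ).fun_sub (hI τ)).congr_deriv ?_
      ring
    · intro r _
      have hK := hU.isCompact_closure
      have hInt : ∀ {h : EuclideanSpace ℝ (Fin N) → ℝ}, Continuous h →
          (∀ x ∉ Ω, h x = 0) → Integrable h := fun hh h0 =>
        hh.integrable_of_hasCompactSupport (HasCompactSupport.intro hK
          fun x hx => h0 x fun h => hx (subset_closure h))
      have hPc : Continuous (truncationPrimitive δ) := continuous_iff_continuousAt.mpr fun s =>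
        (hasDerivAt_truncationPrimitive δ s).continuousAt
      have hTc : Continuous (truncation δ) := (contDiff_truncation δ (n := 0)).continuous
      have i1 : ∀ q, Integrable fun x => truncationPrimitive δ (U x q) := fun q =>
        hInt (hPc.comp (hU.continuous_slice q))
          fun x hx => by simp [hU.eq_zero x hx, truncationPrimitive]
      have i2 : ∀ q, Integrable fun x => U x q * truncation δ (U x τ) := fun q =>
        hInt ((hU.continuous_slice q).mul (hTc.comp (hU.continuous_slice τ)))
          fun x hx => by simp [hU.eq_zero x hx]
      have key : e τ - e r ≤
          (∫ x, U x τ * truncation δ (U x τ)) - ∫ x, U x r * truncation δ (U x τ) := by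
        rw [he, ← integral_sub (i1 τ) (i1 r), ← integral_sub (i2 τ) (i2 r)]
        refine integral_mono ((i1 τ).sub (i1 r)) ((i2 τ).sub (i2 r)) fun x => ?_
        exact (truncationPrimitive_sub_le hδ _ _).trans_eq (by ring)
      simp only
      linarith

end IsHeatSolution

/-- The Dirichlet energy `∫ ‖∇U(·, t)‖²` over `Ω`. -/
noncomputable def dirichletEnergy {N : ℕ} (Ω : Set (EuclideanSpace ℝ (Fin N)))
    (U : EuclideanSpace ℝ (Fin N) → ℝ → ℝ) (t : ℝ) : ℝ :=
  ∫ x in Ω, ‖gradient (fun y => U y t) x‖ ^ 2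

lemma dirichletEnergy_nonneg {N : ℕ} (Ω : Set (EuclideanSpace ℝ (Fin N)))
    (U : EuclideanSpace ℝ (Fin N) → ℝ → ℝ) (t : ℝ) : 0 ≤ dirichletEnergy Ω U t :=
  integral_nonneg fun _ => sq_nonneg _

namespace IsHeatSolution

variable {N : ℕ} {Ω : Set (EuclideanSpace ℝ (Fin N))} {b : ℝ} {f : ℝ → ℝ}
  {U : EuclideanSpace ℝ (Fin N) → ℝ → ℝ}

lemma integrable_of_eq_zero (hU : IsHeatSolution Ω b f U) {h : EuclideanSpace ℝ (Fin N) → ℝ}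
    (hh : Continuous h) (h0 : ∀ x ∉ Ω, h x = 0) : Integrable h :=
  hh.integrable_of_hasCompactSupport (HasCompactSupport.intro hU.isCompact_closure
    fun x hx => h0 x fun h => hx (subset_closure h))

/-- Integrals of continuous functions of the solution depend continuously on time. -/
lemma continuous_integral_of_eq_zero (hU : IsHeatSolution Ω b f U)
    {h : EuclideanSpace ℝ (Fin N) → ℝ → ℝ} (hh : Continuous (Function.uncurry h))
    (h0 : ∀ x ∉ Ω, ∀ t, h x t = 0) : Continuous fun t => ∫ x, h x t :=
  continuous_integral_of_compact (h := fun t x => h x t)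
    (hh.comp (continuous_snd.prodMk continuous_fst)) hU.isCompact_closure
    fun t x hx => h0 x (fun h => hx (subset_closure h)) t

open Filter Topology in
lemma tendsto_truncated_dirichlet (hU : IsHeatSolution Ω b f U) {t : ℝ} (ht : t ∈ Ico 0 b)
    (k : ℕ) :
    Tendsto (fun n : ℕ => ∫ x in Ω, deriv (truncation (1 / ((n : ℝ) + 1))) (U x t) ^ k *
      ‖gradient (fun y => U y t) x‖ ^ 2) atTop (𝓝 (dirichletEnergy Ω U t)) := by
  obtain ⟨C, hC0, hC⟩ := exists_deriv_truncation_le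
  refine tendsto_integral_of_dominated_convergence
    (fun x => C ^ k * ‖gradient (fun y => U y t) x‖ ^ 2) ?_
    ((hU.integrableOn_gradient t ht).const_mul _) ?_ ?_
  · intro n
    refine AEStronglyMeasurable.mul ?_ (hU.integrableOn_gradient t ht).aestronglyMeasurable
    exact (((measurable_deriv _).comp (hU.continuous_slice t).measurable).pow_const
      k).aestronglyMeasurable
  · intro n
    refine Eventually.of_forall fun x => ?_
    have hδ : (0 : ℝ) < 1 / ((n : ℝ) + 1) := by positivity
    have h0 := deriv_truncation_nonneg hδ (U x t)
    rw [Real.norm_of_nonneg (by positivity)]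
    gcongr
    exact hC _ hδ _
  · filter_upwards [ae_restrict_mem hU.isOpen.measurableSet] with x hx
    rcases (hU.nonneg x t).eq_or_lt with h | h
    · have hmin : IsLocalMin (fun y => U y t) x :=
        Eventually.of_forall fun y => by simpa [← h] using hU.nonneg y t
      simp [norm_gradient, hmin.fderiv_eq_zero]
    · refine tendsto_const_nhds.congr' ?_
      have h1 : Tendsto (fun n : ℕ => 2 * (1 / ((n : ℝ) + 1))) atTop (𝓝 (2 * 0)) :=
        tendsto_one_div_add_atTop_nhds_zero_nat.const_mul 2
      rw [mul_zero] at h1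
      filter_upwards [h1.eventually_lt_const h] with n hn
      rw [deriv_truncation_of_two_mul_lt (by positivity) hn, one_pow, one_mul]

open Filter Topology in
lemma intervalIntegrable_and_integral_dirichletEnergy_le (hU : IsHeatSolution Ω b f U)
    {s t : ℝ} (hs : 0 ≤ s)
    (hst : s ≤ t) (ht : t < b) :
    IntervalIntegrable (dirichletEnergy Ω U) volume s t ∧
    ∫ τ in s..t, dirichletEnergy Ω U τ ≤ (1 / 2) * (∫ x, U x s ^ 2) - (1 / 2) * (∫ x, U x t ^ 2) +
      ∫ τ in s..t, ∫ x, f (U x τ) * U x τ := by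
  set R : ℝ := (1 / 2) * (∫ x, U x s ^ 2) - (1 / 2) * (∫ x, U x t ^ 2) +
      ∫ τ in s..t, ∫ x, f (U x τ) * U x τ with hR
  set R' : ℕ → ℝ := fun n => (∫ x, truncationPrimitive (1 / ((n : ℝ) + 1)) (U x s)) -
    (∫ x, truncationPrimitive (1 / ((n : ℝ) + 1)) (U x t)) +
      ∫ τ in s..t, ∫ x, f (U x τ) * truncation (1 / ((n : ℝ) + 1)) (U x τ) with hR'
  have hPc : ∀ δ, Continuous (truncationPrimitive δ) := fun δ =>
    continuous_iff_continuousAt.mpr fun s => (hasDerivAt_truncationPrimitive δ s).continuousAt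
  have hTc : ∀ δ, Continuous (truncation δ) := fun δ => (contDiff_truncation δ (n := 0)).continuous
  have hfc := hU.locallyLipschitz.continuous
  have hprim : ∀ τ, ∀ δ > 0, |(∫ x, truncationPrimitive δ (U x τ)) - (1 / 2) * ∫ x, U x τ ^ 2| ≤
      δ * (2 * ∫ x, U x τ) := by
    intro τ δ hδ
    have hc := hU.continuous_slice τ
    have hPδ := hPc δ
    have i1 : Integrable fun x => truncationPrimitive δ (U x τ) :=
      hU.integrable_of_eq_zero (by fun_prop) fun x hx => by
        simp [hU.eq_zero x hx, truncationPrimitive]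
    have i2 : Integrable fun x => 1 / 2 * U x τ ^ 2 :=
      hU.integrable_of_eq_zero (by fun_prop) fun x hx => by simp [hU.eq_zero x hx]
    rw [← integral_const_mul, ← integral_const_mul, ← integral_const_mul, ← integral_sub i1 i2]
    refine norm_integral_le_of_norm_le (f := fun x => truncationPrimitive δ (U x τ) -
      1 / 2 * U x τ ^ 2) (g := fun x => δ * (2 * U x τ)) (hU.integrable_of_eq_zero
        (by fun_prop) fun x hx => by simp [hU.eq_zero x hx]) (Eventually.of_forall fun x => ?_)
    have := abs_truncationPrimitive_sub_le hδ (hU.nonneg x τ)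
    rw [Real.norm_eq_abs, show 1 / 2 * U x τ ^ 2 = U x τ ^ 2 / 2 by ring]
    exact this.trans_eq (by ring)
  have hc1 : ∀ δ, Continuous fun τ => ∫ x, f (U x τ) * truncation δ (U x τ) :=
    hU.continuous_truncated_source
  have hUc := hU.continuous
  have hUc' : Continuous fun p : EuclideanSpace ℝ (Fin N) × ℝ => U p.1 p.2 := hUc
  have hc2 : Continuous fun τ => ∫ x, f (U x τ) * U x τ :=
    hU.continuous_integral_of_eq_zero (by
      simp only [Function.uncurry_def]; fun_prop) fun x hx t => by simp [hU.eq_zero x hx]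
  have hc3 : Continuous fun τ => ∫ x, |f (U x τ)| :=
    hU.continuous_integral_of_eq_zero (by
      simp only [Function.uncurry_def]; fun_prop)
        fun x hx t => by simp [hU.eq_zero x hx, hU.map_zero]
  have hsrc : ∀ δ > 0, |(∫ τ in s..t, ∫ x, f (U x τ) * truncation δ (U x τ)) -
      ∫ τ in s..t, ∫ x, f (U x τ) * U x τ| ≤ δ * (2 * ∫ τ in s..t, ∫ x, |f (U x τ)|) := by
    intro δ hδ
    rw [← intervalIntegral.integral_const_mul, ← intervalIntegral.integral_const_mul,
      ← intervalIntegral.integral_sub ((hc1 δ).intervalIntegrable _ _)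
      (hc2.intervalIntegrable _ _)]
    refine intervalIntegral.norm_integral_le_of_norm_le (f := fun τ =>
      (∫ x, f (U x τ) * truncation δ (U x τ)) - ∫ x, f (U x τ) * U x τ) hst
      (Eventually.of_forall fun τ _ => ?_) (Continuous.intervalIntegrable (by fun_prop) _ _)
    have hc := hU.continuous_slice τ
    have hTδ := hTc δ
    rw [← integral_const_mul, ← integral_const_mul, ← integral_sub
      (hU.integrable_of_eq_zero (by fun_prop) fun x hx => by
        simp [hU.eq_zero x hx, hU.map_zero])
      (hU.integrable_of_eq_zero (by fun_prop) fun x hx => by simp [hU.eq_zero x hx])]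
    refine norm_integral_le_of_norm_le (hU.integrable_of_eq_zero (by fun_prop) fun x hx => by
        simp [hU.eq_zero x hx, hU.map_zero]) (Eventually.of_forall fun x => ?_)
    have := abs_truncation_sub_le hδ (hU.nonneg x τ)
    rw [← mul_sub, norm_mul, Real.norm_eq_abs, Real.norm_eq_abs]
    nlinarith [abs_nonneg (f (U x τ))]
  have hlim : Tendsto R' atTop (𝓝 R) := by
    have hz : Tendsto (fun n : ℕ => 1 / ((n : ℝ) + 1) * ((2 * ∫ x, U x s) + (2 * ∫ x, U x t) +
        2 * ∫ τ in s..t, ∫ x, |f (U x τ)|)) atTop (𝓝 0) := by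
      simpa only [zero_mul] using
        (tendsto_one_div_add_atTop_nhds_zero_nat (𝕜 := ℝ)).mul_const ((2 * ∫ x, U x s) +
          (2 * ∫ x, U x t) + 2 * ∫ τ in s..t, ∫ x, |f (U x τ)|)
    rw [tendsto_iff_norm_sub_tendsto_zero]
    refine squeeze_zero (fun n => norm_nonneg _) (fun n => ?_) hz
    have hδ : (0 : ℝ) < 1 / ((n : ℝ) + 1) := by positivity
    have h1 := abs_le.1 (hprim s _ hδ)
    have h2 := abs_le.1 (hprim t _ hδ)
    have h3 := abs_le.1 (hsrc _ hδ)
    rw [Real.norm_eq_abs, abs_le, hR, hR']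
    constructor <;> simp only <;> linarith [h1.1, h1.2, h2.1, h2.2, h3.1, h3.2]
  have hn := fun n : ℕ => hU.lintegral_truncated_dirichlet_le hs hst ht
    (δ := 1 / ((n : ℝ) + 1)) (by positivity)
  have hR0 : 0 ≤ R := ge_of_tendsto' hlim fun n => (hn n).1
  have hfatou : ∫⁻ τ in Ioc s t, ENNReal.ofReal (dirichletEnergy Ω U τ) ≤ ENNReal.ofReal R := by
    have h1 : ∀ τ ∈ Ioc s t, ENNReal.ofReal (dirichletEnergy Ω U τ) =
        liminf (fun n : ℕ => ENNReal.ofReal (∫ x in Ω, deriv (truncation (1 / ((n : ℝ) + 1)))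
          (U x τ) * ‖gradient (fun y => U y τ) x‖ ^ 2)) atTop := by
      intro τ hτ
      have := (ENNReal.continuous_ofReal.tendsto _).comp (hU.tendsto_truncated_dirichlet
        ⟨hs.trans hτ.1.le, hτ.2.trans_lt ht⟩ 1)
      simp only [pow_one] at this
      exact this.liminf_eq.symm
    rw [setLIntegral_congr_fun measurableSet_Ioc h1]
    refine (lintegral_liminf_le fun n =>
      (hU.measurable_truncated_dirichlet _).ennreal_ofReal).trans ?_
    have h2 := ((ENNReal.continuous_ofReal.tendsto _).comp hlim).liminf_eq
    rw [← h2]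
    exact liminf_le_liminf (Eventually.of_forall fun n => (hn n).2)
  have hmeas : Measurable (dirichletEnergy Ω U) := hU.measurable_dirichlet
  have hInt : IntegrableOn (dirichletEnergy Ω U) (Ioc s t) := by
    refine ⟨hmeas.aestronglyMeasurable, ?_⟩
    rw [hasFiniteIntegral_iff_ofReal (Eventually.of_forall (dirichletEnergy_nonneg Ω U))]
    exact hfatou.trans_lt ENNReal.ofReal_lt_top
  refine ⟨(intervalIntegrable_iff_integrableOn_Ioc_of_le hst).2 hInt, ?_⟩
  rw [intervalIntegral.integral_of_le hst, ← ENNReal.ofReal_le_ofReal_iff hR0,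
    ofReal_integral_eq_lintegral_ofReal hInt (Eventually.of_forall (dirichletEnergy_nonneg Ω U))]
  exact hfatou

end IsHeatSolution

open Convolution in
/-- A compactly supported `C¹` function can be approximated in `C¹` by `C²` functions with
compact support in a prescribed neighbourhood of its support. -/
lemma exists_contDiff_two_near {N : ℕ} {Ω : Set (EuclideanSpace ℝ (Fin N))} (hΩ : IsOpen Ω)
    {φ : EuclideanSpace ℝ (Fin N) → ℝ} (hφ : ContDiff ℝ 1 φ) (hc : HasCompactSupport φ)
    (hs : tsupport φ ⊆ Ω) {ε : ℝ} (hε : 0 < ε) :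
    ∃ ψ : EuclideanSpace ℝ (Fin N) → ℝ, ContDiff ℝ 2 ψ ∧ HasCompactSupport ψ ∧ tsupport ψ ⊆ Ω ∧
      (∀ x, |ψ x - φ x| ≤ ε) ∧ ∀ x, ‖fderiv ℝ ψ x - fderiv ℝ φ x‖ ≤ ε := by
  obtain ⟨r₁, hr₁, h1⟩ := IsCompact.exists_cthickening_subset_open hc hΩ hs
  obtain ⟨r₂, hr₂, h2⟩ := Metric.uniformContinuous_iff.1
    (hc.uniformContinuous_of_continuous hφ.continuous) ε hε
  obtain ⟨r₃, hr₃, h3⟩ := Metric.uniformContinuous_iff.1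
    ((hc.fderiv ℝ).uniformContinuous_of_continuous (hφ.continuous_fderiv one_ne_zero)) ε hε
  set r := min r₁ (min r₂ r₃) with hr
  have hr0 : 0 < r := lt_min hr₁ (lt_min hr₂ hr₃)
  obtain ⟨ρ, hρ⟩ : ∃ ρ : ContDiffBump (0 : EuclideanSpace ℝ (Fin N)), ρ.rOut = r :=
    ⟨⟨r / 2, r, by positivity, by linarith⟩, rfl⟩
  have hder : ∀ x, HasFDerivAt (ρ.normed volume ⋆[ContinuousLinearMap.lsmul ℝ ℝ, volume] φ)
      ((ρ.normed volume ⋆[ContinuousLinearMap.lsmul ℝ ℝ, volume] fderiv ℝ φ) x) x := by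
    intro x
    have h := hc.hasFDerivAt_convolution_right (μ := volume) (ContinuousLinearMap.lsmul ℝ ℝ)
      (ρ.continuous_normed (μ := volume)).locallyIntegrable hφ x
    refine h.congr_fderiv ?_
    rw [convolution_def, convolution_def]
    refine integral_congr_ae (Filter.Eventually.of_forall fun y => ?_)
    ext v
    simp [ContinuousLinearMap.precompR_apply]
  refine ⟨ρ.normed volume ⋆[ContinuousLinearMap.lsmul ℝ ℝ, volume] φ, ?_, ?_, ?_, ?_, ?_⟩
  · have h : ContDiff ℝ ((2 : ℕ∞) : WithTop ℕ∞)
        (ρ.normed volume ⋆[ContinuousLinearMap.lsmul ℝ ℝ, volume] φ) :=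
      (ρ.hasCompactSupport_normed (μ := volume)).contDiff_convolution_left (μ := volume)
        (ContinuousLinearMap.lsmul ℝ ℝ) ρ.contDiff_normed hφ.continuous.locallyIntegrable
    exact h
  · exact ρ.hasCompactSupport_normed.convolution _ hc
  · refine (closure_minimal ?_ Metric.isClosed_cthickening).trans h1
    refine (support_convolution_subset _).trans ?_
    rintro _ ⟨y, hy, z, hz, rfl⟩
    rw [ρ.support_normed_eq, Metric.mem_ball, dist_zero_right] at hy
    refine Metric.mem_cthickening_of_dist_le _ z _ _ (subset_tsupport _ hz) ?_
    rw [dist_eq_norm]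
    simpa using hy.le.trans (hρ.le.trans (min_le_left _ _))
  · intro x
    refine ContDiffBump.dist_normed_convolution_le hφ.continuous.aestronglyMeasurable
      fun y hy => (h2 ?_).le
    exact (Metric.mem_ball.1 hy).trans_le (hρ.le.trans <|
      (min_le_right _ _).trans (min_le_left _ _))
  · intro x
    rw [(hder x).fderiv, ← dist_eq_norm]
    refine ContDiffBump.dist_normed_convolution_le (g := fderiv ℝ φ)
      (hφ.continuous_fderiv one_ne_zero).aestronglyMeasurable fun y hy => (h3 ?_).le
    exact (Metric.mem_ball.1 hy).trans_le (hρ.le.trans <|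
      (min_le_right _ _).trans (min_le_right _ _))

lemma integrable_norm_fderiv_sq {N : ℕ} {φ : EuclideanSpace ℝ (Fin N) → ℝ}
    (hφ : ContDiff ℝ 1 φ) (hc : HasCompactSupport φ) :
    Integrable fun x => ‖fderiv ℝ φ x‖ ^ 2 := by
  have hcont : Continuous fun x => ‖fderiv ℝ φ x‖ ^ 2 :=
    (hφ.continuous_fderiv one_ne_zero).norm.pow 2
  refine hcont.integrable_of_hasCompactSupport ((hc.fderiv ℝ).mono fun x hx h => hx ?_)
  simp [h]

/-- A lower bound for the increment over `[s, t]` of the pairing of a solution with `φ`; for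
`L = ∫ ‖∇φ‖²` it follows from the weak form of the equation and Young's inequality. -/
def HasIncrementBound {N : ℕ} (Ω : Set (EuclideanSpace ℝ (Fin N))) (f : ℝ → ℝ)
    (U : EuclideanSpace ℝ (Fin N) → ℝ → ℝ) (s t : ℝ) (φ : EuclideanSpace ℝ (Fin N) → ℝ)
    (L : ℝ) : Prop :=
  (∫ τ in s..t, ∫ x, f (U x τ) * φ x) - (1 / 2) * (∫ τ in s..t, dirichletEnergy Ω U τ) -
    (1 / 2) * (t - s) * L ≤ (∫ x, U x t * φ x) - ∫ x, U x s * φ x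

namespace IsHeatSolution

variable {N : ℕ} {Ω : Set (EuclideanSpace ℝ (Fin N))} {b : ℝ} {f : ℝ → ℝ}
  {U : EuclideanSpace ℝ (Fin N) → ℝ → ℝ}

lemma abs_integral_mul_sub_integral_mul_le (hU : IsHeatSolution Ω b f U)
    {a φ ψ : EuclideanSpace ℝ (Fin N) → ℝ} (ha : Continuous a) (h0 : ∀ x ∉ Ω, a x = 0)
    (hφ : Continuous φ) (hψ : Continuous ψ) {ε : ℝ} (h : ∀ x, |ψ x - φ x| ≤ ε) :
    |(∫ x, a x * ψ x) - ∫ x, a x * φ x| ≤ ε * ∫ x, |a x| := by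
  have i1 : ∀ {ψ : EuclideanSpace ℝ (Fin N) → ℝ}, Continuous ψ →
      Integrable fun x => a x * ψ x := fun hψ =>
    hU.integrable_of_eq_zero (by fun_prop) fun x hx => by simp [h0 x hx]
  rw [← integral_sub (i1 hψ) (i1 hφ), ← integral_const_mul]
  refine norm_integral_le_of_norm_le (f := fun x => a x * ψ x - a x * φ x)
    (g := fun x => ε * |a x|) (hU.integrable_of_eq_zero (by fun_prop)
      fun x hx => by simp [h0 x hx]) (Filter.Eventually.of_forall fun x => ?_)
  rw [← mul_sub, norm_mul, Real.norm_eq_abs, Real.norm_eq_abs, mul_comm]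
  exact mul_le_mul_of_nonneg_right (h x) (abs_nonneg _)

lemma hasIncrementBound_of_forall_near (hU : IsHeatSolution Ω b f U) {s t : ℝ} (hst : s ≤ t)
    {φ : EuclideanSpace ℝ (Fin N) → ℝ} (hφ : Continuous φ) {L : ℝ}
    (h : ∀ ε > 0, ∃ (ψ : EuclideanSpace ℝ (Fin N) → ℝ) (L' : ℝ), Continuous ψ ∧
      (∀ x, |ψ x - φ x| ≤ ε) ∧ L' ≤ L + ε ∧ HasIncrementBound Ω f U s t ψ L') :
    HasIncrementBound Ω f U s t φ L := by
  have hfc := hU.locallyLipschitz.continuous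
  have hUc : Continuous fun p : EuclideanSpace ℝ (Fin N) × ℝ => U p.1 p.2 := hU.continuous
  set K : ℝ := (∫ x, |U x t|) + (∫ x, |U x s|) + (∫ τ in s..t, ∫ x, |f (U x τ)|) +
    (1 / 2) * (t - s) with hK
  have hK0 : 0 ≤ K := by
    have h1 : 0 ≤ ∫ x, |U x t| := integral_nonneg fun _ => abs_nonneg _
    have h2 : 0 ≤ ∫ x, |U x s| := integral_nonneg fun _ => abs_nonneg _
    have h3 : 0 ≤ ∫ τ in s..t, ∫ x, |f (U x τ)| :=
      intervalIntegral.integral_nonneg hst fun _ _ => integral_nonneg fun _ => abs_nonneg _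
    linarith
  have hc3 : Continuous fun τ => ∫ x, |f (U x τ)| :=
    hU.continuous_integral_of_eq_zero (by
      simp only [Function.uncurry_def]; fun_prop)
        fun x hx t => by simp [hU.eq_zero x hx, hU.map_zero]
  refine le_of_forall_pos_le_add fun η hη => ?_
  obtain ⟨ψ, L', hψ, hψφ, hL, hb⟩ := h (η / (K + 1)) (by positivity)
  set ε := η / (K + 1) with hε
  have hε0 : 0 < ε := by positivity
  have hεK : ε * K ≤ η := by
    rw [hε, div_mul_eq_mul_div, div_le_iff₀ (by positivity)]
    nlinarith
  have e1 := fun r => abs_le.1 (hU.abs_integral_mul_sub_integral_mul_le (hU.continuous_slice r)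
    (fun x hx => hU.eq_zero x hx r) hφ hψ hψφ)
  have e2 : |(∫ τ in s..t, ∫ x, f (U x τ) * ψ x) - ∫ τ in s..t, ∫ x, f (U x τ) * φ x| ≤
      ε * ∫ τ in s..t, ∫ x, |f (U x τ)| := by
    rw [← intervalIntegral.integral_const_mul, ← intervalIntegral.integral_sub
      ((hU.continuous_integral_comp_mul hψ).intervalIntegrable _ _)
      ((hU.continuous_integral_comp_mul hφ).intervalIntegrable _ _)]
    refine intervalIntegral.norm_integral_le_of_norm_le (f := fun τ =>
      (∫ x, f (U x τ) * ψ x) - ∫ x, f (U x τ) * φ x) hst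
      (Filter.Eventually.of_forall fun τ _ => ?_) (Continuous.intervalIntegrable (by fun_prop) _ _)
    have hc := hU.continuous_slice τ
    exact hU.abs_integral_mul_sub_integral_mul_le (a := fun x => f (U x τ)) (by fun_prop)
      (fun x hx => by simp [hU.eq_zero x hx, hU.map_zero]) hφ hψ hψφ
  have e3 := abs_le.1 e2
  unfold HasIncrementBound at hb
  have h4 : (1 / 2) * (t - s) * L' ≤ (1 / 2) * (t - s) * (L + ε) :=
    mul_le_mul_of_nonneg_left hL (by linarith)
  rw [hK] at hεK
  have h5 := (e1 t).2
  have h6 := (e1 s).1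
  linarith [e3.1]

lemma hasIncrementBound_of_contDiff_two (hU : IsHeatSolution Ω b f U) {s t : ℝ} (hs : 0 ≤ s)
    (hst : s ≤ t) (ht : t < b) {φ : EuclideanSpace ℝ (Fin N) → ℝ} (hφ : ContDiff ℝ 2 φ)
    (hc : HasCompactSupport φ) (hsub : tsupport φ ⊆ Ω) :
    HasIncrementBound Ω f U s t φ (∫ x in Ω, ‖fderiv ℝ φ x‖ ^ 2) := by
  have hInt := (hU.intervalIntegrable_and_integral_dirichletEnergy_le hs hst ht).1
  have hcL := hU.continuous_integral_mul hφ.continuous_laplacian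
  have hcf := hU.continuous_integral_comp_mul hφ.continuous
  have hFTC := intervalIntegral.integral_eq_sub_of_hasDerivAt_of_le hst
    (hU.continuous_integral_mul hφ.continuous).continuousOn
    (fun r hr => hU.hasDerivAt_integral_mul ⟨hs.trans_lt hr.1, hr.2.trans ht⟩ hφ hc hsub)
    ((hcL.add hcf).intervalIntegrable _ _)
  rw [HasIncrementBound, ← hFTC]
  set L := ∫ x in Ω, ‖fderiv ℝ φ x‖ ^ 2 with hL
  have h1 : (∫ τ in s..t, ∫ x, f (U x τ) * φ x) - (1 / 2) * (∫ τ in s..t, dirichletEnergy Ω U τ) -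
      (1 / 2) * (t - s) * L = ∫ τ in s..t, ((∫ x, f (U x τ) * φ x) -
        (1 / 2) * dirichletEnergy Ω U τ - (1 / 2) * L) := by
    rw [intervalIntegral.integral_sub ((hcf.intervalIntegrable _ _).sub (hInt.const_mul _))
      (by simp), intervalIntegral.integral_sub (hcf.intervalIntegrable _ _) (hInt.const_mul _),
      intervalIntegral.integral_const_mul, intervalIntegral.integral_const, smul_eq_mul]
    ring
  rw [h1]
  refine intervalIntegral.integral_mono_on_of_le_Ioo hst
    (((hcf.intervalIntegrable _ _).sub (hInt.const_mul _)).sub (by simp))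
    ((hcL.add hcf).intervalIntegrable _ _) fun r hr => ?_
  have hr0 : r ∈ Ico 0 b := ⟨hs.trans hr.1.le, hr.2.trans ht⟩
  rw [integral_mul_laplacian_of_tsupport_subset hU.isOpen (hU.contDiffOn_one hr0) hφ hc hsub]
  have hLi : IntegrableOn (fun x => ‖fderiv ℝ φ x‖ ^ 2) Ω :=
    (integrable_norm_fderiv_sq (hφ.of_le (by norm_num)) hc).integrableOn
  have h2 : ∫ x, ∑ i, fderiv ℝ (fun y => U y r) x (EuclideanSpace.single i 1) *
      fderiv ℝ φ x (EuclideanSpace.single i 1) ≤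
      ∫ x in Ω, ((1 / 2) * ‖gradient (fun y => U y r) x‖ ^ 2 + (1 / 2) * ‖fderiv ℝ φ x‖ ^ 2) := by
    rw [← setIntegral_eq_integral_of_forall_compl_eq_zero (s := Ω)]
    · refine integral_mono (Integrable.integrableOn ?_)
        (((hU.integrableOn_gradient r hr0).const_mul _).add (hLi.const_mul _)) fun x => ?_
      · exact integrable_finsetSum _ fun i _ => integrable_mul_of_tsupport_subset hU.isOpen
          ((hU.contDiffOn_one hr0).continuousOn_fderiv_apply hU.isOpen _)
          ((hφ.fderiv_apply_const _).continuous) (hc.fderiv_apply ℝ _)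
          ((tsupport_fderiv_apply_subset ℝ _).trans hsub)
      · simp only
        rw [← norm_gradient φ, norm_gradient_sq, norm_gradient_sq, Finset.mul_sum, Finset.mul_sum,
          ← Finset.sum_add_distrib]
        refine Finset.sum_le_sum fun i _ => ?_
        nlinarith [sq_nonneg (fderiv ℝ (fun y => U y r) x (EuclideanSpace.single i 1) -
          fderiv ℝ φ x (EuclideanSpace.single i 1))]
    · intro x hx
      have : fderiv ℝ φ x = 0 := image_eq_zero_of_notMem_tsupport
        fun h => hx (hsub (tsupport_fderiv_subset ℝ h))
      simp [this]
  rw [integral_add ((hU.integrableOn_gradient r hr0).const_mul _) (hLi.const_mul _),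
    integral_const_mul, integral_const_mul] at h2
  rw [dirichletEnergy]
  linarith

lemma hasIncrementBound_of_contDiff_one (hU : IsHeatSolution Ω b f U) {s t : ℝ} (hs : 0 ≤ s)
    (hst : s ≤ t) (ht : t < b) {φ : EuclideanSpace ℝ (Fin N) → ℝ} (hφ : ContDiff ℝ 1 φ)
    (hc : HasCompactSupport φ) (hsub : tsupport φ ⊆ Ω) :
    HasIncrementBound Ω f U s t φ (∫ x in Ω, ‖fderiv ℝ φ x‖ ^ 2) := by
  obtain ⟨C, hC⟩ := (hc.fderiv ℝ).exists_bound_of_continuous (hφ.continuous_fderiv one_ne_zero)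
  have hC0 : 0 ≤ C := (norm_nonneg _).trans (hC 0)
  have hvol : volume Ω ≠ ⊤ := hU.isBounded.measure_lt_top.ne
  set V : ℝ := volume.real Ω with hV
  have hV0 : 0 ≤ V := measureReal_nonneg
  refine hU.hasIncrementBound_of_forall_near hst hφ.continuous fun ε hε => ?_
  set η := min (min ε 1) (ε / ((2 * C + 1) * V + 1)) with hη
  have hη0 : 0 < η := lt_min (lt_min hε one_pos) (by positivity)
  have hη1 : η ≤ 1 := (min_le_left _ _).trans (min_le_right _ _)
  have hη2 : η * ((2 * C + 1) * V) ≤ ε := by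
    have : η ≤ ε / ((2 * C + 1) * V + 1) := min_le_right _ _
    rw [le_div_iff₀ (by positivity)] at this
    linarith
  obtain ⟨ψ, hψ, hψc, hψs, h1, h2⟩ := exists_contDiff_two_near hU.isOpen hφ hc hsub hη0
  refine ⟨ψ, _, hψ.continuous, fun x => (h1 x).trans ((min_le_left _ _).trans (min_le_left _ _)),
    ?_, hU.hasIncrementBound_of_contDiff_two hs hst ht hψ hψc hψs⟩
  have h3 : ∀ x, ‖fderiv ℝ ψ x‖ ^ 2 ≤ ‖fderiv ℝ φ x‖ ^ 2 + η * (2 * C + 1) := by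
    intro x
    have h4 : ‖fderiv ℝ ψ x‖ ≤ ‖fderiv ℝ φ x‖ + η := by
      linarith [norm_sub_norm_le (fderiv ℝ ψ x) (fderiv ℝ φ x), h2 x]
    have h5 := hC x
    have h6 := norm_nonneg (fderiv ℝ φ x)
    have h7 := norm_nonneg (fderiv ℝ ψ x)
    nlinarith [mul_le_mul_of_nonneg_left h5 hη0.le, mul_le_mul_of_nonneg_left hη1 hη0.le]
  have hφi := (integrable_norm_fderiv_sq hφ hc).integrableOn (s := Ω)
  have hci : IntegrableOn (fun _ : EuclideanSpace ℝ (Fin N) => η * (2 * C + 1)) Ω :=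
    integrableOn_const hvol
  calc ∫ x in Ω, ‖fderiv ℝ ψ x‖ ^ 2
      ≤ ∫ x in Ω, (‖fderiv ℝ φ x‖ ^ 2 + η * (2 * C + 1)) :=
        integral_mono (integrable_norm_fderiv_sq (hψ.of_le (by norm_num)) hψc).integrableOn
          (Integrable.add hφi hci) h3
    _ = (∫ x in Ω, ‖fderiv ℝ φ x‖ ^ 2) + η * ((2 * C + 1) * V) := by
        rw [integral_add hφi hci, setIntegral_const, smul_eq_mul]
        ring
    _ ≤ _ := by linarith

open Filter Topology in
/-- The increment bound with the solution at the initial time of the interval as test function. -/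
lemma hasIncrementBound_slice (hU : IsHeatSolution Ω b f U) {s t : ℝ} (hs : 0 ≤ s)
    (hst : s ≤ t) (ht : t < b) :
    HasIncrementBound Ω f U s t (fun x => U x s) (dirichletEnergy Ω U s) := by
  have hs' : s ∈ Ico 0 b := ⟨hs, hst.trans_lt ht⟩
  have hv := hU.continuous_slice s
  have h0 : ∀ x ∉ Ω, U x s = 0 := fun x hx => hU.eq_zero x hx s
  refine hU.hasIncrementBound_of_forall_near hst hv fun ε hε => ?_
  have h1 := (hU.tendsto_truncated_dirichlet hs' 2).eventually_le_const
    (show dirichletEnergy Ω U s < dirichletEnergy Ω U s + ε by linarith)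
  have h2 : Tendsto (fun n : ℕ => 2 * (1 / ((n : ℝ) + 1))) atTop (𝓝 (2 * 0)) :=
    tendsto_one_div_add_atTop_nhds_zero_nat.const_mul 2
  rw [mul_zero] at h2
  obtain ⟨n, hn1, hn2⟩ := (h1.and (h2.eventually_le_const hε)).exists
  set δ : ℝ := 1 / ((n : ℝ) + 1) with hδ
  have hδ0 : 0 < δ := by positivity
  have hcd : ContDiff ℝ 1 fun x => truncation δ (U x s) :=
    contDiff_truncation_comp hU.isOpen hv (hU.contDiffOn_one hs') h0 hδ0
  refine ⟨fun x => truncation δ (U x s), _, hcd.continuous,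
    fun x => (abs_truncation_sub_le hδ0 (hU.nonneg x s)).trans hn2, ?_,
    hU.hasIncrementBound_of_contDiff_one hs hst ht hcd
      (hasCompactSupport_truncation_comp hv hU.isBounded h0 hδ0)
      (tsupport_truncation_comp_subset_of_eq_zero hv h0 hδ0)⟩
  refine le_of_eq_of_le (setIntegral_congr_fun hU.isOpen.measurableSet fun x hx => ?_) hn1
  have hd : DifferentiableAt ℝ (fun y => U y s) x :=
    ((hU.contDiffOn_one hs').contDiffAt (hU.isOpen.mem_nhds hx)).differentiableAt one_ne_zero
  rw [fderiv_truncation_comp hd, norm_smul, norm_gradient, mul_pow, Real.norm_eq_abs, sq_abs]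

end IsHeatSolution

open Filter Topology in
lemma tendsto_integral_difference_quotient {e : ℝ → ℝ} (he : Continuous e) (a b : ℝ) :
    Tendsto (fun h => (∫ r in a..b, (e (r + h) - e r)) / h) (𝓝[>] 0) (𝓝 (e b - e a)) := by
  have hd : HasDerivAt (fun h => (∫ r in b..b + h, e r) - ∫ r in a..a + h, e r)
      (e b - e a) 0 := by
    have h1 : ∀ x, HasDerivAt (fun h => ∫ r in x..x + h, e r) (e x) 0 := fun x => by
      have h2 := (he.integral_hasStrictDerivAt x (x + 0)).hasDerivAt
      have h3 := h2.comp_const_add x 0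
      simpa using h3
    exact (h1 b).fun_sub (h1 a)
  have h4 := (hasDerivWithinAt_iff_tendsto_slope' (s := Ioi 0) (by simp)).1
    (hd.hasDerivWithinAt (s := Ioi 0))
  refine h4.congr fun h => ?_
  have hi : ∀ x y, IntervalIntegrable e volume x y := fun x y => he.intervalIntegrable x y
  have hi' : IntervalIntegrable (fun r => e (r + h)) volume a b :=
    Continuous.intervalIntegrable (by fun_prop) _ _
  rw [slope_def_field, intervalIntegral.integral_sub hi' (hi _ _),
    intervalIntegral.integral_comp_add_right (fun r => e r)]
  simp only [add_zero, intervalIntegral.integral_same, sub_zero]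
  congr 1
  rw [← intervalIntegral.integral_add_adjacent_intervals (hi a (a + h)) (hi (a + h) b),
    ← intervalIntegral.integral_add_adjacent_intervals (hi (a + h) b) (hi b (b + h))]
  ring

open Filter Topology in
/-- A continuous function whose forward differences are bounded below, uniformly to first order,
by an integrable function grows at least as much as the integral of that function. -/
lemma integral_le_sub_of_forward_difference_ge {e g : ℝ → ℝ} (he : Continuous e) {a b : ℝ}
    (hab : a ≤ b) (hg : IntervalIntegrable g volume a b)
    (h : ∀ ε > 0, ∀ᶠ h in 𝓝[>] (0 : ℝ), ∀ r ∈ Icc a b, h * (g r - ε) ≤ e (r + h) - e r) :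
    ∫ r in a..b, g r ≤ e b - e a := by
  have hlim := tendsto_integral_difference_quotient he a b
  have key : ∀ ε > 0, (∫ r in a..b, g r) - (b - a) * ε ≤ e b - e a := by
    intro ε hε
    refine ge_of_tendsto hlim ?_
    filter_upwards [h ε hε, self_mem_nhdsWithin] with h' hh hpos
    rw [le_div_iff₀ hpos, mul_comm]
    calc h' * ((∫ r in a..b, g r) - (b - a) * ε) = ∫ r in a..b, h' * (g r - ε) := by
          rw [intervalIntegral.integral_const_mul, intervalIntegral.integral_sub hg (by simp),
            intervalIntegral.integral_const, smul_eq_mul]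
      _ ≤ _ := intervalIntegral.integral_mono_on hab ((hg.sub (by simp)).const_mul _)
          (Continuous.intervalIntegrable (by fun_prop) _ _) hh
  refine le_of_forall_pos_le_add fun η hη => ?_
  have h1 := key (η / (b - a + 1)) (div_pos hη (by linarith))
  have h2 : (b - a) * (η / (b - a + 1)) ≤ η := by
    rw [mul_div_assoc', div_le_iff₀ (by linarith)]
    nlinarith
  linarith

open Filter Topology in
lemma eventually_forall_mul_le_integral {c : ℝ → ℝ → ℝ} (hc : Continuous (Function.uncurry c))
    (a b : ℝ) {ε : ℝ} (hε : 0 < ε) :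
    ∀ᶠ h in 𝓝[>] (0 : ℝ), ∀ r ∈ Icc a b, h * (c r r - ε) ≤ ∫ τ in r..r + h, c τ r := by
  have huc := (isCompact_Icc (a := a) (b := b + 1) |>.prod
    (isCompact_Icc (a := a) (b := b + 1))).uniformContinuousOn_of_continuous hc.continuousOn
  obtain ⟨δ, hδ, h⟩ := Metric.uniformContinuousOn_iff.1 huc ε hε
  filter_upwards [Ioo_mem_nhdsGT (show 0 < min δ 1 by positivity)] with h' hh r hr
  have h1 : h' < δ := hh.2.trans_le (min_le_left _ _)
  have h2 : h' < 1 := hh.2.trans_le (min_le_right _ _)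
  have h0 : 0 < h' := hh.1
  have h3 : (∫ _ in r..r + h', (c r r - ε)) = h' * (c r r - ε) := by
    rw [intervalIntegral.integral_const, smul_eq_mul, add_sub_cancel_left]
  rw [← h3]
  refine intervalIntegral.integral_mono_on (by linarith) (by simp)
    (Continuous.intervalIntegrable ?_ _ _) fun τ hτ => ?_
  · exact hc.comp (Continuous.prodMk_left r)
  · have h4 := h (τ, r) ⟨⟨hr.1.trans hτ.1, by linarith [hτ.2, hr.2]⟩, ⟨hr.1, by linarith [hr.2]⟩⟩
      (r, r) ⟨⟨hr.1, by linarith [hr.2]⟩, ⟨hr.1, by linarith [hr.2]⟩⟩ (by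
        rw [Prod.dist_eq, dist_self, Real.dist_eq]
        refine max_lt ?_ hδ
        rw [abs_of_nonneg (by linarith [hτ.1])]
        linarith [hτ.2])
    rw [Real.dist_eq, abs_lt] at h4
    simp only [Function.uncurry_apply_pair] at h4
    linarith [h4.1]

lemma mul_sub_le_integral_add_sq {f : ℝ → ℝ} (hf : Continuous f) {s : Set ℝ} (hs : Convex ℝ s)
    {L : NNReal} (hL : LipschitzOnWith L f s) {x y : ℝ} (hx : x ∈ s) (hy : y ∈ s) :
    f x * (x - y) ≤ (∫ r in 0..x, f r) - (∫ r in 0..y, f r) + L * (x - y) ^ 2 := by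
  have hi : ∀ p q, IntervalIntegrable f volume p q := fun p q => hf.intervalIntegrable p q
  rw [intervalIntegral.integral_interval_sub_left (hi 0 x) (hi 0 y)]
  have h1 : f x * (x - y) - ∫ r in y..x, f r = ∫ r in y..x, (f x - f r) := by
    rw [intervalIntegral.integral_sub (by simp) (hi y x), intervalIntegral.integral_const,
      smul_eq_mul, mul_comm]
  have h2 : ‖∫ r in y..x, (f x - f r)‖ ≤ (L * |x - y|) * |x - y| := by
    refine intervalIntegral.norm_integral_le_of_norm_le_const fun r hr => ?_
    have hr' : r ∈ uIcc y x := uIoc_subset_uIcc hr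
    have hrs : r ∈ s := hs.ordConnected.uIcc_subset hy hx hr'
    have h3 := hL.dist_le_mul x hx r hrs
    rw [Real.dist_eq, Real.dist_eq] at h3
    refine h3.trans ?_
    gcongr ?_ * ?_
    rw [abs_sub_comm x y, abs_sub_comm x r]
    rw [uIcc_comm] at hr'
    have := abs_sub_left_of_mem_uIcc hr'
    simpa [abs_sub_comm] using this
  rw [mul_assoc, abs_mul_abs_self] at h2
  have := (abs_le.1 h2).2
  nlinarith

namespace IsHeatSolution

variable {N : ℕ} {Ω : Set (EuclideanSpace ℝ (Fin N))} {b : ℝ} {f : ℝ → ℝ}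
  {U : EuclideanSpace ℝ (Fin N) → ℝ → ℝ}

lemma continuous_integral_of_eq_zero₂ (hU : IsHeatSolution Ω b f U)
    {h : EuclideanSpace ℝ (Fin N) → ℝ → ℝ → ℝ}
    (hh : Continuous fun p : (ℝ × ℝ) × EuclideanSpace ℝ (Fin N) => h p.2 p.1.1 p.1.2)
    (h0 : ∀ x ∉ Ω, ∀ s t, h x s t = 0) :
    Continuous (Function.uncurry fun s t => ∫ x, h x s t) := by
  have h1 : (Function.uncurry fun s t => ∫ x, h x s t) =
      fun p : ℝ × ℝ => ∫ x in closure Ω, h x p.1 p.2 := funext fun p =>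
    (setIntegral_eq_integral_of_forall_compl_eq_zero
      fun x hx => h0 x (fun h => hx (subset_closure h)) _ _).symm
  rw [h1]
  exact continuous_parametric_integral_of_continuous
    (f := fun (p : ℝ × ℝ) x => h x p.1 p.2) hh hU.isCompact_closure

lemma continuous_integral_sq (hU : IsHeatSolution Ω b f U) :
    Continuous fun t => ∫ x, U x t ^ 2 :=
  hU.continuous_integral_of_eq_zero (h := fun x t => U x t ^ 2) (hU.continuous.pow 2)
    fun x hx t => by simp [hU.eq_zero x hx]

lemma continuous_integral_sub_sq (hU : IsHeatSolution Ω b f U) :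
    Continuous (Function.uncurry fun s t => ∫ x, (U x t - U x s) ^ 2) := by
  have hUc : Continuous fun p : EuclideanSpace ℝ (Fin N) × ℝ => U p.1 p.2 := hU.continuous
  refine hU.continuous_integral_of_eq_zero₂ (h := fun x s t => (U x t - U x s) ^ 2) ?_
    fun x hx s t => by simp [hU.eq_zero x hx]
  fun_prop

lemma continuous_integral_comp_mul_slice (hU : IsHeatSolution Ω b f U) :
    Continuous (Function.uncurry fun τ s => ∫ x, f (U x τ) * U x s) := by
  have hUc : Continuous fun p : EuclideanSpace ℝ (Fin N) × ℝ => U p.1 p.2 := hU.continuous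
  have hf := hU.locallyLipschitz.continuous
  refine hU.continuous_integral_of_eq_zero₂ (h := fun x τ s => f (U x τ) * U x s) ?_
    fun x hx s t => by simp [hU.eq_zero x hx]
  fun_prop

lemma continuous_integral_comp_mul_self (hU : IsHeatSolution Ω b f U) :
    Continuous fun t => ∫ x, f (U x t) * U x t :=
  hU.continuous_integral_of_eq_zero (h := fun x t => f (U x t) * U x t)
    (hU.continuous_comp.mul hU.continuous) fun x hx t => by simp [hU.eq_zero x hx]

lemma integral_sub_sq (hU : IsHeatSolution Ω b f U) (s t : ℝ) :
    ∫ x, (U x t - U x s) ^ 2 =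
      (∫ x, U x t ^ 2) + (∫ x, U x s ^ 2) - 2 * ∫ x, U x t * U x s := by
  have hs := hU.continuous_slice s
  have ht := hU.continuous_slice t
  have h0 := hU.eq_zero
  have i1 : Integrable fun x => U x t ^ 2 :=
    hU.integrable_of_eq_zero (ht.pow 2) fun x hx => by simp [h0 x hx]
  have i2 : Integrable fun x => U x s ^ 2 :=
    hU.integrable_of_eq_zero (hs.pow 2) fun x hx => by simp [h0 x hx]
  have i3 : Integrable fun x => 2 * (U x t * U x s) :=
    hU.integrable_of_eq_zero ((ht.mul hs).const_mul 2) fun x hx => by simp [h0 x hx]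
  have i4 : Integrable fun x => U x t ^ 2 + U x s ^ 2 := i1.add i2
  rw [← integral_const_mul, ← integral_add i1 i2, ← integral_sub i4 i3]
  congr 1 with x
  ring

/-- The evolution variational inequality satisfied by the solution. -/
lemma integral_sub_sq_add_dirichletEnergy_le (hU : IsHeatSolution Ω b f U) {s t : ℝ}
    (hs : 0 ≤ s) (hst : s ≤ t) (ht : t < b) :
    (∫ x, (U x t - U x s) ^ 2) + ∫ τ in s..t, dirichletEnergy Ω U τ ≤
      (t - s) * dirichletEnergy Ω U s +
        2 * ∫ τ in s..t, ∫ x, f (U x τ) * (U x τ - U x s) := by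
  have h1 := (hU.intervalIntegrable_and_integral_dirichletEnergy_le hs hst ht).2
  have h2 := hU.hasIncrementBound_slice hs hst ht
  rw [HasIncrementBound] at h2
  have hG := hU.continuous_integral_comp_mul_self
  have hc := hU.continuous_integral_comp_mul (hU.continuous_slice s)
  have h3 : ∀ τ, ∫ x, f (U x τ) * (U x τ - U x s) =
      (∫ x, f (U x τ) * U x τ) - ∫ x, f (U x τ) * U x s := by
    intro τ
    have hf := hU.locallyLipschitz.continuous.comp (hU.continuous_slice τ)
    have i1 : Integrable fun x => f (U x τ) * U x τ :=
      hU.integrable_of_eq_zero (hf.mul (hU.continuous_slice τ)) fun x hx => by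
        simp [hU.eq_zero x hx]
    have i2 : Integrable fun x => f (U x τ) * U x s :=
      hU.integrable_of_eq_zero (hf.mul (hU.continuous_slice s)) fun x hx => by
        simp [hU.eq_zero x hx]
    rw [← integral_sub i1 i2]
    simp_rw [mul_sub]
  simp_rw [h3]
  rw [intervalIntegral.integral_sub (hG.intervalIntegrable _ _) (hc.intervalIntegrable _ _),
    hU.integral_sub_sq]
  have h4 : ∫ x, U x s * U x s = ∫ x, U x s ^ 2 := by simp_rw [sq]
  rw [h4] at h2
  linarith

lemma intervalIntegrable_dirichletEnergy (hU : IsHeatSolution Ω b f U) {s t : ℝ}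
    (hs : 0 ≤ s) (hst : s ≤ t) (ht : t < b) :
    IntervalIntegrable (dirichletEnergy Ω U) volume s t :=
  (hU.intervalIntegrable_and_integral_dirichletEnergy_le hs hst ht).1

open Filter Topology in
/-- The energy inequality opposite to the one for weak solutions. -/
lemma integral_comp_mul_sub_dirichletEnergy_le (hU : IsHeatSolution Ω b f U) {s t : ℝ}
    (hs : 0 ≤ s) (hst : s ≤ t) (ht : t < b) :
    2 * (∫ τ in s..t, ((∫ x, f (U x τ) * U x τ) - dirichletEnergy Ω U τ)) ≤
      (∫ x, U x t ^ 2) - ∫ x, U x s ^ 2 := by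
  obtain ⟨c, htc, hcb⟩ := exists_between ht
  have hG := hU.continuous_integral_comp_mul_self
  set n := (Ioc 0 c).indicator (dirichletEnergy Ω U) with hn
  have hc0 : 0 ≤ c := (hs.trans hst).trans htc.le
  have hni : ∀ p q, IntervalIntegrable n volume p q := fun p q => by
    have h1 : IntegrableOn (dirichletEnergy Ω U) (Ioc 0 c) := by
      rw [← intervalIntegrable_iff_integrableOn_Ioc_of_le hc0]
      exact hU.intervalIntegrable_dirichletEnergy le_rfl hc0 hcb
    exact ((integrable_indicator_iff measurableSet_Ioc).2 h1).intervalIntegrable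
  have hnE : ∀ p q, 0 ≤ p → p ≤ q → q ≤ c →
      ∫ τ in p..q, n τ = ∫ τ in p..q, dirichletEnergy Ω U τ := fun p q hp hpq hq => by
    refine intervalIntegral.integral_congr_ae (Eventually.of_forall fun τ hτ => ?_)
    rw [uIoc_of_le hpq] at hτ
    exact indicator_of_mem (show τ ∈ Ioc 0 c from ⟨hp.trans_lt hτ.1, hτ.2.trans hq⟩) _
  have hi := hU.intervalIntegrable_dirichletEnergy hs hst ht
  have he : Continuous fun r => (∫ x, U x r ^ 2) + ∫ τ in 0..r, n τ :=
    hU.continuous_integral_sq.add (intervalIntegral.continuous_primitive hni 0)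
  have hGi : IntervalIntegrable (fun τ => 2 * ∫ x, f (U x τ) * U x τ) volume s t :=
    (hG.const_mul 2).intervalIntegrable _ _
  have key := integral_le_sub_of_forward_difference_ge he hst (hGi.sub hi) ?_
  · rw [intervalIntegral.integral_sub hGi hi, intervalIntegral.integral_const_mul] at key
    have h1 : (∫ τ in 0..t, n τ) = (∫ τ in 0..s, n τ) + ∫ τ in s..t, n τ :=
      (intervalIntegral.integral_add_adjacent_intervals (hni _ _) (hni _ _)).symm
    rw [h1, hnE s t hs hst htc.le] at key
    rw [intervalIntegral.integral_sub (hG.intervalIntegrable _ _) hi]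
    linarith
  · intro ε hε
    filter_upwards [eventually_forall_mul_le_integral hU.continuous_integral_comp_mul_slice s t
      (half_pos hε), Ioo_mem_nhdsGT (sub_pos.2 htc)] with h hh hh2 r hr
    have hr0 : 0 ≤ r := hs.trans hr.1
    have hrh : r + h < c := by linarith [hr.2, hh2.2]
    have h1 := hU.hasIncrementBound_slice hr0 (by linarith [hh2.1] : r ≤ r + h)
      (hrh.trans hcb)
    rw [HasIncrementBound] at h1
    have h2 := hU.integral_sub_sq r (r + h)
    have h3 : 0 ≤ ∫ x, (U x (r + h) - U x r) ^ 2 := integral_nonneg fun x => sq_nonneg _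
    have h4 : ∫ x, U x r * U x r = ∫ x, U x r ^ 2 := by simp_rw [sq]
    rw [h4] at h1
    have h5 : (∫ τ in 0..r + h, n τ) = (∫ τ in 0..r, n τ) + ∫ τ in r..r + h, n τ :=
      (intervalIntegral.integral_add_adjacent_intervals (hni _ _) (hni _ _)).symm
    rw [hnE r (r + h) hr0 (by linarith [hh2.1]) hrh.le] at h5
    have h6 := hh r hr
    linarith

end IsHeatSolution

/-- The free energy `∫ ∫₀^U f - ½ ∫ ‖∇U‖²` of a solution at time `t`. -/
noncomputable def freeEnergy {N : ℕ} (Ω : Set (EuclideanSpace ℝ (Fin N))) (f : ℝ → ℝ)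
    (U : EuclideanSpace ℝ (Fin N) → ℝ → ℝ) (t : ℝ) : ℝ :=
  (∫ x, ∫ r in 0..U x t, f r) - (1 / 2) * dirichletEnergy Ω U t

namespace IsHeatSolution

variable {N : ℕ} {Ω : Set (EuclideanSpace ℝ (Fin N))} {b : ℝ} {f : ℝ → ℝ}
  {U : EuclideanSpace ℝ (Fin N) → ℝ → ℝ}

lemma continuous_primitive (hU : IsHeatSolution Ω b f U) : Continuous fun y => ∫ r in 0..y, f r :=
  intervalIntegral.continuous_primitive
    (fun _ _ => hU.locallyLipschitz.continuous.intervalIntegrable _ _) 0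

lemma continuous_integral_primitive (hU : IsHeatSolution Ω b f U) :
    Continuous fun t => ∫ x, ∫ r in 0..U x t, f r :=
  hU.continuous_integral_of_eq_zero (h := fun x t => ∫ r in 0..U x t, f r)
    (hU.continuous_primitive.comp hU.continuous) fun x hx t => by simp [hU.eq_zero x hx]

lemma intervalIntegrable_freeEnergy (hU : IsHeatSolution Ω b f U) {s t : ℝ}
    (hs : 0 ≤ s) (hst : s ≤ t) (ht : t < b) :
    IntervalIntegrable (freeEnergy Ω f U) volume s t :=
  (hU.continuous_integral_primitive.intervalIntegrable _ _).sub
    ((hU.intervalIntegrable_dirichletEnergy hs hst ht).const_mul _)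

lemma exists_integral_sub_sq_le (hU : IsHeatSolution Ω b f U) :
    ∃ L : ℝ, 0 ≤ L ∧ ∀ s t, 0 ≤ s → s ≤ t → t < b → ∫ x, (U x t - U x s) ^ 2 ≤
      2 * (∫ τ in s..t, freeEnergy Ω f U τ) - 2 * (t - s) * freeEnergy Ω f U s +
        L * ∫ τ in s..t, ∫ x, (U x τ - U x s) ^ 2 := by
  obtain ⟨R, hR⟩ :=
    (hU.isCompact_closure.prod (isCompact_Icc (a := 0) (b := b))).exists_bound_of_continuousOn
    hU.continuous.continuousOn
  have hR' : ∀ x, ∀ t ∈ Icc 0 b, U x t ∈ Icc 0 (max R 0) := fun x t ht => by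
    refine ⟨hU.nonneg x t, ?_⟩
    by_cases hx : x ∈ Ω
    · exact ((le_abs_self _).trans (hR (x, t) ⟨subset_closure hx, ht⟩)).trans (le_max_left _ _)
    · rw [hU.eq_zero x hx]
      exact le_max_right _ _
  obtain ⟨L, hL⟩ := LocallyLipschitzOn.exists_lipschitzOnWith_of_compact
    (isCompact_Icc (a := 0) (b := max R 0)) (hU.locallyLipschitz.locallyLipschitzOn)
  refine ⟨2 * L, by positivity, fun s t hs hst ht => ?_⟩
  have hf := hU.locallyLipschitz.continuous
  have hP := hU.continuous_primitive
  have hPI := hU.continuous_integral_primitive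
  have hD : Continuous fun τ => ∫ x, (U x τ - U x s) ^ 2 :=
    hU.continuous_integral_sub_sq.comp (Continuous.prodMk_right s)
  have hcG : Continuous fun τ => ∫ x, f (U x τ) * (U x τ - U x s) := by
    refine hU.continuous_integral_of_eq_zero (h := fun x τ => f (U x τ) * (U x τ - U x s)) ?_
      fun x hx t => by simp [hU.eq_zero x hx]
    have hUc : Continuous fun p : EuclideanSpace ℝ (Fin N) × ℝ => U p.1 p.2 := hU.continuous
    simp only [Function.uncurry_def]
    fun_prop
  have h1 : ∀ τ ∈ Icc s t, ∫ x, f (U x τ) * (U x τ - U x s) ≤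
      ((∫ x, ∫ r in 0..U x τ, f r) - ∫ x, ∫ r in 0..U x s, f r) +
        L * ∫ x, (U x τ - U x s) ^ 2 := by
    intro τ hτ
    have hUs := hU.continuous_slice s
    have hUτ := hU.continuous_slice τ
    have i0 : Integrable fun x => f (U x τ) * (U x τ - U x s) :=
      hU.integrable_of_eq_zero (by fun_prop) fun x hx => by simp [hU.eq_zero x hx]
    have i1 : Integrable fun x => ∫ r in 0..U x τ, f r :=
      hU.integrable_of_eq_zero (hP.comp hUτ) fun x hx => by simp [hU.eq_zero x hx]
    have i2 : Integrable fun x => ∫ r in 0..U x s, f r :=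
      hU.integrable_of_eq_zero (hP.comp hUs) fun x hx => by simp [hU.eq_zero x hx]
    have i3 : Integrable fun x => L * (U x τ - U x s) ^ 2 :=
      hU.integrable_of_eq_zero (by fun_prop) fun x hx => by simp [hU.eq_zero x hx]
    have i4 : Integrable fun x => (∫ r in 0..U x τ, f r) - ∫ r in 0..U x s, f r := i1.sub i2
    rw [← integral_const_mul, ← integral_sub i1 i2, ← integral_add i4 i3]
    exact integral_mono i0 (i4.add i3) fun x => mul_sub_le_integral_add_sq hf (convex_Icc _ _) hL
      (hR' x τ ⟨hs.trans hτ.1, hτ.2.trans ht.le⟩) (hR' x s ⟨hs, hst.trans ht.le⟩)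
  have i5 : IntervalIntegrable (fun τ => (∫ x, ∫ r in 0..U x τ, f r) - ∫ x, ∫ r in 0..U x s, f r)
      volume s t := (hPI.sub continuous_const).intervalIntegrable _ _
  have i6 : IntervalIntegrable (fun τ => L * ∫ x, (U x τ - U x s) ^ 2) volume s t :=
    (hD.const_mul _).intervalIntegrable _ _
  have h2 := intervalIntegral.integral_mono_on hst (hcG.intervalIntegrable _ _) (i5.add i6) h1
  rw [intervalIntegral.integral_add i5 i6, intervalIntegral.integral_const_mul,
    intervalIntegral.integral_sub (hPI.intervalIntegrable _ _) (by simp),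
    intervalIntegral.integral_const, smul_eq_mul] at h2
  have h3 := hU.integral_sub_sq_add_dirichletEnergy_le hs hst ht
  have h4 : ∫ τ in s..t, freeEnergy Ω f U τ = (∫ τ in s..t, ∫ x, ∫ r in 0..U x τ, f r) -
      (1 / 2) * ∫ τ in s..t, dirichletEnergy Ω U τ := by
    rw [← intervalIntegral.integral_const_mul, ← intervalIntegral.integral_sub
      (hPI.intervalIntegrable _ _) ((hU.intervalIntegrable_dirichletEnergy hs hst ht).const_mul _)]
    rfl
  rw [h4, freeEnergy]
  linarith

lemma integral_sq_sub_integral_sq_le (hU : IsHeatSolution Ω b f U) {k : ℝ} (hk : 0 < k)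
    (s t : ℝ) : (∫ x, U x t ^ 2) - (∫ x, U x s ^ 2) ≤ k / 2 * (∫ x, (U x t - U x s) ^ 2) +
      1 / k * ((∫ x, U x t ^ 2) + ∫ x, U x s ^ 2) := by
  have hs := hU.continuous_slice s
  have ht := hU.continuous_slice t
  have h0 := hU.eq_zero
  have i1 : Integrable fun x => U x t ^ 2 :=
    hU.integrable_of_eq_zero (ht.pow 2) fun x hx => by simp [h0 x hx]
  have i2 : Integrable fun x => U x s ^ 2 :=
    hU.integrable_of_eq_zero (hs.pow 2) fun x hx => by simp [h0 x hx]
  have i3 : Integrable fun x => k / 2 * (U x t - U x s) ^ 2 :=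
    hU.integrable_of_eq_zero (((ht.sub hs).pow 2).const_mul _) fun x hx => by simp [h0 x hx]
  have i4 : Integrable fun x => U x t ^ 2 + U x s ^ 2 := i1.add i2
  rw [← integral_add i1 i2, ← integral_const_mul, ← integral_const_mul, ← integral_sub i1 i2,
    ← integral_add i3 (i4.const_mul _)]
  refine integral_mono (i1.sub i2) (i3.add (i4.const_mul _)) fun x => ?_
  have h1 : k / 2 * (U x t - U x s) ^ 2 + 1 / k * (U x t ^ 2 + U x s ^ 2) -
      (U x t ^ 2 - U x s ^ 2) =
      ((k * (U x t - U x s) - (U x t + U x s)) ^ 2 + (U x t - U x s) ^ 2) / (2 * k) := by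
    field_simp
    ring
  have h2 : 0 ≤ ((k * (U x t - U x s) - (U x t + U x s)) ^ 2 + (U x t - U x s) ^ 2) / (2 * k) := by
    positivity
  linarith

end IsHeatSolution

open Filter Topology in
/-- A short-time Gronwall inequality with quadratic forcing. -/
lemma eventually_le_mul_sq_of_le_add_integral {S : ℝ → ℝ} (hS : Continuous S)
    (hS0 : ∀ h, 0 ≤ S h) {κ L : ℝ} (hL : 0 ≤ L)
    (h : ∀ᶠ h in 𝓝[>] (0 : ℝ), S h ≤ κ * h ^ 2 + L * ∫ θ in 0..h, S θ) (hS00 : S 0 = 0) :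
    0 ≤ κ ∧ ∀ᶠ h in 𝓝[>] (0 : ℝ), S h ≤ κ * (1 + 2 * L * h) * h ^ 2 := by
  obtain ⟨δ, hδ0, hδ⟩ := mem_nhdsGT_iff_exists_Ioo_subset.1 h
  have hδ0 : 0 < δ := hδ0
  have key : ∀ᶠ h in 𝓝[>] (0 : ℝ), 0 ≤ κ ∧ S h ≤ κ * (1 + 2 * L * h) * h ^ 2 := by
    filter_upwards [Ioo_mem_nhdsGT (show 0 < min δ (1 / (2 * (L + 1))) by positivity)] with h hh
    have h0 : 0 < h := hh.1
    have hhδ : h < δ := hh.2.trans_le (min_le_left _ _)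
    have hhL : L * h ≤ 1 / 2 := by
      have := (hh.2.trans_le (min_le_right _ _)).le
      rw [le_div_iff₀ (by positivity)] at this
      nlinarith
    obtain ⟨m, hm, hmax⟩ := isCompact_Icc.exists_isMaxOn (nonempty_Icc.2 h0.le) hS.continuousOn
    have hInt : ∀ x ∈ Icc 0 h, ∫ θ in 0..x, S θ ≤ x * S m := fun x hx => by
      have : ∫ θ in 0..x, S θ ≤ ∫ _ in 0..x, S m :=
        intervalIntegral.integral_mono_on hx.1 (hS.intervalIntegrable _ _) (by simp)
          fun θ hθ => hmax ⟨hθ.1, hθ.2.trans hx.2⟩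
      simpa using this
    have hbd : ∀ x ∈ Ioc 0 h, S x ≤ κ * x ^ 2 + L * (x * S m) := fun x hx =>
      (show S x ≤ κ * x ^ 2 + L * ∫ θ in 0..x, S θ from hδ ⟨hx.1, hx.2.trans_lt hhδ⟩).trans
        (by gcongr; exact hInt x ⟨hx.1.le, hx.2⟩)
    have hh1 := hbd h ⟨h0, le_rfl⟩
    rcases hm.1.eq_or_lt with hm0 | hm0
    · rw [← hm0, hS00] at hh1
      have hκ : 0 ≤ κ := by
        by_contra! hneg
        nlinarith [hS0 h, mul_pos (neg_pos.2 hneg) (pow_pos h0 2)]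
      refine ⟨hκ, hh1.trans ?_⟩
      nlinarith [mul_nonneg (mul_nonneg hκ (mul_nonneg hL h0.le)) (sq_nonneg h)]
    · have h1 := hbd m ⟨hm0, hm.2⟩
      have h2 : L * (m * S m) ≤ 1 / 2 * S m := by
        rw [← mul_assoc]
        exact mul_le_mul_of_nonneg_right
          ((mul_le_mul_of_nonneg_left hm.2 hL).trans hhL) (hS0 m)
      have h3 : S m ≤ 2 * κ * m ^ 2 := by linarith
      have hκ : 0 ≤ κ := by
        by_contra! hneg
        nlinarith [hS0 m, mul_pos (neg_pos.2 hneg) (pow_pos hm0 2)]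
      have h4 : S m ≤ 2 * κ * h ^ 2 := h3.trans (by gcongr; exact hm.2)
      refine ⟨hκ, hh1.trans ?_⟩
      have := mul_le_mul_of_nonneg_left h4 (mul_nonneg hL h0.le)
      linarith
  exact ⟨key.exists.choose_spec.1, key.mono fun h hh => hh.2⟩

open Filter Topology in
lemma eventually_integral_sub_le_of_hasDerivAt {P : ℝ → ℝ} (hP : Continuous P) {t p q ε : ℝ}
    (hε : 0 < ε) (ht : HasDerivAt P p t)
    (h0 : ∀ᶠ θ in 𝓝[>] (0 : ℝ), θ * q ≤ P θ) :
    ∀ᶠ h in 𝓝[>] (0 : ℝ), (∫ θ in 0..h, (P (t + θ) - P t - P θ)) ≤ (p - q + ε) / 2 * h ^ 2 := by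
  have h1 := (hasDerivAt_iff_isLittleO_nhds_zero.1 ht).def hε
  have h2 : ∀ᶠ θ in 𝓝[>] (0 : ℝ), P (t + θ) - P t - P θ ≤ (p - q + ε) * θ := by
    filter_upwards [h0, nhdsWithin_le_nhds h1, self_mem_nhdsWithin] with θ hθ hθ1 hpos
    have hpos : 0 < θ := hpos
    rw [Real.norm_of_nonneg hpos.le, Real.norm_eq_abs] at hθ1
    have := (le_abs_self _).trans hθ1
    simp only [smul_eq_mul] at this
    linarith
  obtain ⟨δ, hδ0, hδ⟩ := mem_nhdsGT_iff_exists_Ioo_subset.1 h2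
  filter_upwards [Ioo_mem_nhdsGT hδ0] with h hh
  have h3 : ∫ θ in 0..h, (p - q + ε) * θ = (p - q + ε) / 2 * h ^ 2 := by
    rw [intervalIntegral.integral_const_mul, integral_id]
    ring
  rw [← h3]
  refine intervalIntegral.integral_mono_on_of_le_Ioo hh.1.le
    (Continuous.intervalIntegrable (by fun_prop) _ _)
    (Continuous.intervalIntegrable (by fun_prop) _ _) fun θ hθ => hδ ⟨hθ.1, hθ.2.trans hh.2⟩

open Filter Topology in
/-- Energy dissipation for a curve satisfying an integrated evolution variational inequality. -/
lemma energy_dissipation_of_hasDerivAt {E Ψ : ℝ → ℝ} {D : ℝ → ℝ → ℝ} {c L t : ℝ}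
    (hE : Continuous E) (hD : Continuous (Function.uncurry D)) (hD0 : ∀ s t, 0 ≤ D s t)
    (hDs : ∀ s, D s s = 0) (hL : 0 ≤ L) (hΨ : ∀ p q, IntervalIntegrable Ψ volume p q)
    (h1 : ∀ s r, 0 ≤ s → s ≤ r → r ≤ c →
      D s r ≤ 2 * (∫ τ in s..r, Ψ τ) - 2 * (r - s) * Ψ s + L * ∫ τ in s..r, D s τ)
    (h2 : ∀ k > 0, ∀ s r, E r - E s ≤ k / 2 * D s r + 1 / k * (E r + E s))
    (ht0 : 0 < t) (htc : t < c) (ht : HasDerivAt (fun x => ∫ τ in 0..x, Ψ τ) (Ψ t) t) :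
    Ψ 0 ≤ Ψ t ∧ ∀ k > 0,
      E t ≤ E 0 + k / 2 * (Ψ t - Ψ 0) + 2 / k * ∫ τ in 0..t, E τ := by
  set P : ℝ → ℝ := fun x => ∫ τ in 0..x, Ψ τ with hPdef
  have hP : Continuous P := intervalIntegral.continuous_primitive hΨ 0
  have hPsub : ∀ p q, ∫ τ in p..q, Ψ τ = P q - P p := fun p q =>
    (intervalIntegral.integral_interval_sub_left (hΨ _ _) (hΨ _ _)).symm
  set S : ℝ → ℝ := fun h => ∫ s in 0..t, D s (s + h) with hSdef
  have hDc : Continuous fun p : ℝ × ℝ => D p.1 p.2 := hD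
  have hDS : Continuous (Function.uncurry fun h s => D s (s + h)) := by
    simp only [Function.uncurry_def]
    fun_prop
  have hDS1 : ∀ h, Continuous fun s => D s (s + h) := fun h => by fun_prop
  have hS : Continuous S :=
    intervalIntegral.continuous_parametric_intervalIntegral_of_continuous' hDS 0 t
  have hSnn : ∀ h, 0 ≤ S h := fun h =>
    intervalIntegral.integral_nonneg ht0.le fun s _ => hD0 _ _
  have hS00 : S 0 = 0 := by simp [hSdef, hDs]
  have hP0 : ∀ ε > 0, ∀ᶠ θ in 𝓝[>] (0 : ℝ), θ * (Ψ 0 - ε) ≤ P θ := by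
    intro ε hε
    have hcont : Continuous (D 0) := hD.comp (Continuous.prodMk_right 0)
    have h3 : ∀ᶠ τ in 𝓝[>] (0 : ℝ), D 0 τ < 2 * ε / (L + 1) := by
      refine nhdsWithin_le_nhds (hcont.continuousAt.eventually_lt_const ?_)
      rw [hDs]
      positivity
    obtain ⟨δ, hδ0, hδ⟩ := mem_nhdsGT_iff_exists_Ioo_subset.1 h3
    filter_upwards [Ioo_mem_nhdsGT hδ0, Ioo_mem_nhdsGT (ht0.trans htc)] with θ hθ hθc
    have h4 := h1 0 θ le_rfl hθ.1.le hθc.2.le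
    rw [hPsub] at h4
    have h5 : ∫ τ in 0..θ, D 0 τ ≤ ∫ _ in 0..θ, 2 * ε / (L + 1) :=
      intervalIntegral.integral_mono_on_of_le_Ioo hθ.1.le (hcont.intervalIntegrable _ _)
        (by simp) fun τ hτ => (hδ ⟨hτ.1, hτ.2.trans hθ.2⟩ : D 0 τ < _).le
    rw [intervalIntegral.integral_const, smul_eq_mul, sub_zero] at h5
    have h6 : L * (θ * (2 * ε / (L + 1))) ≤ 2 * ε * θ := by
      have : L / (L + 1) ≤ 1 := (div_le_one (by positivity)).2 (by linarith)
      calc L * (θ * (2 * ε / (L + 1))) = L / (L + 1) * (2 * ε * θ) := by ring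
        _ ≤ 1 * (2 * ε * θ) := by
          have := hθ.1
          gcongr
        _ = _ := one_mul _
    have h7 := mul_le_mul_of_nonneg_left h5 hL
    have h8 : P 0 = 0 := by simp [hPdef]
    have h9 := hD0 0 θ
    rw [h8] at h4
    linarith
  have hSle : ∀ᶠ h in 𝓝[>] (0 : ℝ), S h ≤
      2 * (∫ θ in 0..h, (P (t + θ) - P t - P θ)) + L * ∫ θ in 0..h, S θ := by
    filter_upwards [Ioo_mem_nhdsGT (sub_pos.2 htc)] with h hh
    have h3 : ∀ s ∈ Icc 0 t, D s (s + h) ≤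
        2 * (P (s + h) - P s) - 2 * h * Ψ s + L * ∫ θ in 0..h, D s (s + θ) := by
      intro s hs
      have h4 := h1 s (s + h) hs.1 (by linarith [hh.1]) (by linarith [hh.2, hs.2])
      rwa [hPsub, add_sub_cancel_left, show (∫ τ in s..s + h, D s τ) = ∫ θ in 0..h, D s (s + θ) by
        rw [intervalIntegral.integral_comp_add_left (fun τ => D s τ), add_zero]] at h4
    have hDL : Continuous fun s => L * ∫ θ in 0..h, D s (s + θ) := by
      refine continuous_const.mul
        (intervalIntegral.continuous_parametric_intervalIntegral_of_continuous' ?_ 0 h)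
      simp only [Function.uncurry_def]
      fun_prop
    have j1 : IntervalIntegrable (fun s => 2 * (P (s + h) - P s)) volume 0 t :=
      Continuous.intervalIntegrable (by fun_prop) _ _
    have j2 : IntervalIntegrable (fun s => 2 * h * Ψ s) volume 0 t := (hΨ 0 t).const_mul _
    have j3 : IntervalIntegrable (fun s => L * ∫ θ in 0..h, D s (s + θ)) volume 0 t :=
      hDL.intervalIntegrable _ _
    have j4 : IntervalIntegrable (fun s => P (s + h)) volume 0 t :=
      Continuous.intervalIntegrable (by fun_prop) _ _
    have j6 : IntervalIntegrable (fun θ => P (t + θ) - P t) volume 0 h :=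
      Continuous.intervalIntegrable (by fun_prop) _ _
    have j7 : IntervalIntegrable (fun θ => P (t + θ)) volume 0 h :=
      Continuous.intervalIntegrable (by fun_prop) _ _
    have hPi : ∀ p q, IntervalIntegrable P volume p q := fun p q => hP.intervalIntegrable p q
    have h5 := intervalIntegral.integral_mono_on ht0.le ((hDS1 h).intervalIntegrable _ _)
      ((j1.sub j2).add j3) h3
    rw [intervalIntegral.integral_add (j1.sub j2) j3, intervalIntegral.integral_sub j1 j2,
      intervalIntegral.integral_const_mul, intervalIntegral.integral_const_mul,
      intervalIntegral.integral_const_mul, intervalIntegral.integral_sub j4 (hPi _ _), hPsub,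
      intervalIntegral.integral_comp_add_right (fun s => P s),
      intervalIntegral_intervalIntegral_swap] at h5
    · refine h5.trans_eq ?_
      rw [intervalIntegral.integral_sub j6 (hPi _ _), intervalIntegral.integral_sub j7 (by simp),
        intervalIntegral.integral_comp_add_left (fun s => P s), intervalIntegral.integral_const,
        smul_eq_mul, ← intervalIntegral.integral_add_adjacent_intervals (hPi (0 + h) t)
          (hPi t (t + h)),
        ← intervalIntegral.integral_add_adjacent_intervals (hPi 0 h) (hPi h t)]
      have h8 : P 0 = 0 := by simp [hPdef]
      simp only [zero_add, add_zero, h8, sub_zero]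
      ring
    · have hcont : Continuous (Function.uncurry fun s θ => D s (s + θ)) := by
        simp only [Function.uncurry_def]
        fun_prop
      exact (hcont.continuousOn.integrableOn_compact (isCompact_uIcc.prod isCompact_uIcc)).mono_set
        (prod_mono uIoc_subset_uIcc uIoc_subset_uIcc)
  have hκ : ∀ ε > 0, 0 ≤ Ψ t - Ψ 0 + ε ∧ ∀ᶠ h in 𝓝[>] (0 : ℝ),
      S h ≤ (Ψ t - Ψ 0 + ε) * (1 + 2 * L * h) * h ^ 2 := by
    intro ε hε
    refine eventually_le_mul_sq_of_le_add_integral hS hSnn hL ?_ hS00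
    filter_upwards [hSle, eventually_integral_sub_le_of_hasDerivAt hP (half_pos hε) ht
      (hP0 _ (half_pos hε))] with h h3 h4
    linarith
  refine ⟨le_of_forall_pos_le_add fun ε hε => by linarith [(hκ ε hε).1], fun k hk => ?_⟩
  have hfin : ∀ ε > 0, E t - E 0 ≤ k / 2 * (Ψ t - Ψ 0 + ε) + 2 / k * ∫ τ in 0..t, E τ := by
    intro ε hε
    have hlim := tendsto_integral_difference_quotient hE 0 t
    have hEs : Continuous fun h => ∫ s in 0..t, (E (s + h) + E s) := by
      refine intervalIntegral.continuous_parametric_intervalIntegral_of_continuous' ?_ 0 t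
      simp only [Function.uncurry_def]
      fun_prop
    have hrhs : Tendsto (fun h => k / 2 * ((Ψ t - Ψ 0 + ε) * (1 + 2 * L * h)) +
        1 / k * ∫ s in 0..t, (E (s + h) + E s)) (𝓝[>] 0)
        (𝓝 (k / 2 * (Ψ t - Ψ 0 + ε) + 2 / k * ∫ τ in 0..t, E τ)) := by
      have hc : Continuous fun h => k / 2 * ((Ψ t - Ψ 0 + ε) * (1 + 2 * L * h)) +
        1 / k * ∫ s in 0..t, (E (s + h) + E s) := by fun_prop
      refine (hc.tendsto' 0 _ ?_).mono_left nhdsWithin_le_nhds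
      simp only [mul_zero, add_zero, mul_one, ← two_mul, intervalIntegral.integral_const_mul]
      ring
    refine le_of_tendsto_of_tendsto hlim hrhs ?_
    filter_upwards [(hκ ε hε).2, self_mem_nhdsWithin] with h h3 h0
    have h0 : 0 < h := h0
    have j1 : IntervalIntegrable (fun s => k / h / 2 * D s (s + h)) volume 0 t :=
      ((hDS1 h).const_mul _).intervalIntegrable _ _
    have j2 : IntervalIntegrable (fun s => 1 / (k / h) * (E (s + h) + E s)) volume 0 t :=
      Continuous.intervalIntegrable (by fun_prop) _ _
    have h5 := intervalIntegral.integral_mono_on ht0.le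
      (Continuous.intervalIntegrable (by fun_prop) _ _) (j1.add j2)
      fun s _ => h2 (k / h) (by positivity) s (s + h)
    rw [intervalIntegral.integral_add j1 j2, intervalIntegral.integral_const_mul,
      intervalIntegral.integral_const_mul] at h5
    rw [div_le_iff₀ h0]
    refine h5.trans ?_
    have h6 := mul_le_mul_of_nonneg_left h3 (show 0 ≤ k / h / 2 by positivity)
    have h7 : k / h / 2 * ((Ψ t - Ψ 0 + ε) * (1 + 2 * L * h) * h ^ 2) =
        k / 2 * ((Ψ t - Ψ 0 + ε) * (1 + 2 * L * h)) * h := by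
      field_simp
    have h8 : 1 / (k / h) = 1 / k * h := by field_simp
    rw [h8, add_mul]
    rw [h7] at h6
    linarith
  refine le_of_forall_pos_le_add fun η hη => ?_
  have h3 := hfin (2 * η / k) (by positivity)
  have h4 : k / 2 * (2 * η / k) = η := by field_simp
  linarith

lemma sq_sub_le_of_forall_le {e e₀ d I : ℝ} (hd : 0 ≤ d) (hI : 0 ≤ I) (he : e₀ ≤ e)
    (h : ∀ k > 0, e ≤ e₀ + k / 2 * d + 2 / k * I) : (e - e₀) ^ 2 ≤ 4 * d * I := by
  rcases he.eq_or_lt with rfl | he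
  · rw [sub_self, zero_pow two_ne_zero]
    positivity
  have hpos : 0 < e - e₀ := sub_pos.2 he
  rcases hd.eq_or_lt with rfl | hd
  · have h1 := h (4 * (I + 1) / (e - e₀)) (by positivity)
    have h2 : 2 / (4 * (I + 1) / (e - e₀)) * I = (I / (I + 1)) * ((e - e₀) / 2) := by
      field_simp
      norm_num
    have h3 : (I / (I + 1)) * ((e - e₀) / 2) ≤ 1 * ((e - e₀) / 2) := by
      gcongr
      exact (div_le_one (by positivity)).2 (by linarith)
    rw [h2] at h1
    linarith
  · have h1 := h ((e - e₀) / d) (by positivity)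
    have h2 : (e - e₀) / d / 2 * d = (e - e₀) / 2 := by field_simp
    have h3 : 2 / ((e - e₀) / d) * I = 2 * d * I / (e - e₀) := by field_simp
    rw [h2, h3] at h1
    have h4 : (e - e₀) / 2 ≤ 2 * d * I / (e - e₀) := by linarith
    rw [le_div_iff₀ hpos] at h4
    linarith

/-- The concavity method: `E ≥ E(0) + ∫ (1 + σ) E² / A` with `A = M + ∫ E` forces `A ^ (-σ)` to
vanish before time `M / (σ E(0))`. -/
lemma le_div_of_integral_sq_div_le {E : ℝ → ℝ} (hE : Continuous E) (hE0 : ∀ t, 0 ≤ E t)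
    (hpos : 0 < E 0) {σ M c : ℝ} (hσ : 0 < σ) (hM : 0 < M) (hc : 0 ≤ c)
    (h : ∀ t ∈ Icc 0 c, E 0 + ∫ τ in 0..t,
      (1 + σ) * E τ ^ 2 / max (M + ∫ r in 0..τ, E r) M ≤ E t) :
    c ≤ M / (σ * E 0) := by
  set A : ℝ → ℝ := fun t => M + ∫ r in 0..t, E r with hA
  have hAd : ∀ t, HasDerivAt A (E t) t := fun t =>
    (hE.integral_hasStrictDerivAt 0 t).hasDerivAt.const_add M
  have hAc : Continuous A := continuous_iff_continuousAt.2 fun t => (hAd t).continuousAt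
  have hAM : ∀ t, 0 ≤ t → M ≤ A t := fun t ht =>
    le_add_of_nonneg_right (intervalIntegral.integral_nonneg ht fun r _ => hE0 r)
  have hA0 : A 0 = M := by simp [hA]
  set W : ℝ → ℝ := fun τ => (1 + σ) * E τ ^ 2 / max (A τ) M with hW
  have hWc : Continuous W := by
    refine Continuous.div (by fun_prop) (by fun_prop) fun τ => ?_
    exact (hM.trans_le (le_max_right _ _)).ne'
  set Y : ℝ → ℝ := fun t => E 0 + ∫ τ in 0..t, W τ with hY
  have hYd : ∀ t, HasDerivAt Y (W t) t := fun t =>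
    (hWc.integral_hasStrictDerivAt 0 t).hasDerivAt.const_add _
  have hYE : ∀ t ∈ Icc 0 c, Y t ≤ E t := h
  have hd1 : ∀ t ∈ Ioo 0 c, HasDerivAt (fun t => Y t * A t ^ (-(1 + σ)))
      (W t * A t ^ (-(1 + σ)) + Y t * (E t * -(1 + σ) * A t ^ (-(1 + σ) - 1))) t := fun t ht =>
    (hYd t).fun_mul ((hAd t).rpow_const (Or.inl (hM.trans_le (hAM t ht.1.le)).ne'))
  have hAcont : ∀ p : ℝ, ContinuousOn (fun t => A t ^ p) (Icc 0 c) := fun p =>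
    hAc.continuousOn.rpow_const fun t ht => Or.inl (hM.trans_le (hAM t ht.1)).ne'
  have hYc : Continuous Y := continuous_iff_continuousAt.2 fun t => (hYd t).continuousAt
  have hmono : MonotoneOn (fun t => Y t * A t ^ (-(1 + σ))) (Icc 0 c) := by
    refine monotoneOn_of_hasDerivWithinAt_nonneg (convex_Icc 0 c)
      (hYc.continuousOn.mul (hAcont _))
      (fun t ht => (hd1 t (by rwa [interior_Icc] at ht)).hasDerivWithinAt) fun t ht => ?_
    rw [interior_Icc] at ht
    have hAt : 0 < A t := hM.trans_le (hAM t ht.1.le)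
    have h1 := hYE t ⟨ht.1.le, ht.2.le⟩
    have h2 : A t ^ (-(1 + σ) - 1) = A t ^ (-(1 + σ)) / A t := by
      rw [Real.rpow_sub hAt, Real.rpow_one]
    have h3 : W t * A t ^ (-(1 + σ)) + Y t * (E t * -(1 + σ) * A t ^ (-(1 + σ) - 1)) =
        (1 + σ) * A t ^ (-(1 + σ)) / A t * (E t * (E t - Y t)) := by
      rw [h2, hW]
      simp only [max_eq_left (hAM t ht.1.le)]
      ring
    rw [h3]
    have := hE0 t
    have := sub_nonneg.2 h1
    positivity
  have hlow : ∀ t ∈ Icc 0 c, E 0 * M ^ (-(1 + σ)) ≤ E t * A t ^ (-(1 + σ)) := fun t ht => by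
    have hAt : 0 < A t := hM.trans_le (hAM t ht.1)
    have h1 := hmono ⟨le_rfl, hc⟩ ht ht.1
    simp only [hA0] at h1
    rw [show Y 0 = E 0 by simp [hY]] at h1
    exact h1.trans (mul_le_mul_of_nonneg_right (hYE t ht) (by positivity))
  set m := σ * (E 0 * M ^ (-(1 + σ))) with hm
  have hanti : AntitoneOn (fun t => A t ^ (-σ) + m * t) (Icc 0 c) := by
    refine antitoneOn_of_hasDerivWithinAt_nonpos (f' := fun t => E t * -σ * A t ^ (-σ - 1) + m)
      (convex_Icc 0 c) ((hAcont _).add (by fun_prop)) (fun t ht => ?_) fun t ht => ?_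
    · rw [interior_Icc] at ht
      have h1 := ((hAd t).rpow_const (p := -σ)
        (Or.inl (hM.trans_le (hAM t ht.1.le)).ne')).fun_add ((hasDerivAt_id t).const_mul m)
      simp only [mul_one, id_eq] at h1
      exact h1.hasDerivWithinAt
    · rw [interior_Icc] at ht
      have h1 := hlow t ⟨ht.1.le, ht.2.le⟩
      rw [show -σ - 1 = -(1 + σ) by ring, hm]
      nlinarith
  have hend := hanti ⟨le_rfl, hc⟩ ⟨hc, le_rfl⟩ hc
  have hAcpos : 0 < A c ^ (-σ) := Real.rpow_pos_of_pos (hM.trans_le (hAM c hc)) _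
  simp only [hA0, mul_zero, add_zero] at hend
  have h1 : M ^ (-σ) = M ^ (-(1 + σ)) * M := by
    rw [← Real.rpow_add_one hM.ne']
    ring_nf
  have h2 : 0 < M ^ (-(1 + σ)) := Real.rpow_pos_of_pos hM _
  rw [le_div_iff₀ (by positivity)]
  have h3 : m * c ≤ M ^ (-(1 + σ)) * M := by
    rw [← h1]
    linarith
  refine le_of_mul_le_mul_left ?_ h2
  calc M ^ (-(1 + σ)) * (c * (σ * E 0)) = m * c := by rw [hm]; ring
    _ ≤ _ := h3

/-- The abstract form of the concavity argument for a curve with integrated energy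
dissipation. -/
lemma le_div_of_energy_dissipation {E J : ℝ → ℝ} (hE : Continuous E) (hE0 : ∀ t, 0 ≤ E t)
    (hpos : 0 < E 0) {α c σ M : ℝ} (hα : 2 < α) (hc : 0 ≤ c) (hJ0 : 0 < J 0)
    (hσ : σ = √(α / 2) - 1)
    (hM : M = α / (α - 2) * (1 + √(α / 2)) * E 0 ^ 2 / (2 * α * J 0))
    (hJ : IntervalIntegrable J volume 0 c)
    (hgrow : ∀ t ∈ Icc 0 c, 2 * α * ∫ τ in 0..t, J τ ≤ E t - E 0)
    (hdiss : ∀ᵐ t, t ∈ Ioo 0 c → J 0 ≤ J t ∧ ∀ k > 0,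
      E t ≤ E 0 + k / 2 * (J t - J 0) + 2 / k * ∫ τ in 0..t, E τ) :
    c ≤ M / (σ * E 0) := by
  set a := √(α / 2) with ha
  have ha2 : α = 2 * a ^ 2 := by
    rw [ha, Real.sq_sqrt (by linarith)]
    ring
  have ha1 : 1 < a := by
    rw [ha, Real.lt_sqrt (by norm_num)]
    linarith
  have hσ0 : 0 < σ := by linarith
  have haσ : a = 1 + σ := by linarith
  have hM0 : 0 < M := by
    have : 0 < α - 2 := by linarith
    rw [hM]
    positivity
  have hMid : 2 * α * J 0 * M = a ^ 2 / σ * E 0 ^ 2 := by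
    have h1 : a - 1 ≠ 0 := by linarith
    have h2 : a + 1 ≠ 0 := by linarith
    have h3 : 2 * a ^ 2 - 2 ≠ 0 := by
      rw [show 2 * a ^ 2 - 2 = 2 * ((a - 1) * (a + 1)) by ring]
      positivity
    have h4 : a ^ 2 - 1 ≠ 0 := by
      intro h
      exact h3 (by linarith)
    rw [hM, hσ, ha2]
    field_simp
    ring
  have hJsub : ∀ t ∈ Icc 0 c, IntervalIntegrable J volume 0 t := fun t ht =>
    hJ.mono_set (by rw [uIcc_of_le ht.1, uIcc_of_le hc]; exact Icc_subset_Icc_right ht.2)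
  have hJae : ∀ t ∈ Icc 0 c, ∀ᵐ τ ∂volume.restrict (Icc 0 t), τ ∈ Ioo 0 c := fun t ht => by
    rw [← restrict_Ioo_eq_restrict_Icc]
    filter_upwards [ae_restrict_mem measurableSet_Ioo] with τ hτ
    exact ⟨hτ.1, hτ.2.trans_le ht.2⟩
  have hmono : ∀ t ∈ Icc 0 c, E 0 ≤ E t := by
    intro t ht
    have h1 : 0 ≤ ∫ τ in 0..t, J τ := by
      refine intervalIntegral.integral_nonneg_of_ae_restrict ht.1 ?_
      filter_upwards [hJae t ht, ae_restrict_of_ae hdiss] with τ hτ h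
      exact hJ0.le.trans (h hτ).1
    have := hgrow t ht
    nlinarith
  refine le_div_of_integral_sq_div_le hE hE0 hpos hσ0 hM0 hc fun t ht => ?_
  have hWc : Continuous fun τ => (1 + σ) * E τ ^ 2 / max (M + ∫ r in 0..τ, E r) M := by
    have : Continuous fun τ => ∫ r in 0..τ, E r :=
      intervalIntegral.continuous_primitive (fun _ _ => hE.intervalIntegrable _ _) 0
    refine Continuous.div (by fun_prop) (by fun_prop) fun τ => ?_
    exact (hM0.trans_le (le_max_right _ _)).ne'
  have h1 : (∫ τ in 0..t, (1 + σ) * E τ ^ 2 / max (M + ∫ r in 0..τ, E r) M) ≤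
      ∫ τ in 0..t, 2 * α * J τ := by
    refine intervalIntegral.integral_mono_ae_restrict ht.1 (hWc.intervalIntegrable _ _)
      ((hJsub t ht).const_mul _) ?_
    filter_upwards [hJae t ht, ae_restrict_of_ae hdiss] with τ hτ h
    obtain ⟨hJτ, hk⟩ := h hτ
    have hI : 0 ≤ ∫ r in 0..τ, E r := intervalIntegral.integral_nonneg hτ.1.le fun r _ => hE0 r
    rw [max_eq_left (le_add_of_nonneg_right hI), div_le_iff₀ (by positivity)]
    set I := ∫ r in 0..τ, E r
    have h2 := sq_sub_le_of_forall_le (sub_nonneg.2 hJτ) hI (hmono τ ⟨hτ.1.le, hτ.2.le⟩) hk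
    have h3 : (1 + σ) * E τ ^ 2 ≤ a ^ 2 * (E τ - E 0) ^ 2 + a ^ 2 / σ * E 0 ^ 2 := by
      have h4 : a ^ 2 * (E τ - E 0) ^ 2 + a ^ 2 / σ * E 0 ^ 2 - (1 + σ) * E τ ^ 2 =
          (1 + σ) / σ * (σ * E τ - (1 + σ) * E 0) ^ 2 := by
        rw [haσ]
        field_simp
        ring
      have h5 : 0 ≤ (1 + σ) / σ * (σ * E τ - (1 + σ) * E 0) ^ 2 := by positivity
      linarith
    have h6 : 2 * α * J τ * (M + I) = 4 * a ^ 2 * (J τ - J 0) * I + a ^ 2 / σ * E 0 ^ 2 +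
        2 * α * (J τ - J 0) * M + 2 * α * J 0 * I := by
      rw [← hMid, ha2]
      ring
    have h7 : 0 ≤ 2 * α * (J τ - J 0) * M := by
      have := sub_nonneg.2 hJτ
      positivity
    have h8 : 0 ≤ 2 * α * J 0 * I := by positivity
    have h9 := mul_le_mul_of_nonneg_left h2 (sq_nonneg a)
    rw [h6]
    linarith
  rw [intervalIntegral.integral_const_mul] at h1
  linarith [hgrow t ht]

namespace IsHeatSolution

variable {N : ℕ} {Ω : Set (EuclideanSpace ℝ (Fin N))} {b : ℝ} {f : ℝ → ℝ}
  {U : EuclideanSpace ℝ (Fin N) → ℝ → ℝ}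

lemma ae_energy_dissipation (hU : IsHeatSolution Ω b f U) {c : ℝ} (hc : 0 ≤ c) (hcb : c < b) :
    ∀ᵐ t, t ∈ Ioo 0 c → freeEnergy Ω f U 0 ≤ freeEnergy Ω f U t ∧ ∀ k > 0,
      ∫ x, U x t ^ 2 ≤ (∫ x, U x 0 ^ 2) + k / 2 * (freeEnergy Ω f U t - freeEnergy Ω f U 0) +
        2 / k * ∫ τ in 0..t, ∫ x, U x τ ^ 2 := by
  obtain ⟨L, hL, h1⟩ := hU.exists_integral_sub_sq_le
  set Ψ := (Icc 0 c).indicator (freeEnergy Ω f U) with hΨ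
  have hΨeq : ∀ r ∈ Icc 0 c, Ψ r = freeEnergy Ω f U r := fun r hr => indicator_of_mem hr _
  have hΨint : Integrable Ψ := by
    refine (integrable_indicator_iff measurableSet_Icc).2 ?_
    rw [integrableOn_Icc_iff_integrableOn_Ioc,
      ← intervalIntegrable_iff_integrableOn_Ioc_of_le hc]
    exact hU.intervalIntegrable_freeEnergy le_rfl hc hcb
  filter_upwards [LocallyIntegrable.ae_hasDerivAt_integral hΨint.locallyIntegrable] with t ht htc
  have key := energy_dissipation_of_hasDerivAt (D := fun s t => ∫ x, (U x t - U x s) ^ 2)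
    hU.continuous_integral_sq hU.continuous_integral_sub_sq
    (fun s t => integral_nonneg fun x => sq_nonneg _) (fun s => by simp) hL
    (fun p q => hΨint.intervalIntegrable) (c := c) ?_
    (fun k hk s r => hU.integral_sq_sub_integral_sq_le hk s r) htc.1 htc.2 (ht 0)
  · rwa [hΨeq 0 ⟨le_rfl, hc⟩, hΨeq t ⟨htc.1.le, htc.2.le⟩] at key
  · intro s r hs hsr hr
    rw [hΨeq s ⟨hs, hsr.trans hr⟩, show ∫ τ in s..r, Ψ τ = ∫ τ in s..r, freeEnergy Ω f U τ from
      intervalIntegral.integral_congr fun τ hτ => by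
        rw [uIcc_of_le hsr] at hτ
        exact hΨeq τ ⟨hs.trans hτ.1, hτ.2.trans hr⟩]
    exact h1 s r hs hsr (hr.trans_lt hcb)

lemma mul_freeEnergy_sub_le (hU : IsHeatSolution Ω b f U) {lam α β γ : ℝ} (hα : 2 < α)
    (hγ : 0 < γ) (hβ : β ≤ (α - 2) * lam / 2)
    (hC : ∀ u : ℝ, 0 < u → α * (∫ r in 0..u, f r) ≤ u * f u + β * u ^ 2 + γ) {t : ℝ}
    (hp : lam * ∫ x, U x t ^ 2 ≤ dirichletEnergy Ω U t) :
    α * (freeEnergy Ω f U t - γ * volume.real Ω) ≤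
      (∫ x, f (U x t) * U x t) - dirichletEnergy Ω U t := by
  have hUt := hU.continuous_slice t
  have h0 := hU.eq_zero
  have hf := hU.locallyLipschitz.continuous
  have i1 : Integrable fun x => ∫ r in 0..U x t, f r :=
    hU.integrable_of_eq_zero (hU.continuous_primitive.comp hUt) fun x hx => by simp [h0 x hx]
  have i2 : Integrable fun x => f (U x t) * U x t :=
    hU.integrable_of_eq_zero (by fun_prop) fun x hx => by simp [h0 x hx]
  have i3 : Integrable fun x => β * U x t ^ 2 :=
    hU.integrable_of_eq_zero (by fun_prop) fun x hx => by simp [h0 x hx]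
  have i4 : Integrable (Ω.indicator fun _ => γ) :=
    (integrable_indicator_iff hU.isOpen.measurableSet).2
      (integrableOn_const hU.isBounded.measure_lt_top.ne)
  have i5 : Integrable fun x => f (U x t) * U x t + β * U x t ^ 2 := i2.add i3
  have h1 : α * (∫ x, ∫ r in 0..U x t, f r) ≤
      (∫ x, f (U x t) * U x t) + β * (∫ x, U x t ^ 2) + γ * volume.real Ω := by
    have h2 : ∫ x, Ω.indicator (fun _ => γ) x = γ * volume.real Ω := by
      rw [integral_indicator hU.isOpen.measurableSet, setIntegral_const, smul_eq_mul, mul_comm]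
    rw [← h2, ← integral_const_mul, ← integral_const_mul, ← integral_add i2 i3,
      ← integral_add i5 i4]
    refine integral_mono (i1.const_mul α) (i5.add i4) fun x => ?_
    by_cases hx : x ∈ Ω
    · simp only [indicator_of_mem hx]
      rcases (hU.nonneg x t).eq_or_lt with h | h
      · simp [← h, hγ.le]
      · linarith [hC _ h, mul_comm (f (U x t)) (U x t)]
    · simp [hx, h0 x hx]
  have hE : 0 ≤ ∫ x, U x t ^ 2 := integral_nonneg fun x => sq_nonneg _
  have hV : 0 ≤ γ * volume.real Ω := by positivity
  have h3 := mul_le_mul_of_nonneg_right hβ hE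
  have h4 := mul_le_mul_of_nonneg_left hp (show 0 ≤ (α - 2) / 2 by linarith)
  have h5 := mul_le_mul_of_nonneg_right hα.le hV
  rw [freeEnergy]
  linarith

/-- A solution with Poincaré inequality and positive initial energy has a bounded lifespan. -/
lemma le_div_of_energy_pos (hU : IsHeatSolution Ω b f U) {lam α β γ σ M : ℝ} (hα : 2 < α)
    (hγ : 0 < γ) (hβ : β ≤ (α - 2) * lam / 2)
    (hC : ∀ u : ℝ, 0 < u → α * (∫ r in 0..u, f r) ≤ u * f u + β * u ^ 2 + γ)
    (hp : ∀ t ∈ Ico 0 b, lam * ∫ x, U x t ^ 2 ≤ dirichletEnergy Ω U t)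
    (hE0 : 0 < ∫ x, U x 0 ^ 2) (hJ0 : 0 < freeEnergy Ω f U 0 - γ * volume.real Ω)
    (hσ : σ = √(α / 2) - 1)
    (hM : M = α / (α - 2) * (1 + √(α / 2)) * (∫ x, U x 0 ^ 2) ^ 2 /
      (2 * α * (freeEnergy Ω f U 0 - γ * volume.real Ω)))
    {c : ℝ} (hc : 0 ≤ c) (hcb : c < b) : c ≤ M / (σ * ∫ x, U x 0 ^ 2) := by
  have hJi : ∀ t ∈ Icc 0 c, IntervalIntegrable (fun τ => freeEnergy Ω f U τ - γ * volume.real Ω)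
      volume 0 t := fun t ht =>
    (hU.intervalIntegrable_freeEnergy le_rfl ht.1 (ht.2.trans_lt hcb)).sub (by simp)
  refine le_div_of_energy_dissipation (E := fun t => ∫ x, U x t ^ 2)
    (J := fun t => freeEnergy Ω f U t - γ * volume.real Ω) hU.continuous_integral_sq
    (fun t => integral_nonneg fun x => sq_nonneg _) hE0 hα hc hJ0 hσ hM (hJi c ⟨hc, le_rfl⟩)
    (fun t ht => ?_) ?_
  · refine le_trans ?_ (hU.integral_comp_mul_sub_dirichletEnergy_le le_rfl ht.1
      (ht.2.trans_lt hcb))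
    rw [mul_assoc, ← intervalIntegral.integral_const_mul]
    refine mul_le_mul_of_nonneg_left ?_ zero_le_two
    refine intervalIntegral.integral_mono_on ht.1 ((hJi t ht).const_mul α)
      ((hU.continuous_integral_comp_mul_self.intervalIntegrable _ _).sub
        (hU.intervalIntegrable_dirichletEnergy le_rfl ht.1 (ht.2.trans_lt hcb))) fun τ hτ => ?_
    exact hU.mul_freeEnergy_sub_le hα hγ hβ hC (hp τ ⟨hτ.1, (hτ.2.trans ht.2).trans_lt hcb⟩)
  · filter_upwards [hU.ae_energy_dissipation hc hcb] with t ht htc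
    obtain ⟨h1, h2⟩ := ht htc
    refine ⟨by linarith, fun k hk => ?_⟩
    simpa only [sub_sub_sub_cancel_right] using h2 k hk

end IsHeatSolution

lemma eqOn_zero_of_setIntegral_sq_nonpos {N : ℕ} {Ω : Set (EuclideanSpace ℝ (Fin N))}
    (hΩ : IsOpen Ω) (hb : Bornology.IsBounded Ω) {w : EuclideanSpace ℝ (Fin N) → ℝ}
    (hw : ContinuousOn w (closure Ω)) (h : ∫ x in Ω, w x ^ 2 ≤ 0) : EqOn w 0 Ω := by
  have hi : IntegrableOn (fun x => w x ^ 2) Ω :=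
    ((hw.pow 2).integrableOn_compact hb.isCompact_closure).mono_set subset_closure
  have hnn : 0 ≤ᵐ[volume.restrict Ω] fun x => w x ^ 2 :=
    Filter.Eventually.of_forall fun x => sq_nonneg _
  have h1 := (setIntegral_eq_zero_iff_of_nonneg_ae hnn hi).1
    (h.antisymm (integral_nonneg fun x => sq_nonneg _))
  intro x hx
  have h2 := Measure.eqOn_open_of_ae_eq h1 hΩ ((hw.mono subset_closure).pow 2)
    continuousOn_const hx
  simpa using h2

/-- Under a Poincaré inequality the Dirichlet integrand is automatically integrable. -/
lemma integrableOn_gradient_sq_of_poincare {N : ℕ} {Ω : Set (EuclideanSpace ℝ (Fin N))}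
    (hΩ : IsOpen Ω) (hb : Bornology.IsBounded Ω) {w : EuclideanSpace ℝ (Fin N) → ℝ}
    (hw : ContinuousOn w (closure Ω)) {lam : ℝ} (hlam : 0 < lam)
    (hp : lam * ∫ x in Ω, w x ^ 2 ≤ ∫ x in Ω, ‖gradient w x‖ ^ 2) :
    IntegrableOn (fun x => ‖gradient w x‖ ^ 2) Ω := by
  by_contra hni
  rw [integral_undef hni] at hp
  have h0 := eqOn_zero_of_setIntegral_sq_nonpos hΩ hb hw
    (nonpos_of_mul_nonpos_right hp hlam)
  refine hni ?_
  have h1 : EqOn (fun x => ‖gradient w x‖ ^ 2) 0 Ω := fun x hx => by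
    have h2 : w =ᶠ[nhds x] fun _ => 0 := h0.eventuallyEq_of_mem (hΩ.mem_nhds hx)
    simp [h2.gradient_eq]
  exact (integrableOn_congr_fun h1 hΩ.measurableSet).2 integrableOn_zero

open Filter Topology in
lemma isHeatSolution_indicator {N : ℕ} {Ω : Set (EuclideanSpace ℝ (Fin N))}
    (hΩ : IsOpen Ω) (hΩb : Bornology.IsBounded Ω) {f : ℝ → ℝ} (hf : LocallyLipschitz f)
    (hf0 : f 0 = 0) {T b : ℝ} (hb : 0 < b) (hbT : b < T)
    {u : EuclideanSpace ℝ (Fin N) → ℝ → ℝ}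
    (hcont : ContinuousOn (fun q : EuclideanSpace ℝ (Fin N) × ℝ => u q.1 q.2)
      (closure Ω ×ˢ Ico 0 T))
    (hx : ∀ t ∈ Ioo (0 : ℝ) T, ContDiffOn ℝ 2 (fun x => u x t) Ω)
    (ht : ∀ x ∈ Ω, ContDiffOn ℝ 1 (u x) (Ioo (0 : ℝ) T))
    (hnn : ∀ x ∈ closure Ω, ∀ t ∈ Ico (0 : ℝ) T, 0 ≤ u x t)
    (hpde : ∀ x ∈ Ω, ∀ t ∈ Ioo (0 : ℝ) T,
      deriv (u x) t = laplacian (fun y => u y t) x + f (u x t))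
    (hbd : ∀ x ∈ frontier Ω, ∀ t ∈ Ico (0 : ℝ) T, u x t = 0)
    (h0 : ContDiffOn ℝ 1 (fun x => u x 0) Ω)
    (hInt : ∀ t ∈ Ico 0 T, IntegrableOn (fun x => ‖gradient (fun y => u y t) x‖ ^ 2) Ω) :
    IsHeatSolution Ω b f (fun x t => Ω.indicator (fun y => u y (max 0 (min t b))) x) := by
  classical
  have hcl : ∀ t, max 0 (min t b) ∈ Ico 0 T := fun t =>
    ⟨le_max_left _ _, max_lt (hb.trans hbT) ((min_le_right _ _).trans_lt hbT)⟩
  have hclid : ∀ t ∈ Icc 0 b, max 0 (min t b) = t := fun t h => by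
    rw [min_eq_left h.2, max_eq_right h.1]
  have hslice : ∀ x ∈ Ω, ∀ t ∈ Icc 0 b,
      (fun y => Ω.indicator (fun y => u y (max 0 (min t b))) y) =ᶠ[𝓝 x] fun y => u y t := by
    intro x hx t ht
    filter_upwards [hΩ.mem_nhds hx] with y hy
    rw [indicator_of_mem hy, hclid t ht]
  have hgrad : ∀ x ∈ Ω, ∀ t ∈ Icc 0 b,
      gradient (fun y => Ω.indicator (fun y => u y (max 0 (min t b))) y) =ᶠ[𝓝 x]
        gradient fun y => u y t := fun x hx t ht => by
    filter_upwards [hΩ.mem_nhds hx] with y hy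
    exact (hslice y hy t ht).gradient_eq
  refine ⟨hΩ, hΩb, hf, hf0, ?_, fun x hx t => indicator_of_notMem hx _, fun x t => ?_, ?_, ?_, ?_,
    ?_⟩
  · have h1 : (Function.uncurry fun x t => Ω.indicator (fun y => u y (max 0 (min t b))) x) =
        (Ω ×ˢ (univ : Set ℝ)).piecewise (fun q => u q.1 (max 0 (min q.2 b))) fun _ => 0 := by
      ext ⟨x, t⟩
      by_cases hx : x ∈ Ω <;> simp [piecewise, hx]
    rw [h1]
    refine continuous_piecewise ?_ ?_ continuousOn_const
    · rintro ⟨x, t⟩ h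
      rw [frontier_prod_univ_eq] at h
      exact hbd x h.1 _ (hcl t)
    · rw [closure_prod_eq, closure_univ]
      refine hcont.comp (f := fun q : EuclideanSpace ℝ (Fin N) × ℝ => (q.1, max 0 (min q.2 b)))
        (by fun_prop) ?_
      rintro ⟨x, t⟩ h
      exact ⟨h.1, hcl t⟩
  · exact indicator_nonneg (fun y hy => hnn y (subset_closure hy) _ (hcl t)) x
  · refine h0.congr fun x hx => ?_
    rw [indicator_of_mem hx, hclid 0 ⟨le_rfl, hb.le⟩]
  · intro x hxΩ t htb
    exact ((hx t ⟨htb.1, htb.2.trans hbT⟩).contDiffAt (hΩ.mem_nhds hxΩ)).congr_of_eventuallyEq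
      (hslice x hxΩ t ⟨htb.1.le, htb.2.le⟩)
  · intro x hxΩ t htb
    have htT : t ∈ Ioo 0 T := ⟨htb.1, htb.2.trans hbT⟩
    have htc : t ∈ Icc 0 b := ⟨htb.1.le, htb.2.le⟩
    have h1 : HasDerivAt (u x) (deriv (u x) t) t :=
      (((ht x hxΩ).contDiffAt (isOpen_Ioo.mem_nhds htT)).differentiableAt one_ne_zero).hasDerivAt
    have h2 : (fun t => Ω.indicator (fun y => u y (max 0 (min t b))) x) =ᶠ[𝓝 t] u x := by
      filter_upwards [isOpen_Ioo.mem_nhds htb] with r hr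
      rw [indicator_of_mem hxΩ, hclid r ⟨hr.1.le, hr.2.le⟩]
    have h3 : laplacian (fun y => Ω.indicator (fun y => u y (max 0 (min t b))) y) x =
        laplacian (fun y => u y t) x := by
      rw [laplacian, laplacian, (hgrad x hxΩ t htc).fderiv_eq]
    refine (h1.congr_of_eventuallyEq h2).congr_deriv ?_
    rw [h3, hpde x hxΩ t htT, indicator_of_mem hxΩ, hclid t htc]
  · intro t htb
    have htc : t ∈ Icc 0 b := ⟨htb.1, htb.2.le⟩
    refine (integrableOn_congr_fun (fun x hx => ?_) hΩ.measurableSet).1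
      (hInt t ⟨htb.1, htb.2.trans hbT⟩)
    rw [(hslice x hx t htc).gradient_eq]

/-- Blow-up (with explicit bound on the blow-up time) for nonnegative classical solutions of
`u_t = Δu + f(u)` with Dirichlet boundary conditions, under the condition `(C)`:
`α F(u) ≤ u f(u) + β u² + γ` with `0 < β ≤ (α-2)λ₁/2`, and initial energy `J(0) > 0`. -/
theorem blowup_heat_condition_C
    {N : ℕ} (hN : 1 ≤ N)
    (Ω : Set (EuclideanSpace ℝ (Fin N)))
    (hΩopen : IsOpen Ω) (hΩbdd : Bornology.IsBounded Ω) (hΩne : Ω.Nonempty)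
    (lam1 : ℝ) (hlam1 : 0 < lam1)
    (f : ℝ → ℝ) (hfLip : LocallyLipschitz f) (hf0 : f 0 = 0)
    (hfpos : ∀ u : ℝ, 0 < u → 0 < f u)
    (F : ℝ → ℝ) (hF : ∀ u : ℝ, F u = ∫ s in (0:ℝ)..u, f s)
    (α β γ : ℝ) (hα : 2 < α) (hβ : 0 < β) (hγ : 0 < γ)
    (hβle : β ≤ (α - 2) * lam1 / 2)
    (hC : ∀ u : ℝ, 0 < u → α * F u ≤ u * f u + β * u ^ 2 + γ)
    (u₀ : EuclideanSpace ℝ (Fin N) → ℝ)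
    (hu₀C1 : ContDiffOn ℝ 1 u₀ (closure Ω))
    (hu₀nonneg : ∀ x ∈ closure Ω, 0 ≤ u₀ x)
    (hu₀netriv : ∃ x ∈ closure Ω, u₀ x ≠ 0)
    (hu₀bdry : ∀ x ∈ frontier Ω, u₀ x = 0)
    (J0 : ℝ)
    (hJ0def : J0 = -(1/2) * (∫ x in Ω, ‖gradient u₀ x‖ ^ 2)
      + ∫ x in Ω, (F (u₀ x) - γ))
    (hJ0pos : 0 < J0)
    (σ M : ℝ)
    (hσdef : σ = Real.sqrt (α / 2) - 1)
    (hMdef : M = (α / (α - 2)) * (1 + Real.sqrt (α / 2))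
      * (∫ x in Ω, (u₀ x) ^ 2) ^ 2 / (2 * α * J0)) :
    ∀ T : ℝ, 0 < T →
    ∀ u : EuclideanSpace ℝ (Fin N) → ℝ → ℝ,
      -- continuity on cl(Ω) × [0,T)
      ContinuousOn (fun q : EuclideanSpace ℝ (Fin N) × ℝ => u q.1 q.2)
        (closure Ω ×ˢ Set.Ico 0 T) →
      -- twice continuously differentiable in space on Ω × (0,T)
      (∀ t ∈ Set.Ioo (0:ℝ) T, ContDiffOn ℝ 2 (fun x => u x t) Ω) →
      -- once continuously differentiable in time on Ω × (0,T)
      (∀ x ∈ Ω, ContDiffOn ℝ 1 (u x) (Set.Ioo (0:ℝ) T)) →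
      -- nonnegativity
      (∀ x ∈ closure Ω, ∀ t ∈ Set.Ico (0:ℝ) T, 0 ≤ u x t) →
      -- the PDE on Ω × (0,T)
      (∀ x ∈ Ω, ∀ t ∈ Set.Ioo (0:ℝ) T,
        deriv (u x) t = laplacian (fun y => u y t) x + f (u x t)) →
      -- Dirichlet boundary condition
      (∀ x ∈ frontier Ω, ∀ t ∈ Set.Ico (0:ℝ) T, u x t = 0) →
      -- initial condition
      (∀ x ∈ closure Ω, u x 0 = u₀ x) →
      -- Poincaré inequality with constant λ₁ for the solution
      (∀ t ∈ Set.Ico (0:ℝ) T,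
        lam1 * ∫ x in Ω, (u x t) ^ 2 ≤ ∫ x in Ω, ‖gradient (fun y => u y t) x‖ ^ 2) →
      T ≤ M / (σ * ∫ x in Ω, (u₀ x) ^ 2) := by
  intro T hT u hcont hux hut hunn hpde hbd hinit hpoin
  have hcl0 : (0 : ℝ) ∈ Ico 0 T := ⟨le_rfl, hT⟩
  have hu₀c : ContinuousOn u₀ (closure Ω) := hu₀C1.continuousOn
  have hslicec : ∀ t ∈ Ico 0 T, ContinuousOn (fun x => u x t) (closure Ω) := fun t ht =>
    hcont.comp (f := fun x => (x, t)) (by fun_prop) fun x hx => ⟨hx, ht⟩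
  have hE0 : 0 < ∫ x in Ω, u₀ x ^ 2 := by
    by_contra! hle
    have h1 := eqOn_zero_of_setIntegral_sq_nonpos hΩopen hΩbdd hu₀c hle
    obtain ⟨x, hx, hne⟩ := hu₀netriv
    by_cases hxΩ : x ∈ Ω
    · exact hne (h1 hxΩ)
    · exact hne (hu₀bdry x ⟨hx, fun h => hxΩ (interior_subset h)⟩)
  have hInt : ∀ t ∈ Ico 0 T, IntegrableOn (fun x => ‖gradient (fun y => u y t) x‖ ^ 2) Ω :=
    fun t ht => integrableOn_gradient_sq_of_poincare hΩopen hΩbdd (hslicec t ht) hlam1 (hpoin t ht)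
  have hu0 : ContDiffOn ℝ 1 (fun x => u x 0) Ω :=
    (hu₀C1.mono subset_closure).congr fun x hx => hinit x (subset_closure hx)
  by_contra! hlt
  obtain ⟨c, hc, hcT⟩ := exists_between (max_lt hT hlt)
  obtain ⟨b, hcb, hbT⟩ := exists_between hcT
  have hc0 : 0 < c := (le_max_left _ _).trans_lt hc
  have hU := isHeatSolution_indicator hΩopen hΩbdd hfLip hf0 (hc0.trans hcb) hbT hcont hux hut
    hunn hpde hbd hu0 hInt
  set U : EuclideanSpace ℝ (Fin N) → ℝ → ℝ :=
    fun x t => Ω.indicator (fun y => u y (max 0 (min t b))) x with hUdef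
  have hUeq : ∀ t ∈ Ico 0 b, ∀ x ∈ Ω, U x t = u x t := fun t ht x hx => by
    rw [hUdef]
    simp only [indicator_of_mem hx]
    rw [min_eq_left ht.2.le, max_eq_right ht.1]
  have hUsq : ∀ t ∈ Ico 0 b, ∫ x, U x t ^ 2 = ∫ x in Ω, u x t ^ 2 := fun t ht => by
    rw [← setIntegral_eq_integral_of_forall_compl_eq_zero (s := Ω) fun x hx => by
      simp [hU.eq_zero x hx]]
    exact setIntegral_congr_fun hΩopen.measurableSet fun x hx => by simp only [hUeq t ht x hx]
  have hUdir : ∀ t ∈ Ico 0 b,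
      dirichletEnergy Ω U t = ∫ x in Ω, ‖gradient (fun y => u y t) x‖ ^ 2 := fun t ht =>
    setIntegral_congr_fun hΩopen.measurableSet fun x hx => by
      have h1 : (fun y => U y t) =ᶠ[nhds x] fun y => u y t := by
        filter_upwards [hΩopen.mem_nhds hx] with y hy using hUeq t ht y hy
      simp only [h1.gradient_eq]
  have h0b : (0 : ℝ) ∈ Ico 0 b := ⟨le_rfl, hc0.trans hcb⟩
  have hUE : ∫ x, U x 0 ^ 2 = ∫ x in Ω, u₀ x ^ 2 := by
    rw [hUsq 0 h0b]
    exact setIntegral_congr_fun hΩopen.measurableSet fun x hx => by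
      simp only [hinit x (subset_closure hx)]
  have hUJ : freeEnergy Ω f U 0 - γ * volume.real Ω = J0 := by
    have h1 : dirichletEnergy Ω U 0 = ∫ x in Ω, ‖gradient u₀ x‖ ^ 2 := by
      rw [hUdir 0 h0b]
      refine setIntegral_congr_fun hΩopen.measurableSet fun x hx => ?_
      have h2 : (fun y => u y 0) =ᶠ[nhds x] u₀ := by
        filter_upwards [hΩopen.mem_nhds hx] with y hy using hinit y (subset_closure hy)
      simp only [h2.gradient_eq]
    have hFc : Continuous F := by
      rw [funext hF]
      exact hU.continuous_primitive
    have h2 : ∫ x, ∫ r in 0..U x 0, f r = ∫ x in Ω, F (u₀ x) := by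
      rw [← setIntegral_eq_integral_of_forall_compl_eq_zero (s := Ω) fun x hx => by
        simp [hU.eq_zero x hx]]
      exact setIntegral_congr_fun hΩopen.measurableSet fun x hx => by
        simp only [hUeq 0 h0b x hx, hinit x (subset_closure hx), hF]
    have i1 : IntegrableOn (fun x => F (u₀ x)) Ω :=
      ((hFc.comp_continuousOn hu₀c).integrableOn_compact hΩbdd.isCompact_closure).mono_set
        subset_closure
    have i2 : IntegrableOn (fun _ : EuclideanSpace ℝ (Fin N) => γ) Ω :=
      integrableOn_const hΩbdd.measure_lt_top.ne
    rw [freeEnergy, h1, h2, hJ0def, integral_sub i1 i2, setIntegral_const, smul_eq_mul]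
    ring
  have key := hU.le_div_of_energy_pos (lam := lam1) (α := α) (β := β) (γ := γ) (σ := σ) (M := M)
    hα hγ hβle (fun w hw => by simpa only [hF] using hC w hw)
    (fun t ht => by
      rw [hUsq t ht, hUdir t ht]
      exact hpoin t ⟨ht.1, ht.2.trans hbT⟩)
    (by rwa [hUE]) (by rwa [hUJ]) hσdef (by rw [hUE, hUJ, hMdef]) hc0.le hcb
  rw [hUE] at key
  exact absurd ((le_max_right _ _).trans_lt hc) key.not_gt
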